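/- Let E₁ and E₂ be countable Borel equivalence relations on standard Borel spaces X₁ and X₂, and let μ₁, μ₂ be σ-finite Borel measures on X₁, X₂ respectively. If E₁ is μ₁-amenable and E₂ is μ₂-amenable, then the product equivalence relation E₁ × E₂ on X₁ × X₂, defined by (x₁, x₂) ∼ (y₁, y₂) if and only if (x₁, y₁) ∈ E₁ and (x₂, y₂) ∈ E₂, is (μ₁ ⊗ μ₂)-amenable with respect to the product measure μ₁ ⊗ μ₂. -/

import Mathlib

open MeasureTheory

/-- E is *μ-amenable* if there is an E-invariant μ-measurable assignment x ↦ ν_x of finitely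
additive probability measures with ν_x([x]_E) = 1. -/
def MuAmenable {X : Type*} [MeasurableSpace X] (μ : Measure X) (E : X → X → Prop) : Prop :=
  ∃ ν : X → Set X → ℝ,
    (∀ x A, 0 ≤ ν x A) ∧
    (∀ x, ν x Set.univ = 1) ∧
    (∀ x A B, Disjoint A B → ν x (A ∪ B) = ν x A + ν x B) ∧
    (∀ x, ν x {y | E x y} = 1) ∧
    (∀ x y, E x y → ν x = ν y) ∧
    (∀ A : Set (X × X), MeasurableSet A →
      AEMeasurable (fun x => ν x {y | (x, y) ∈ A}) μ)

set_option linter.unusedSectionVars false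

namespace LusinNovikov

open Set

section Separation
variable {X : Type*} [TopologicalSpace X] [T2Space X] [MeasurableSpace X] [OpensMeasurableSpace X]

theorem AnalyticSet.inter' {A B : Set X} (hA : AnalyticSet A) (hB : AnalyticSet B) :
    AnalyticSet (A ∩ B) := by
  rw [inter_eq_iInter]
  exact AnalyticSet.iInter fun b => by cases b <;> simpa

/-- Simultaneous Borel separation of finitely many analytic sets with empty intersection. -/
theorem analytic_separation_finset [PolishSpace X] [BorelSpace X] {ι : Type*} (A : ι → Set X)
    (hA : ∀ i, AnalyticSet (A i)) (s : Finset ι) :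
    ∀ B : Set X, AnalyticSet B → B ∩ (⋂ i ∈ s, A i) = ∅ →
      ∃ (Z : ι → Set X) (Z' : Set X), (∀ i, MeasurableSet (Z i)) ∧ MeasurableSet Z' ∧
        (∀ i, A i ⊆ Z i) ∧ B ⊆ Z' ∧ Z' ∩ (⋂ i ∈ s, Z i) = ∅ := by
  classical
  induction s using Finset.induction_on with
  | empty =>
    intro B _ hB
    refine ⟨fun _ => univ, ∅, fun _ => .univ, .empty, fun _ => subset_univ _, ?_, by simp⟩
    simpa using hB
  | insert j s hj ih =>
    intro B hB h
    obtain ⟨Z, Z', hZ, hZ', hAZ, hBZ, hemp⟩ := ih (B ∩ A j) (AnalyticSet.inter' hB (hA j)) (by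
      rw [Finset.set_biInter_insert, ← inter_assoc] at h; exact h)
    obtain ⟨V, hV1, hV2, hV⟩ := AnalyticSet.measurablySeparable
      (AnalyticSet.inter' hB hZ'.compl.analyticSet)
      (AnalyticSet.inter' (hA j) hZ'.compl.analyticSet)
      (by
        rw [Set.disjoint_left]
        rintro x ⟨hx, hx'⟩ ⟨hx2, _⟩
        exact hx' (hBZ ⟨hx, hx2⟩))
    refine ⟨fun i => if i = j then (Vᶜ ∪ Z') else Z i, V ∪ Z', ?_, hV.union hZ', ?_, ?_, ?_⟩
    · intro i; dsimp only; split_ifs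
      · exact hV.compl.union hZ'
      · exact hZ i
    · intro i; dsimp only; split_ifs with hi
      · subst hi
        intro x hx
        by_cases hxz : x ∈ Z'
        · exact Or.inr hxz
        · exact Or.inl fun hxV => (Set.disjoint_left.1 hV2 ⟨hx, hxz⟩ hxV)
      · exact hAZ i
    · intro x hx
      by_cases hxz : x ∈ Z'
      · exact Or.inr hxz
      · exact Or.inl (hV1 ⟨hx, hxz⟩)
    · rw [eq_empty_iff_forall_notMem] at hemp ⊢
      rintro x ⟨hx, hx'⟩
      simp only [mem_iInter, Finset.mem_insert] at hx'
      have hj' := hx' j (Or.inl rfl)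
      simp only [if_true] at hj'
      have hxz : x ∈ Z' := by
        rcases hx with hx | hx
        · rcases hj' with hj' | hj'
          · exact absurd hx hj'
          · exact hj'
        · exact hx
      refine hemp x ⟨hxz, ?_⟩
      simp only [mem_iInter]
      intro i hi
      have := hx' i (Or.inr hi)
      rwa [if_neg (by rintro rfl; exact hj hi)] at this

end Separation

section Core
variable {S X : Type*} [MetricSpace S] [CompleteSpace S] [SecondCountableTopology S]
  [MeasurableSpace S] [BorelSpace S]
  [TopologicalSpace X] [PolishSpace X] [MeasurableSpace X] [BorelSpace X]

/-- `A` is covered by countably many Borel sets on which `f` is injective. -/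
def Small (f : S → X) (A : Set S) : Prop :=
  ∃ C : ℕ → Set S, (∀ n, MeasurableSet (C n) ∧ InjOn f (C n)) ∧ A ⊆ ⋃ n, C n

def Thin {ι : Type*} (f : S → X) (U : ι → Set S) : Prop :=
  ∃ Y : ι → Set X, (∀ i, MeasurableSet (Y i)) ∧ (⋃ i, Y i) = univ ∧
    ∀ i, Small f (U i ∩ f ⁻¹' Y i)

theorem Small.empty (f : S → X) : Small f ∅ :=
  ⟨fun _ => ∅, fun _ => ⟨.empty, injOn_empty _⟩, empty_subset _⟩

theorem exists_mem_of_not_thin {ι : Type*} [Finite ι] [Nonempty ι] {f : S → X}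
    (hf : Continuous f) {U : ι → Set S} (hU : ∀ i, IsOpen (U i)) (h : ¬ Thin f U) :
    ∃ x, ∀ i, x ∈ f '' U i := by
  classical
  by_contra! hcon
  have := Fintype.ofFinite ι
  obtain ⟨Z, Z', hZ, hZ', hAZ, hBZ, hemp⟩ := analytic_separation_finset (fun i => f '' U i)
    (fun i => (hU i).analyticSet_image hf) Finset.univ univ
    (MeasurableSet.univ.analyticSet) (by
      rw [eq_empty_iff_forall_notMem]
      rintro x ⟨-, hx⟩
      obtain ⟨i, hi⟩ := hcon x
      simp only [mem_iInter] at hx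
      exact hi (hx i (Finset.mem_univ _)))
  rw [univ_subset_iff.1 hBZ, univ_inter] at hemp
  refine h ⟨fun i => (Z i)ᶜ, fun i => (hZ i).compl, ?_, fun i => ?_⟩
  · rw [← compl_iInter]
    simp only [Finset.mem_univ, iInter_true] at hemp
    rw [hemp, compl_empty]
  · convert Small.empty f
    rw [eq_empty_iff_forall_notMem]
    rintro s ⟨hs, hs'⟩
    exact hs' (hAZ i ⟨s, hs, rfl⟩)

/-- The pairs of basic open sets used to split an open set. -/
def splitPairs (U : Set S) (ε : ℝ) : Set (Bool → Set S) :=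
  {v | (∀ b, v b ∈ TopologicalSpace.countableBasis S) ∧ (∀ b, closure (v b) ⊆ U) ∧
    Disjoint (closure (v true)) (closure (v false)) ∧
    ∀ b, ∀ s ∈ v b, ∀ t ∈ v b, dist s t ≤ ε}

theorem splitPairs_countable (U : Set S) (ε : ℝ) : (splitPairs U ε).Countable := by
  have h := TopologicalSpace.countable_countableBasis S
  refine (Set.countable_univ_pi (s := fun _ : Bool => TopologicalSpace.countableBasis S)
    fun _ => h).mono ?_
  intro v hv
  simpa using hv.1

theorem exists_splitPair {U : Set S} (hU : IsOpen U) {ε : ℝ} (hε : 0 < ε) {s t : S} (hs : s ∈ U)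
    (ht : t ∈ U) (hst : s ≠ t) : ∃ v ∈ splitPairs U ε, s ∈ v true ∧ t ∈ v false := by
  have key : ∀ p ∈ U, ∃ B ∈ TopologicalSpace.countableBasis S, p ∈ B ∧ closure B ⊆ U ∧
      closure B ⊆ Metric.closedBall p (dist s t / 3) ∧ ∀ a ∈ B, ∀ b ∈ B, dist a b ≤ ε := by
    intro p hp
    have hd : 0 < dist s t := dist_pos.2 hst
    obtain ⟨r, hr, hrU⟩ := Metric.isOpen_iff.1 hU p hp
    set q := min (r / 2) (min (dist s t / 3) (ε / 2)) with hq
    have hq0 : 0 < q := by positivity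
    obtain ⟨B, hB, hpB, hBs⟩ := (TopologicalSpace.isBasis_countableBasis S).exists_subset_of_mem_open
      (Metric.mem_ball_self hq0) (Metric.isOpen_ball (x := p) (ε := q))
    have hcl : closure B ⊆ Metric.closedBall p q :=
      closure_minimal (hBs.trans Metric.ball_subset_closedBall) Metric.isClosed_closedBall
    refine ⟨B, hB, hpB, ?_, ?_, ?_⟩
    · refine (hcl.trans ?_).trans hrU
      apply Metric.closedBall_subset_ball
      have : q ≤ r / 2 := min_le_left _ _
      linarith
    · exact hcl.trans (Metric.closedBall_subset_closedBall ((min_le_right _ _).trans (min_le_left _ _)))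
    · intro a ha b hb
      have h1 := hBs ha; have h2 := hBs hb
      rw [Metric.mem_ball] at h1 h2
      have h3 : q ≤ ε / 2 := (min_le_right _ _).trans (min_le_right _ _)
      have := dist_triangle_right a b p
      linarith
  obtain ⟨B, hB, hsB, hBU, hBc, hBd⟩ := key s hs
  obtain ⟨C, hC, htC, hCU, hCc, hCd⟩ := key t ht
  refine ⟨fun b => if b then B else C, ⟨?_, ?_, ?_, ?_⟩, by simpa, by simpa⟩
  · intro b; cases b <;> simpa
  · intro b; cases b <;> simpa
  · simp only [if_true, Bool.false_eq_true, if_false]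
    rw [Set.disjoint_left]
    intro a ha ha'
    have h1 := hBc ha; have h2 := hCc ha'
    rw [Metric.mem_closedBall] at h1 h2
    have := dist_triangle_left s t a
    have hd : 0 < dist s t := dist_pos.2 hst
    linarith
  · intro b; cases b
    · simpa using hCd
    · simpa using hBd

theorem exists_split {ι : Type*} [Finite ι] {f : S → X} (hf : Continuous f) {U : ι → Set S}
    (hU : ∀ i, IsOpen (U i)) (h : ¬ Thin f U) {ε : ℝ} (hε : 0 < ε) :
    ∃ v : ι → Bool → Set S, (∀ i, v i ∈ splitPairs (U i) ε) ∧
      ¬ Thin f (fun p : ι × Bool => v p.1 p.2) := by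
  classical
  by_contra! hcon
  apply h
  let 𝒞 : Set (ι → Bool → Set S) := {v | ∀ i, v i ∈ splitPairs (U i) ε}
  have h𝒞 : 𝒞.Countable := by
    refine (Set.countable_univ_pi fun i => splitPairs_countable (U i) ε).mono ?_
    intro v hv; simpa using (show ∀ i, v i ∈ splitPairs (U i) ε from hv)
  have hcc : Countable 𝒞 := h𝒞.to_subtype
  choose Y hYm hYc hYs using fun c : 𝒞 => hcon c.1 c.2
  choose C hC hCs using hYs
  refine ⟨fun i => ⋂ v ∈ splitPairs (U i) ε, ⋃ c : {c : 𝒞 // c.1 i = v},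
    ⋃ b : Bool, Y c.1 (i, b), fun i => ?_, ?_, fun i => ?_⟩
  · exact MeasurableSet.biInter (splitPairs_countable _ _) fun v _ =>
      MeasurableSet.iUnion fun c => MeasurableSet.iUnion fun b => hYm _ _
  · rw [eq_univ_iff_forall]
    intro x
    by_contra hx
    simp only [mem_iUnion, mem_iInter, not_exists, not_forall] at hx
    choose v hv hvx using hx
    have hx' : x ∈ ⋃ i, Y ⟨v, hv⟩ i := by rw [hYc]; trivial
    obtain ⟨⟨i, b⟩, hib⟩ := mem_iUnion.1 hx'
    exact hvx i ⟨⟨v, hv⟩, rfl⟩ b hib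
  · set A : Set S := U i ∩ f ⁻¹' (⋂ v ∈ splitPairs (U i) ε, ⋃ c : {c : 𝒞 // c.1 i = v},
      ⋃ b : Bool, Y c.1 (i, b)) with hA
    have hAm : MeasurableSet A := (hU i).measurableSet.inter (hf.measurable
      (MeasurableSet.biInter (splitPairs_countable _ _) fun v _ =>
        MeasurableSet.iUnion fun c => MeasurableSet.iUnion fun b => hYm _ _))
    let D : Option (𝒞 × Bool × ℕ) → Set S := fun o => match o with
      | none => A \ ⋃ q : 𝒞 × Bool × ℕ, C q.1 (i, q.2.1) q.2.2
      | some q => C q.1 (i, q.2.1) q.2.2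
    obtain ⟨e, he⟩ := exists_surjective_nat (Option (𝒞 × Bool × ℕ))
    refine ⟨fun n => D (e n), fun n => ?_, ?_⟩
    · change MeasurableSet (D (e n)) ∧ InjOn f (D (e n))
      generalize e n = o
      cases o with
      | some q => exact hC q.1 (i, q.2.1) q.2.2
      | none =>
        refine ⟨hAm.diff (MeasurableSet.iUnion fun q => (hC q.1 (i, q.2.1) q.2.2).1), ?_⟩
        rintro s ⟨hs, hs'⟩ t ⟨ht, ht'⟩ hst
        by_contra hne
        obtain ⟨v, hv, hsv, htv⟩ := exists_splitPair (hU i) hε hs.1 ht.1 hne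
        have h1 := hs.2
        simp only [mem_preimage, mem_iInter, mem_iUnion] at h1
        obtain ⟨⟨c, hc⟩, b, hb⟩ := h1 v hv
        cases b with
        | true =>
          have : s ∈ ⋃ n, C c (i, true) n := hCs c (i, true) ⟨by simpa [hc] using hsv, hb⟩
          obtain ⟨n, hn⟩ := mem_iUnion.1 this
          exact hs' (mem_iUnion.2 ⟨(c, true, n), hn⟩)
        | false =>
          have : t ∈ ⋃ n, C c (i, false) n :=
            hCs c (i, false) ⟨by simpa [hc] using htv, by rw [hst] at hb; exact hb⟩
          obtain ⟨n, hn⟩ := mem_iUnion.1 this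
          exact ht' (mem_iUnion.2 ⟨(c, false, n), hn⟩)
    · intro s hs
      by_cases hs' : s ∈ ⋃ q : 𝒞 × Bool × ℕ, C q.1 (i, q.2.1) q.2.2
      · obtain ⟨q, hq⟩ := mem_iUnion.1 hs'
        obtain ⟨n, hn⟩ := he (some q)
        exact mem_iUnion.2 ⟨n, by simpa only [hn] using hq⟩
      · obtain ⟨n, hn⟩ := he none
        exact mem_iUnion.2 ⟨n, by simpa only [hn] using ⟨hs, hs'⟩⟩

/-- The set of finite binary words splits as an initial word and a last letter. -/
theorem thin_snoc {n : ℕ} {f : S → X} {v : (Fin n → Bool) × Bool → Set S}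
    (h : Thin f (fun a : Fin (n + 1) → Bool => v (fun i => a i.castSucc, a (Fin.last n)))) :
    Thin f v := by
  obtain ⟨Y, hY, hYu, hYs⟩ := h
  have key : ∀ p : (Fin n → Bool) × Bool,
      v ((fun i => (Fin.snoc (α := fun _ => Bool) p.1 p.2 : Fin (n + 1) → Bool) i.castSucc),
        (Fin.snoc (α := fun _ => Bool) p.1 p.2 : Fin (n + 1) → Bool) (Fin.last n)) = v p := by
    intro p
    simp
  refine ⟨fun p => Y (Fin.snoc (α := fun _ => Bool) p.1 p.2), fun p => hY _, ?_, fun p => ?_⟩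
  · rw [eq_univ_iff_forall] at hYu ⊢
    intro x
    obtain ⟨a, ha⟩ := mem_iUnion.1 (hYu x)
    refine mem_iUnion.2 ⟨(fun i => a i.castSucc, a (Fin.last n)), ?_⟩
    have : (Fin.snoc (α := fun _ => Bool) (fun i => a i.castSucc) (a (Fin.last n)) :
        Fin (n + 1) → Bool) = a :=
      Fin.snoc_init_self a
    dsimp only
    rw [this]
    exact ha
  · have := hYs (Fin.snoc (α := fun _ => Bool) p.1 p.2)
    simp only [key p] at this
    exact this

theorem not_countable_nat_to_bool : ¬ Countable (ℕ → Bool) := by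
  intro h
  obtain ⟨e, he⟩ := exists_surjective_nat (ℕ → Bool)
  obtain ⟨n, hn⟩ := he fun k => !(e k k)
  have := congrFun hn n
  simp at this

/-- **Lusin–Novikov**, continuous version. -/
theorem small_univ_of_countable_fibers [Nonempty S] {f : S → X} (hf : Continuous f)
    (hc : ∀ x, (f ⁻¹' {x}).Countable) : Small f univ := by
  classical
  by_contra hsm
  let P : ∀ n, ((Fin n → Bool) → Set S) → Prop := fun n U => (∀ a, IsOpen (U a)) ∧ ¬ Thin f U
  have step : ∀ n (U : (Fin n → Bool) → Set S), P n U → ∃ U' : (Fin (n + 1) → Bool) → Set S,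
      P (n + 1) U' ∧ ∃ v : (Fin n → Bool) → Bool → Set S,
        (∀ i, v i ∈ splitPairs (U i) ((1 / 2 : ℝ) ^ n)) ∧
        U' = fun a => v (fun i => a i.castSucc) (a (Fin.last n)) := by
    intro n U hU
    obtain ⟨v, hv, hvt⟩ := exists_split hf hU.1 hU.2 (ε := (1 / 2 : ℝ) ^ n) (by positivity)
    refine ⟨_, ⟨?_, fun ht => hvt ?_⟩, v, hv, rfl⟩
    · intro a
      exact (TopologicalSpace.isBasis_countableBasis S).isOpen ((hv _).1 _)
    · exact thin_snoc (v := fun p => v p.1 p.2) ht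
  choose F hF v hv hFv using step
  have h0 : P 0 (fun _ => univ) := by
    refine ⟨fun _ => isOpen_univ, ?_⟩
    rintro ⟨Y, -, hY, hYs⟩
    apply hsm
    have : Y default = univ := by
      rw [← hY]
      ext x
      simp [Unique.eq_default]
    have h1 := hYs default
    rwa [this, preimage_univ, univ_inter] at h1
  let seq : ∀ n, {U : (Fin n → Bool) → Set S // P n U} := fun n =>
    Nat.rec ⟨_, h0⟩ (fun n U => ⟨F n U.1 U.2, hF n U.1 U.2⟩) n
  let U : ∀ n, (ℕ → Bool) → Set S := fun n α => (seq n).1 fun i => α i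
  have hUs : ∀ n α, U (n + 1) α = v n (seq n).1 (seq n).2 (fun i => α i) (α n) := by
    intro n α
    change F n (seq n).1 (seq n).2 _ = _
    rw [hFv]
    rfl
  have hpair := fun n (α : ℕ → Bool) => hv n (seq n).1 (seq n).2 (fun i : Fin n => α i)
  have hcl : ∀ n α, closure (U (n + 1) α) ⊆ U n α := fun n α => by
    rw [hUs]; exact (hpair n α).2.1 _
  have hdiam : ∀ n α, ∀ s ∈ U (n + 1) α, ∀ t ∈ U (n + 1) α, dist s t ≤ (1 / 2 : ℝ) ^ n :=
    fun n α => by rw [hUs]; exact (hpair n α).2.2.2 _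
  have hmono : ∀ α, Antitone fun n => U n α := fun α =>
    antitone_nat_of_succ_le fun n => subset_closure.trans (hcl n α)
  choose x hx using fun n => exists_mem_of_not_thin hf (seq n).2.1 (seq n).2.2
  choose p hpU hpx using fun n (α : ℕ → Bool) => hx n fun i => α i
  have hpU' : ∀ n α, p n α ∈ U n α := hpU
  have hcau : ∀ α, CauchySeq fun n => p (n + 1) α := fun α => by
    refine cauchySeq_of_le_geometric (1 / 2 : ℝ) 1 (by norm_num) fun n => ?_
    rw [one_mul]
    exact hdiam n α _ (hpU' (n + 1) α) _ (hmono α (Nat.le_succ (n + 1)) (hpU' (n + 2) α))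
  choose q hq using fun α => cauchySeq_tendsto_of_complete (hcau α)
  have hqU : ∀ n α, q α ∈ closure (U (n + 1) α) := fun n α => by
    refine mem_closure_of_tendsto (hq α) (Filter.eventually_atTop.2 ⟨n, fun k hk => ?_⟩)
    exact hmono α (Nat.succ_le_succ hk) (hpU' (k + 1) α)
  have hfq : ∀ α, Filter.Tendsto (fun n => x (n + 1)) Filter.atTop (nhds (f (q α))) := fun α => by
    have := (hf.tendsto (q α)).comp (hq α)
    refine this.congr fun n => ?_
    exact hpx (n + 1) α
  have hinj : Function.Injective q := by
    intro α β hαβ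
    by_contra hne
    have hex : ∃ n, α n ≠ β n := by
      by_contra! hh
      exact hne (funext hh)
    have hmin : ∀ k < Nat.find hex, α k = β k := fun k hk => not_not.1 (Nat.find_min hex hk)
    have hsp := Nat.find_spec hex
    generalize Nat.find hex = n at hmin hsp
    have hr : (fun i : Fin n => β i) = fun i : Fin n => α i := funext fun i => (hmin i i.2).symm
    have h1 := hqU n α
    have h2 := hqU n β
    rw [hUs] at h1 h2
    rw [hr, ← hαβ] at h2
    have hd := (hpair n α).2.2.1
    cases ha : α n <;> cases hb : β n <;> rw [ha] at h1 <;> rw [hb] at h2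
    · exact hsp (ha.trans hb.symm)
    · exact Set.disjoint_left.1 hd h2 h1
    · exact Set.disjoint_left.1 hd h1 h2
    · exact hsp (ha.trans hb.symm)
  have hcount := hc (f (q default))
  have hmaps : ∀ α, q α ∈ f ⁻¹' {f (q default)} := fun α =>
    tendsto_nhds_unique (hfq α) (hfq default)
  have := hcount.to_subtype
  exact not_countable_nat_to_bool
    (Function.Injective.countable (f := fun α => (⟨q α, hmaps α⟩ : f ⁻¹' {f (q default)}))
      fun α β h => hinj (congrArg Subtype.val h))

end Core

/-- **Lusin–Novikov**: a countable-to-one Borel map between standard Borel spaces is injective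
on each piece of a countable Borel partition, encoded by a measurable `part : S → ℕ`. -/
theorem exists_part {S X : Type*} [MeasurableSpace S] [StandardBorelSpace S] [MeasurableSpace X]
    [StandardBorelSpace X] {f : S → X} (hf : Measurable f) (hc : ∀ x, (f ⁻¹' {x}).Countable) :
    ∃ part : S → ℕ, Measurable part ∧ ∀ s t, part s = part t → f s = f t → s = t := by
  classical
  rcases isEmpty_or_nonempty S with hS | hS
  · exact ⟨fun _ => 0, measurable_const, fun s => (hS.false s).elim⟩
  let _ := upgradeStandardBorel S
  let _ := upgradeStandardBorel X
  have hbor := eq_borel_upgradeStandardBorel S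
  have hpolS : PolishSpace S := inferInstance
  obtain ⟨t', ht', hcont, hpol⟩ := hf.exists_continuous
  have hb : @BorelSpace S t' _ := by
    refine @BorelSpace.mk S t' _ ?_
    rw [hbor]
    exact (borel_eq_borel_of_le hpol hpolS ht').symm
  let _ : TopologicalSpace S := t'
  let _ := TopologicalSpace.upgradeIsCompletelyMetrizable S
  obtain ⟨C, hC, hcov⟩ := small_univ_of_countable_fibers hcont hc
  have hex : ∀ s, ∃ n, s ∈ C n := fun s => mem_iUnion.1 (hcov (mem_univ s))
  refine ⟨fun s => Nat.find (hex s), ?_, fun s t h hst => ?_⟩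
  · exact measurable_find hex fun n => (hC n).1
  · have h1 := Nat.find_spec (hex s)
    have h2 := Nat.find_spec (hex t)
    dsimp only at h
    rw [← h] at h2
    exact (hC _).2 h1 h2 hst

end LusinNovikov

namespace AmenProd

open Set Filter Topology ProbabilityTheory
open scoped ENNReal

/-- Borel sets with countable sections are covered by countably many graphs of Borel functions. -/
theorem exists_section_enum {Z X : Type*} [MeasurableSpace Z] [StandardBorelSpace Z]
    [MeasurableSpace X] [StandardBorelSpace X] [Nonempty X] {Γ : Set (Z × X)}
    (hΓ : MeasurableSet Γ) (hc : ∀ z, {x | (z, x) ∈ Γ}.Countable) :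
    ∃ g : ℕ → Z → X, (∀ n, Measurable (g n)) ∧ ∀ z x, (z, x) ∈ Γ → ∃ n, g n z = x := by
  have hsb : StandardBorelSpace Γ := hΓ.standardBorel
  obtain ⟨part, hpart, hinj⟩ := LusinNovikov.exists_part (f := fun s : Γ => s.1.1)
    (measurable_fst.comp measurable_subtype_coe) (fun z => by
      refine ((hc z).image fun x => (z, x)).preimage_of_injOn
        (f := (Subtype.val : Γ → Z × X)) Subtype.val_injective.injOn |>.mono ?_
      rintro ⟨⟨z', x⟩, hs⟩ hz
      obtain rfl : z' = z := hz
      exact ⟨x, hs, rfl⟩)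
  have key : ∀ n, ∃ g : Z → X, Measurable g ∧ ∀ s : Γ, part s = n → g s.1.1 = s.1.2 := by
    intro n
    have hm : MeasurableSet {s : Γ | part s = n} := hpart (measurableSet_singleton n)
    have : StandardBorelSpace {s : Γ | part s = n} := hm.standardBorel
    have hemb : MeasurableEmbedding (fun s : {s : Γ | part s = n} => s.1.1.1) := by
      refine Measurable.measurableEmbedding (by fun_prop) fun s t h => ?_
      exact Subtype.ext (hinj _ _ (s.2.trans t.2.symm) h)
    obtain ⟨g, hg, hgf⟩ := hemb.exists_measurable_extend
      (g := fun s : {s : Γ | part s = n} => s.1.1.2) (by fun_prop) (fun _ => inferInstance)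
    exact ⟨g, hg, fun s hs => congrFun hgf ⟨s, hs⟩⟩
  choose g hg hgf using key
  exact ⟨g, hg, fun z x h => ⟨_, hgf _ ⟨(z, x), h⟩ rfl⟩⟩

/-- A countable Borel equivalence relation is enumerated by Borel functions. -/
theorem exists_enum {X : Type*} [MeasurableSpace X] [StandardBorelSpace X] {E : X → X → Prop}
    (hE : Equivalence E) (hB : MeasurableSet {p : X × X | E p.1 p.2})
    (hc : ∀ x, {y | E x y}.Countable) :
    ∃ g : ℕ → X → X, (∀ n, Measurable (g n)) ∧ ∀ x y, E x y ↔ ∃ n, g n x = y := by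
  classical
  rcases isEmpty_or_nonempty X with hX | hX
  · exact ⟨fun _ => id, fun _ => measurable_id, fun x => (hX.false x).elim⟩
  obtain ⟨g, hg, hgE⟩ := exists_section_enum hB hc
  refine ⟨fun n x => if E x (g n x) then g n x else x, fun n => ?_, fun x y => ⟨fun h => ?_, ?_⟩⟩
  · exact Measurable.ite ((measurable_id.prodMk (hg n)) hB) (hg n) measurable_id
  · obtain ⟨n, rfl⟩ := hgE x y h
    exact ⟨n, if_pos h⟩
  · rintro ⟨n, rfl⟩
    dsimp only
    split_ifs with h
    exacts [h, hE.refl x]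

/-- **Feldman–Moore**: a countable Borel equivalence relation is the union of the graphs of
countably many Borel involutions. -/
theorem exists_involutions {X : Type*} [MeasurableSpace X] [StandardBorelSpace X]
    {E : X → X → Prop}
    (hE : Equivalence E) (hB : MeasurableSet {p : X × X | E p.1 p.2})
    (hc : ∀ x, {y | E x y}.Countable) :
    ∃ θ : ℕ → X → X, (∀ n, Measurable (θ n)) ∧ (∀ n x, θ n (θ n x) = x) ∧
      ∀ x y, E x y ↔ ∃ n, θ n x = y := by
  classical
  obtain ⟨g, hg, hgE⟩ := exists_enum hE hB hc
  obtain ⟨f, hf, hfi⟩ := MeasurableSpace.measurable_injection_nat_bool_of_countablySeparated X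
  have hO : ∀ k, MeasurableSet {x | f x k = true} := fun k =>
    (measurable_pi_iff.1 hf k) (measurableSet_singleton true)
  have hgm : ∀ n x, E x (g n x) := fun n x => (hgE _ _).2 ⟨n, rfl⟩
  let θ : ℕ × ℕ × ℕ → X → X := fun t x =>
    if f x t.2.2 = true ∧ f (g t.1 x) t.2.2 = false ∧ g t.2.1 (g t.1 x) = x then g t.1 x else
    if f x t.2.2 = false ∧ f (g t.2.1 x) t.2.2 = true ∧ g t.1 (g t.2.1 x) = x then g t.2.1 x else x
  have hm : ∀ t, Measurable (θ t) := by
    rintro ⟨n, m, k⟩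
    have hfk : Measurable fun x => f x k := measurable_pi_iff.1 hf k
    have e1 : ∀ b, MeasurableSet {x | f x k = b} := fun b => hfk (measurableSet_singleton b)
    have e2 : ∀ n b, MeasurableSet {x | f (g n x) k = b} := fun n b =>
      (hfk.comp (hg n)) (measurableSet_singleton b)
    have e3 : ∀ n m, MeasurableSet {x | g m (g n x) = x} := fun n m =>
      measurableSet_eq_fun ((hg m).comp (hg n)) measurable_id
    exact Measurable.ite ((e1 _).inter ((e2 _ _).inter (e3 _ _))) (hg n)
      (Measurable.ite ((e1 _).inter ((e2 _ _).inter (e3 _ _))) (hg m) measurable_id)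
  have hinv : ∀ t x, θ t (θ t x) = x := by
    rintro ⟨n, m, k⟩ x
    simp only [θ]
    split_ifs <;> grind
  have hθE : ∀ t x, E x (θ t x) := by
    rintro ⟨n, m, k⟩ x
    simp only [θ]
    split_ifs
    exacts [hgm _ _, hgm _ _, hE.refl x]
  have hcov : ∀ x y, E x y → ∃ t, θ t x = y := by
    intro x y h
    by_cases hxy : x = y
    · by_contra! hcon
      subst hxy
      obtain ⟨n, hn⟩ := (hgE x x).1 h
      have := hcon (n, n, 0)
      simp [θ, hn] at this
    · obtain ⟨k, hk⟩ : ∃ k, f x k ≠ f y k := by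
        by_contra! hh
        exact hxy (hfi (funext hh))
      obtain ⟨n, hn⟩ := (hgE x y).1 h
      obtain ⟨m, hm⟩ := (hgE y x).1 (hE.symm h)
      cases hx : f x k
      · have hy : f y k = true := by simpa [hx] using hk.symm
        exact ⟨(m, n, k), by simp [θ, hn, hm, hx, hy]⟩
      · have hy : f y k = false := by simpa [hx] using hk.symm
        exact ⟨(n, m, k), by simp [θ, hn, hm, hx, hy]⟩
  obtain ⟨e⟩ : Nonempty (ℕ ≃ ℕ × ℕ × ℕ) :=
    ⟨(Denumerable.eqv _).symm⟩
  refine ⟨fun n => θ (e n), fun n => hm _, fun n => hinv _, fun x y => ⟨fun h => ?_, ?_⟩⟩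
  · obtain ⟨t, ht⟩ := hcov x y h
    exact ⟨e.symm t, by simpa using ht⟩
  · rintro ⟨n, rfl⟩
    exact hθE _ _

/-- A real function with bounded range. -/
def Bdd {α : Type*} (f : α → ℝ) : Prop := ∃ C, ∀ x, |f x| ≤ C

theorem Bdd.add {α : Type*} {f g : α → ℝ} (hf : Bdd f) (hg : Bdd g) : Bdd (fun x => f x + g x) := by
  obtain ⟨C, hC⟩ := hf
  obtain ⟨D, hD⟩ := hg
  exact ⟨C + D, fun x => (abs_add_le _ _).trans (add_le_add (hC x) (hD x))⟩

theorem Bdd.const_mul {α : Type*} {f : α → ℝ} (hf : Bdd f) (c : ℝ) : Bdd (fun x => c * f x) := by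
  obtain ⟨C, hC⟩ := hf
  exact ⟨|c| * C, fun x => by
    rw [abs_mul]; exact mul_le_mul_of_nonneg_left (hC x) (abs_nonneg c)⟩

theorem Bdd.const {α : Type*} (c : ℝ) : Bdd (fun _ : α => c) := ⟨|c|, fun _ => le_rfl⟩

theorem Bdd.neg {α : Type*} {f : α → ℝ} (hf : Bdd f) : Bdd (fun x => - f x) := by
  simpa using hf.const_mul (-1)

theorem Bdd.sub {α : Type*} {f g : α → ℝ} (hf : Bdd f) (hg : Bdd g) : Bdd (fun x => f x - g x) := by
  simpa [sub_eq_add_neg] using hf.add hg.neg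

theorem Bdd.of_mem {α : Type*} {f : α → ℝ} (hf : ∀ x, f x ∈ Icc (0 : ℝ) 1) : Bdd f :=
  ⟨1, fun x => abs_le.2 ⟨by linarith [(hf x).1], (hf x).2⟩⟩

theorem Bdd.indicator {α : Type*} (A : Set α) : Bdd (A.indicator (1 : α → ℝ)) :=
  Bdd.of_mem fun x => by by_cases h : x ∈ A <;> simp [h]

theorem Bdd.sum {α ι : Type*} (s : Finset ι) {f : ι → α → ℝ} (hf : ∀ i, Bdd (f i)) :
    Bdd (fun x => ∑ i ∈ s, f i x) := by
  classical
  induction s using Finset.induction_on with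
  | empty => simpa using Bdd.const 0
  | insert i s hi ih => simpa [Finset.sum_insert hi] using (hf i).add ih

/-- A positive normalized functional, linear on bounded functions. -/
structure IsPosFun {α : Type*} (Λ : (α → ℝ) → ℝ) : Prop where
  add : ∀ f g, Bdd f → Bdd g → Λ (fun x => f x + g x) = Λ f + Λ g
  smul : ∀ (c : ℝ) f, Bdd f → Λ (fun x => c * f x) = c * Λ f
  nonneg : ∀ f, Bdd f → (∀ x, 0 ≤ f x) → 0 ≤ Λ f
  one : Λ (fun _ => 1) = 1

namespace IsPosFun

variable {α : Type*} {Λ : (α → ℝ) → ℝ}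

theorem const (h : IsPosFun Λ) (c : ℝ) : Λ (fun _ => c) = c := by
  have := h.smul c (fun _ => 1) (Bdd.const 1)
  simpa [h.one] using this

theorem sub (h : IsPosFun Λ) {f g : α → ℝ} (hf : Bdd f) (hg : Bdd g) :
    Λ (fun x => f x - g x) = Λ f - Λ g := by
  have h1 := h.add f (fun x => (-1) * g x) hf (hg.const_mul _)
  rw [h.smul _ _ hg] at h1
  have : (fun x => f x - g x) = fun x => f x + (-1) * g x := by ext x; ring
  rw [this, h1]; ring

theorem mono (h : IsPosFun Λ) {f g : α → ℝ} (hf : Bdd f) (hg : Bdd g) (hfg : ∀ x, f x ≤ g x) :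
    Λ f ≤ Λ g := by
  have := h.nonneg (fun x => g x - f x) (hg.sub hf) fun x => sub_nonneg.2 (hfg x)
  rw [h.sub hg hf] at this
  linarith

theorem sum (h : IsPosFun Λ) {ι : Type*} (s : Finset ι) {f : ι → α → ℝ} (hf : ∀ i, Bdd (f i)) :
    Λ (fun x => ∑ i ∈ s, f i x) = ∑ i ∈ s, Λ (f i) := by
  classical
  induction s using Finset.induction_on with
  | empty => simpa using h.const 0
  | insert i s hi ih =>
    simp only [Finset.sum_insert hi]
    rw [h.add _ _ (hf i) (Bdd.sum s hf), ih]

theorem abs_sub_le (h : IsPosFun Λ) {f g : α → ℝ} (hf : Bdd f) (hg : Bdd g) {ε : ℝ}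
    (hfg : ∀ x, |f x - g x| ≤ ε) : |Λ f - Λ g| ≤ ε := by
  rw [← h.sub hf hg, abs_le]
  constructor
  · have := h.mono (Bdd.const (-ε)) (hf.sub hg) fun x => (abs_le.1 (hfg x)).1
    rwa [h.const] at this
  · have := h.mono (hf.sub hg) (Bdd.const ε) fun x => (abs_le.1 (hfg x)).2
    rwa [h.const] at this

end IsPosFun

/-- The layer-cake step approximation of a function with values in `[0,1]`. -/
theorem layer_approx {y : ℝ} (hy : y ∈ Icc (0 : ℝ) 1) (N : ℕ) :
    |y - ((N : ℝ) + 1)⁻¹ * ∑ i ∈ Finset.range (N + 1), (if (i : ℝ) / (N + 1) < y then 1 else 0)|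
      ≤ ((N : ℝ) + 1)⁻¹ := by
  have hN : (0 : ℝ) < N + 1 := by positivity
  have hcard : (∑ i ∈ Finset.range (N + 1), (if (i : ℝ) / (N + 1) < y then (1 : ℝ) else 0))
      = ⌈y * (N + 1)⌉₊ := by
    rw [Finset.sum_boole]
    congr 1
    have : (Finset.range (N + 1)).filter (fun i : ℕ => (i : ℝ) / (N + 1) < y)
        = Finset.range ⌈y * (N + 1)⌉₊ := by
      ext i
      simp only [Finset.mem_filter, Finset.mem_range, div_lt_iff₀ hN, Nat.lt_ceil]
      refine ⟨fun h => h.2, fun h => ⟨?_, h⟩⟩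
      have : (i : ℝ) < N + 1 := h.trans_le (by nlinarith [hy.2])
      exact_mod_cast this
    rw [this, Finset.card_range]
  rw [hcard]
  have h1 := Nat.le_ceil (y * ((N : ℝ) + 1))
  have h2 := Nat.ceil_lt_add_one (mul_nonneg hy.1 hN.le)
  have e : y = ((N : ℝ) + 1)⁻¹ * (y * (N + 1)) := by field_simp
  have hinv : (0 : ℝ) < ((N : ℝ) + 1)⁻¹ := by positivity
  rw [abs_le]
  constructor
  · have := mul_le_mul_of_nonneg_left h2.le hinv.le
    rw [mul_add _ (y * ((N : ℝ) + 1)) 1, ← e] at this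
    linarith
  · have := mul_le_mul_of_nonneg_left h1 hinv.le
    rw [← e] at this
    linarith

namespace IsPosFun
variable {α : Type*} {Λ : (α → ℝ) → ℝ}

theorem layer (h : IsPosFun Λ) {f : α → ℝ} (hf : ∀ x, f x ∈ Icc (0 : ℝ) 1) (N : ℕ) :
    |Λ f - ((N : ℝ) + 1)⁻¹ * ∑ i ∈ Finset.range (N + 1),
      Λ ({x | (i : ℝ) / (N + 1) < f x}.indicator 1)| ≤ ((N : ℝ) + 1)⁻¹ := by
  have hb : ∀ i : ℕ, Bdd ({x | (i : ℝ) / (N + 1) < f x}.indicator (1 : α → ℝ)) :=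
    fun i => Bdd.indicator _
  rw [← h.sum _ hb, ← h.smul _ _ (Bdd.sum _ hb)]
  refine h.abs_sub_le (Bdd.of_mem hf) ((Bdd.sum _ hb).const_mul _) fun x => ?_
  have := layer_approx (hf x) N
  simpa [indicator_apply] using this

theorem tendsto_layer (h : IsPosFun Λ) {f : α → ℝ} (hf : ∀ x, f x ∈ Icc (0 : ℝ) 1) :
    Tendsto (fun N : ℕ => ((N : ℝ) + 1)⁻¹ * ∑ i ∈ Finset.range (N + 1),
      Λ ({x | (i : ℝ) / (N + 1) < f x}.indicator 1)) atTop (𝓝 (Λ f)) := by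
  have h0 : Tendsto (fun N : ℕ => ((N : ℝ) + 1)⁻¹) atTop (𝓝 0) := by
    simpa using tendsto_one_div_add_atTop_nhds_zero_nat (𝕜 := ℝ)
  refine tendsto_iff_dist_tendsto_zero.2 (squeeze_zero (fun _ => dist_nonneg) (fun N => ?_) h0)
  rw [dist_comm, Real.dist_eq]
  exact h.layer hf N

end IsPosFun

theorem tendsto_layer_integral {α : Type*} {_ : MeasurableSpace α} (κ : Measure α)
    [IsProbabilityMeasure κ] {f : α → ℝ} (hm : Measurable f) (hf : ∀ x, f x ∈ Icc (0 : ℝ) 1) :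
    Tendsto (fun N : ℕ => ((N : ℝ) + 1)⁻¹ * ∑ i ∈ Finset.range (N + 1),
      κ.real {x | (i : ℝ) / (N + 1) < f x}) atTop (𝓝 (∫ x, f x ∂κ)) := by
  have h0 : Tendsto (fun N : ℕ => ((N : ℝ) + 1)⁻¹) atTop (𝓝 0) := by
    simpa using tendsto_one_div_add_atTop_nhds_zero_nat (𝕜 := ℝ)
  refine tendsto_iff_dist_tendsto_zero.2 (squeeze_zero (fun _ => dist_nonneg) (fun N => ?_) h0)
  have hms : ∀ i : ℕ, MeasurableSet {x | (i : ℝ) / (N + 1) < f x} := fun i =>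
    measurableSet_lt measurable_const hm
  have hInt : ∀ i : ℕ, Integrable ({x | (i : ℝ) / (N + 1) < f x}.indicator (1 : α → ℝ)) κ :=
    fun i => (integrable_const (1 : ℝ)).indicator (hms i)
  have hfi : Integrable f κ := Integrable.of_mem_Icc 0 1 hm.aemeasurable (ae_of_all _ hf)
  have e : ((N : ℝ) + 1)⁻¹ * ∑ i ∈ Finset.range (N + 1), κ.real {x | (i : ℝ) / (N + 1) < f x}
      = ∫ x, ((N : ℝ) + 1)⁻¹ * ∑ i ∈ Finset.range (N + 1),
          {x | (i : ℝ) / (N + 1) < f x}.indicator (1 : α → ℝ) x ∂κ := by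
    rw [integral_const_mul, integral_finsetSum _ fun i _ => hInt i]
    congr 1
    exact Finset.sum_congr rfl fun i _ => (integral_indicator_one (hms i)).symm
  rw [e, dist_comm, Real.dist_eq,
    ← integral_sub hfi ((integrable_finsetSum _ fun i _ => hInt i).const_mul _)]
  have := norm_integral_le_of_norm_le_const (μ := κ) (C := ((N : ℝ) + 1)⁻¹)
    (f := fun x => f x - ((N : ℝ) + 1)⁻¹ * ∑ i ∈ Finset.range (N + 1),
          {x | (i : ℝ) / (N + 1) < f x}.indicator (1 : α → ℝ) x) (ae_of_all _ fun x => by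
      have := layer_approx (hf x) N
      simpa [indicator_apply] using this)
  simpa using this

theorem finAdd_biUnion {α ι : Type*} (𝓘 : MeasurableSpace α) (m : Set α → ℝ)
    (hadd : ∀ A B, MeasurableSet[𝓘] A → MeasurableSet[𝓘] B → Disjoint A B →
      m (A ∪ B) = m A + m B) (t : Finset ι) (P : ι → Set α) (hP : ∀ i, MeasurableSet[𝓘] (P i))
    (hd : Pairwise fun i j => Disjoint (P i) (P j)) :
    m (⋃ i ∈ t, P i) = ∑ i ∈ t, m (P i) := by
  classical
  induction t using Finset.induction_on with
  | empty =>
    have := hadd ∅ ∅ (@MeasurableSet.empty _ 𝓘) (@MeasurableSet.empty _ 𝓘) (by simp)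
    simp at this ⊢
    linarith
  | insert i t hi ih =>
    rw [Finset.set_biUnion_insert, Finset.sum_insert hi, ← ih]
    refine hadd _ _ (hP i) (Finset.measurableSet_biUnion _ fun j _ => hP j) ?_
    rw [disjoint_iUnion₂_right]
    exact fun j hj => hd fun h => hi (h ▸ hj)

/-- A finitely additive probability on a `σ`-algebra of sets extends to a positive normalized
functional on all bounded functions. -/
theorem exists_functional {α : Type*} [Nonempty α] (𝓘 : MeasurableSpace α) (m : Set α → ℝ)
    (h0 : ∀ A, MeasurableSet[𝓘] A → 0 ≤ m A) (h1 : m univ = 1)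
    (hadd : ∀ A B, MeasurableSet[𝓘] A → MeasurableSet[𝓘] B → Disjoint A B →
      m (A ∪ B) = m A + m B) :
    ∃ Λ : (α → ℝ) → ℝ, IsPosFun Λ ∧ ∀ A, MeasurableSet[𝓘] A → Λ (A.indicator 1) = m A := by
  classical
  let T := {A : Set α // MeasurableSet[𝓘] A}
  let key : (s : Finset T) → α → (s → Prop) := fun s x A => x ∈ A.1.1
  let fib : (s : Finset T) → (s → Prop) → Set α := fun s c => {x | key s x = c}
  have hfib : ∀ s c, MeasurableSet[𝓘] (fib s c) := by
    intro s c
    have : fib s c = ⋂ A : s, {x | x ∈ A.1.1 ↔ c A} := by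
      ext x
      simp only [fib, key, mem_ofPred_eq, mem_iInter, funext_iff, eq_iff_iff]
    rw [this]
    refine MeasurableSet.iInter fun A => ?_
    by_cases hc : c A
    · have e : {x | x ∈ A.1.1 ↔ c A} = A.1.1 := by ext x; simp [hc]
      rw [e]; exact A.1.2
    · have e : {x | x ∈ A.1.1 ↔ c A} = A.1.1ᶜ := by ext x; simp [hc]
      rw [e]; exact A.1.2.compl
  have hdisj : ∀ s, Pairwise fun c d => Disjoint (fib s c) (fib s d) := by
    intro s c d hcd
    exact Set.disjoint_left.2 fun x hx hx' => hcd (hx.symm.trans hx')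
  have hsum : ∀ (s : Finset T) (t : Finset (s → Prop)), ∑ c ∈ t, m (fib s c) = m (⋃ c ∈ t, fib s c) :=
    fun s t => (finAdd_biUnion 𝓘 m hadd t _ (hfib s) (hdisj s)).symm
  have hsum1 : ∀ s : Finset T, ∑ c, m (fib s c) = 1 := by
    intro s
    rw [hsum, ← h1]
    congr 1
    ext x
    simp [fib]
  have hempty : m ∅ = 0 := by
    have := hadd ∅ ∅ (@MeasurableSet.empty _ 𝓘) (@MeasurableSet.empty _ 𝓘) (by simp)
    simp at this
    linarith
  let pt : (s : Finset T) → (s → Prop) → α := fun s c =>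
    if h : (fib s c).Nonempty then h.some else Classical.arbitrary α
  have hpt : ∀ s c, (fib s c).Nonempty → pt s c ∈ fib s c := by
    intro s c h
    simp only [pt, dif_pos h]
    exact h.some_mem
  let L : Finset T → (α → ℝ) → ℝ := fun s f => ∑ c, m (fib s c) * f (pt s c)
  have hLA : ∀ (s : Finset T) (A : T), A ∈ s → L s (A.1.indicator 1) = m A.1 := by
    intro s A hA
    have : A.1 = ⋃ c ∈ Finset.univ.filter (fun c : s → Prop => c ⟨A, hA⟩), fib s c := by
      ext x
      simp [fib, key]
    have e : m A.1 = ∑ c ∈ Finset.univ.filter (fun c : s → Prop => c ⟨A, hA⟩), m (fib s c) := by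
      rw [hsum, ← this]
    rw [e, Finset.sum_filter]
    refine Finset.sum_congr rfl fun c _ => ?_
    rcases (fib s c).eq_empty_or_nonempty with hc | hc
    · simp [hc, hempty]
    · have hp : key s (pt s c) ⟨A, hA⟩ = c ⟨A, hA⟩ := congrFun (hpt s c hc) _
      have hp' : pt s c ∈ A.1 ↔ c ⟨A, hA⟩ := eq_iff_iff.1 hp
      by_cases hcA : c ⟨A, hA⟩
      · simp [hcA, hp'.2 hcA]
      · simp [hcA, mt hp'.1 hcA]
  let 𝒰 : Ultrafilter (Finset T) := Ultrafilter.of atTop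
  have hlim : ∀ f, Bdd f → ∃ y, Tendsto (fun s => L s f) 𝒰 (𝓝 y) := by
    rintro f ⟨C, hC⟩
    have hmem : ∀ s, L s f ∈ Icc (-C) C := by
      intro s
      rw [mem_Icc, ← abs_le]
      calc |L s f| ≤ ∑ c, |m (fib s c) * f (pt s c)| := Finset.abs_sum_le_sum_abs _ _
        _ ≤ ∑ c, m (fib s c) * C := by
          refine Finset.sum_le_sum fun c _ => ?_
          rw [abs_mul, abs_of_nonneg (h0 _ (hfib s c))]
          exact mul_le_mul_of_nonneg_left (hC _) (h0 _ (hfib s c))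
        _ = C := by rw [← Finset.sum_mul, hsum1, one_mul]
    obtain ⟨y, -, hy⟩ := isCompact_Icc.ultrafilter_le_nhds (𝒰.map fun s => L s f)
      (le_principal_iff.2 (Eventually.of_forall (f := (𝒰 : Filter (Finset T))) hmem))
    exact ⟨y, hy⟩
  refine ⟨fun f => limUnder (𝒰 : Filter (Finset T)) fun s => L s f, ⟨?_, ?_, ?_, ?_⟩, ?_⟩
  · intro f g hf hg
    refine Tendsto.limUnder_eq ?_
    refine ((tendsto_nhds_limUnder (hlim f hf)).add (tendsto_nhds_limUnder (hlim g hg))).congr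
      fun s => ?_
    simp only [L, mul_add, Finset.sum_add_distrib]
  · intro c f hf
    refine Tendsto.limUnder_eq ?_
    refine ((tendsto_nhds_limUnder (hlim f hf)).const_mul c).congr fun s => ?_
    simp only [L, Finset.mul_sum]
    exact Finset.sum_congr rfl fun _ _ => by ring
  · intro f hf hp
    refine ge_of_tendsto' (tendsto_nhds_limUnder (hlim f hf)) fun s => ?_
    exact Finset.sum_nonneg fun c _ => mul_nonneg (h0 _ (hfib s c)) (hp _)
  · refine Tendsto.limUnder_eq (tendsto_const_nhds.congr fun s => ?_)
    simp only [L, mul_one, hsum1]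
  · intro A hA
    refine Tendsto.limUnder_eq (tendsto_const_nhds.congr' ?_)
    have : ∀ᶠ s : Finset T in atTop, m A = L s (A.indicator 1) := by
      filter_upwards [eventually_ge_atTop ({⟨A, hA⟩} : Finset T)] with s hs
      exact (hLA s ⟨A, hA⟩ (hs (by simp))).symm
    exact Ultrafilter.of_le _ this

/-- A finitely additive probability measure defined on all subsets. -/
structure IsMean {α : Type*} (m : Set α → ℝ) : Prop where
  nonneg : ∀ A, 0 ≤ m A
  univ : m univ = 1
  add : ∀ A B, Disjoint A B → m (A ∪ B) = m A + m B

namespace IsMean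
variable {α : Type*} {m : Set α → ℝ}

theorem empty (h : IsMean m) : m ∅ = 0 := by
  have := h.add ∅ ∅ (by simp)
  simp at this
  linarith

theorem mono (h : IsMean m) {A B : Set α} (hAB : A ⊆ B) : m A ≤ m B := by
  have := h.add A (B \ A) disjoint_sdiff_self_right
  rw [union_sdiff_cancel hAB] at this
  linarith [h.nonneg (B \ A)]

theorem mem_Icc (h : IsMean m) (A : Set α) : m A ∈ Icc (0 : ℝ) 1 :=
  ⟨h.nonneg A, h.univ ▸ h.mono (subset_univ A)⟩

theorem eq_of_symmDiff_null (h : IsMean m) {A B C : Set α} (hC : m C = 0)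
    (hAB : ∀ x ∉ C, x ∈ A ↔ x ∈ B) : m A = m B := by
  have key : ∀ A : Set α, m A = m (A \ C) := by
    intro A
    have h1 := h.add (A ∩ C) (A \ C) (disjoint_sdiff_self_right.mono_left inter_subset_right)
    rw [inter_union_sdiff] at h1
    have h2 := h.mono (inter_subset_right : A ∩ C ⊆ C)
    have h3 := h.nonneg (A ∩ C)
    linarith
  rw [key A, key B]
  congr 1
  ext x
  simp only [Set.mem_sdiff]
  exact ⟨fun hx => ⟨(hAB x hx.2).1 hx.1, hx.2⟩, fun hx => ⟨(hAB x hx.2).2 hx.1, hx.2⟩⟩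

theorem finite_null (h : IsMean m) (hn : ∀ x, m {x} = 0) {A : Set α} (hA : A.Finite) : m A = 0 := by
  induction A, hA using Set.Finite.induction_on with
  | empty => exact h.empty
  | @insert a s ha _ ih =>
    rw [insert_eq, h.add _ _ (by simpa using ha), hn, ih, add_zero]

end IsMean

/-- The relation `F` on `(Z, μ)` carries an invariant, strongly measurable field of nonprincipal
finitely additive probabilities on `ℕ`. -/
def Medial {Z : Type*} [MeasurableSpace Z] (μ : Measure Z) (F : Z → Z → Prop) : Prop :=
  ∃ m : Z → Set ℕ → ℝ, (∀ z, IsMean (m z)) ∧ (∀ z n, m z {n} = 0) ∧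
    (∀ z z', F z z' → m z = m z') ∧
    ∀ S : Set (Z × ℕ), MeasurableSet S → AEMeasurable (fun z => m z {n | (z, n) ∈ S}) μ

theorem exists_nonprincipal_mean : ∃ m : Set ℕ → ℝ, IsMean m ∧ ∀ n, m {n} = 0 := by
  classical
  refine ⟨fun A => if A ∈ hyperfilter ℕ then 1 else 0, ⟨?_, ?_, ?_⟩, ?_⟩
  · intro A; split_ifs <;> norm_num
  · exact if_pos (Filter.univ_mem (f := (hyperfilter ℕ : Filter ℕ)))
  · intro A B hAB
    have hn : ¬ (A ∈ hyperfilter ℕ ∧ B ∈ hyperfilter ℕ) := fun h => by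
      have := inter_mem h.1 h.2
      rw [hAB.inter_eq] at this
      exact Filter.empty_notMem _ this
    simp only [Ultrafilter.union_mem_iff]
    by_cases hA : A ∈ hyperfilter ℕ <;> by_cases hB : B ∈ hyperfilter ℕ <;> simp_all
  · intro n
    simp [(Set.finite_singleton n).notMem_hyperfilter]

/-- Exact invariance can be restored from invariance on a conull set. -/
theorem exists_invariant_modification {X β : Type*} {R : X → X → Prop} (hR : Equivalence R)
    (X0 : Set X) (m : X → β) (b : β) (hm : ∀ x ∈ X0, ∀ x' ∈ X0, R x x' → m x = m x') :
    ∃ m' : X → β, (∀ x ∈ X0, m' x = m x) ∧ (∀ x x', R x x' → m' x = m' x') ∧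
      ∀ x, m' x = b ∨ ∃ y, R x y ∧ m' x = m y := by
  classical
  let P : X → Set X := fun x => {y | y ∈ X0 ∧ R x y}
  let G : Set X → β := fun P => if h : P.Nonempty then m h.some else b
  refine ⟨fun x => G (P x), ?_, ?_, ?_⟩
  · intro x hx
    have h : (P x).Nonempty := ⟨x, hx, hR.refl x⟩
    simp only [G, dif_pos h]
    exact (hm x hx _ h.some_mem.1 h.some_mem.2).symm
  · intro x x' h
    have : P x = P x' := by
      ext y
      exact ⟨fun hy => ⟨hy.1, hR.trans (hR.symm h) hy.2⟩, fun hy => ⟨hy.1, hR.trans h hy.2⟩⟩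
    dsimp only
    rw [this]
  · intro x
    by_cases h : (P x).Nonempty
    · exact Or.inr ⟨h.some, h.some_mem.2, by simp only [G, dif_pos h]⟩
    · exact Or.inl (by simp only [G, dif_neg h])

theorem medial_of_ae {X : Type*} [MeasurableSpace X] {κ : Measure X} {R : X → X → Prop}
    (hR : Equivalence R) (X0 : Set X) (hX0 : ∀ᵐ x ∂κ, x ∈ X0) (m : X → Set ℕ → ℝ)
    (h1 : ∀ x, IsMean (m x)) (h2 : ∀ x n, m x {n} = 0)
    (h3 : ∀ x ∈ X0, ∀ x' ∈ X0, R x x' → m x = m x')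
    (h4 : ∀ S : Set (X × ℕ), MeasurableSet S → AEMeasurable (fun x => m x {n | (x, n) ∈ S}) κ) :
    Medial κ R := by
  obtain ⟨m0, hm0, hm0'⟩ := exists_nonprincipal_mean
  obtain ⟨m', e1, e2, e3⟩ := exists_invariant_modification hR X0 m m0 h3
  refine ⟨m', fun x => ?_, fun x n => ?_, e2, fun S hS => ?_⟩
  · rcases e3 x with h | ⟨y, -, h⟩ <;> rw [h]
    exacts [hm0, h1 y]
  · rcases e3 x with h | ⟨y, -, h⟩ <;> rw [h]
    exacts [hm0' n, h2 y n]
  · refine (h4 S hS).congr ?_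
    filter_upwards [hX0] with x hx
    rw [e1 x hx]

/-- The `σ`-algebra of `F`-invariant measurable sets. -/
@[reducible] def invSigma {Z : Type*} [MeasurableSpace Z] (F : Z → Z → Prop) : MeasurableSpace Z where
  MeasurableSet' U := MeasurableSet U ∧ ∀ z z', F z z' → (z ∈ U ↔ z' ∈ U)
  measurableSet_empty := ⟨MeasurableSet.empty, fun _ _ _ => by simp⟩
  measurableSet_compl U h := ⟨h.1.compl, fun z z' hz => by simp [h.2 z z' hz]⟩
  measurableSet_iUnion U h := ⟨MeasurableSet.iUnion fun i => (h i).1, fun z z' hz => by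
    simp only [mem_iUnion]
    exact exists_congr fun i => (h i).2 z z' hz⟩

theorem ext_eq_integral {Z : Type*} [MeasurableSpace Z] [StandardBorelSpace Z]
    {F : Z → Z → Prop} (hF : Equivalence F) (hFB : MeasurableSet {p : Z × Z | F p.1 p.2})
    (hFc : ∀ z, {z' | F z z'}.Countable) (κ : Measure Z) [IsProbabilityMeasure κ]
    {Λ : (Z → ℝ) → ℝ} (hΛ : IsPosFun Λ)
    (hext : ∀ A, MeasurableSet[invSigma F] A → Λ (A.indicator 1) = κ.real A)
    {h : Z → ℝ} (h01 : ∀ z, h z ∈ Icc (0 : ℝ) 1) (hinv : ∀ z z', F z z' → h z = h z')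
    (hm : AEMeasurable h κ) : Λ h = ∫ z, h z ∂κ := by
  classical
  obtain ⟨γ, hγ, hγF⟩ := exists_enum hF hFB hFc
  set h' := hm.mk h
  have hh' : Measurable h' := hm.measurable_mk
  let V : Set Z := (toMeasurable κ {z | h z ≠ h' z})ᶜ
  have hV : MeasurableSet V := (measurableSet_toMeasurable _ _).compl
  have hVeq : ∀ z ∈ V, h z = h' z := fun z hz => by
    by_contra hne
    exact hz (subset_toMeasurable κ _ hne)
  have hVnull : κ Vᶜ = 0 := by
    simp only [V, compl_compl, measure_toMeasurable]
    exact hm.ae_eq_mk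
  let W : Set Z := {z | ∃ i, γ i z ∈ V}
  have hW : MeasurableSet[invSigma F] W := by
    refine ⟨?_, fun z z' hz => ?_⟩
    · have : W = ⋃ i, γ i ⁻¹' V := by ext; simp [W]
      rw [this]
      exact MeasurableSet.iUnion fun i => hγ i hV
    · have aux : ∀ z, z ∈ W ↔ ∃ y, F z y ∧ y ∈ V := fun z =>
        ⟨fun ⟨i, hi⟩ => ⟨_, (hγF _ _).2 ⟨i, rfl⟩, hi⟩, fun ⟨y, h1, h2⟩ => by
          obtain ⟨i, rfl⟩ := (hγF _ _).1 h1
          exact ⟨i, h2⟩⟩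
      rw [aux, aux]
      exact ⟨fun ⟨y, h1, h2⟩ => ⟨y, hF.trans (hF.symm hz) h1, h2⟩,
        fun ⟨y, h1, h2⟩ => ⟨y, hF.trans hz h1, h2⟩⟩
  have hWm : MeasurableSet W := hW.1
  have hVW : V ⊆ W := fun z hz => by
    obtain ⟨i, hi⟩ := (hγF z z).1 (hF.refl z)
    exact ⟨i, by rwa [hi]⟩
  have hWnull : κ Wᶜ = 0 := measure_mono_null (compl_subset_compl.2 hVW) hVnull
  let u : Z → ℝ := W.indicator h
  have hum : Measurable u := by
    have hus : ∀ s : Set ℝ, MeasurableSet s → MeasurableSet (W ∩ h ⁻¹' s) := by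
      intro s hs
      have : W ∩ h ⁻¹' s = ⋃ i, γ i ⁻¹' (V ∩ h' ⁻¹' s) := by
        ext z
        simp only [mem_inter_iff, mem_preimage, mem_iUnion]
        constructor
        · rintro ⟨⟨i, hi⟩, hz⟩
          refine ⟨i, hi, ?_⟩
          rwa [← hVeq _ hi, ← hinv z _ ((hγF _ _).2 ⟨i, rfl⟩)]
        · rintro ⟨i, hi, hz⟩
          refine ⟨⟨i, hi⟩, ?_⟩
          rwa [hinv z _ ((hγF _ _).2 ⟨i, rfl⟩), hVeq _ hi]
      rw [this]
      exact MeasurableSet.iUnion fun i => hγ i (hV.inter (hh' hs))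
    refine measurable_of_restrict_of_restrict_compl hWm ?_ ?_
    · intro s hs
      have := (hus s hs)
      refine ⟨_, this, ?_⟩
      ext z
      simp [u, z.2]
    · have : Wᶜ.domRestrict u = fun _ => 0 := by
        ext z
        exact indicator_of_notMem z.2 _
      rw [this]
      exact measurable_const
  have hu01 : ∀ z, u z ∈ Icc (0 : ℝ) 1 := fun z => by
    by_cases hz : z ∈ W
    · simpa [u, hz] using h01 z
    · simp [u, hz]
  have humI : ∀ t : ℝ, MeasurableSet[invSigma F] {z | t < u z} := fun t => by
    refine ⟨measurableSet_lt measurable_const hum, fun z z' hz => ?_⟩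
    have h1 := hW.2 z z' hz
    have h2 := hinv z z' hz
    have : u z = u z' := by
      by_cases hzW : z ∈ W
      · simp [u, hzW, h1.1 hzW, h2]
      · simp [u, hzW, mt h1.2 hzW]
    simp [this]
  have e1 : Λ u = ∫ z, u z ∂κ := by
    refine tendsto_nhds_unique (hΛ.tendsto_layer hu01)
      ((tendsto_layer_integral κ hum hu01).congr fun N => ?_)
    congr 1
    exact Finset.sum_congr rfl fun i _ => (hext _ (humI _)).symm
  have e2 : ∫ z, u z ∂κ = ∫ z, h z ∂κ := by
    refine integral_congr_ae ?_
    have : ∀ᵐ z ∂κ, z ∈ W := hWnull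
    filter_upwards [this] with z hz
    exact indicator_of_mem hz _
  rw [← e2, ← e1]
  have e3 : Λ (Wᶜ.indicator 1) = 0 := by
    rw [hext _ hW.compl, Measure.real, hWnull]; rfl
  have hbh := Bdd.of_mem h01
  have hbu := Bdd.of_mem hu01
  refine le_antisymm ?_ (hΛ.mono hbu hbh fun z => ?_)
  · have := hΛ.mono hbh (hbu.add (Bdd.indicator Wᶜ)) fun z => ?_
    · rwa [hΛ.add _ _ hbu (Bdd.indicator _), e3, add_zero] at this
    · by_cases hz : z ∈ W
      · simp [u, hz]
      · simpa [u, hz] using (h01 z).2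
  · by_cases hz : z ∈ W
    · simp [u, hz]
    · simpa [u, hz] using (h01 z).1

/-- **Transfer** of medial fields along a Markov kernel. -/
theorem Medial.transfer {Z X : Type*} [MeasurableSpace Z] [StandardBorelSpace Z]
    [MeasurableSpace X] [StandardBorelSpace X]
    {F : Z → Z → Prop} (hF : Equivalence F) (hFB : MeasurableSet {p : Z × Z | F p.1 p.2})
    (hFc : ∀ z, {z' | F z z'}.Countable) {μ : Measure Z} (hmed : Medial μ F)
    (κ : Measure X) [IsFiniteMeasure κ] (K : Kernel X Z) [IsMarkovKernel K]
    (hac : (κ ⊗ₘ K).snd ≪ μ) {Γ : Set (X × Z)} (hΓ : MeasurableSet Γ)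
    (hΓae : ∀ᵐ p ∂(κ ⊗ₘ K), p ∈ Γ) (hΓc : ∀ z, {x | (x, z) ∈ Γ}.Countable)
    {R : X → X → Prop} (hR : Equivalence R) (X0 : Set X) (hX0 : ∀ᵐ x ∂κ, x ∈ X0)
    (hK : ∀ x ∈ X0, ∀ x' ∈ X0, R x x' → ∀ U, MeasurableSet U →
      (∀ z z', F z z' → (z ∈ U ↔ z' ∈ U)) → K x U = K x' U) : Medial κ R := by
  classical
  obtain ⟨m0, hm0, hm0'⟩ := exists_nonprincipal_mean
  rcases isEmpty_or_nonempty X with hX | hX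
  · exact ⟨fun x => (hX.false x).elim, fun x => (hX.false x).elim, fun x => (hX.false x).elim,
      fun x => (hX.false x).elim, fun S hS => (measurable_of_empty _).aemeasurable⟩
  have hZ : Nonempty Z := (nonempty_of_isProbabilityMeasure (K hX.some))
  obtain ⟨m, h1, h2, h3, h4⟩ := hmed
  let G : (Set Z → ℝ) → (Z → ℝ) → ℝ := fun w => if h : ∃ Λ : (Z → ℝ) → ℝ, IsPosFun Λ ∧
    ∀ A, MeasurableSet[invSigma F] A → Λ (A.indicator 1) = w A then h.choose else 0
  let w : X → Set Z → ℝ := fun x A => if MeasurableSet[invSigma F] A then (K x).real A else 0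
  have hw : ∀ x, ∃ Λ : (Z → ℝ) → ℝ, IsPosFun Λ ∧
      ∀ A, MeasurableSet[invSigma F] A → Λ (A.indicator 1) = w x A := by
    intro x
    refine exists_functional (invSigma F) (w x) (fun A hA => ?_) ?_ fun A B hA hB hAB => ?_
    · simp only [w, if_pos hA]; exact measureReal_nonneg
    · simp only [w, if_pos (@MeasurableSet.univ _ (invSigma F))]; simp
    · simp only [w, if_pos hA, if_pos hB, if_pos (hA.union hB)]
      exact measureReal_union hAB hB.1
  let Λ : X → (Z → ℝ) → ℝ := fun x => G (w x)
  have hΛ : ∀ x, IsPosFun (Λ x) := fun x => by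
    simp only [Λ, G, dif_pos (hw x)]
    exact (hw x).choose_spec.1
  have hΛe : ∀ x A, MeasurableSet[invSigma F] A → Λ x (A.indicator 1) = (K x).real A := by
    intro x A hA
    have := (hw x).choose_spec.2 A hA
    simp only [w, if_pos hA] at this
    simp only [Λ, G, dif_pos (hw x)]
    exact this
  have hmb : ∀ A, Bdd fun z => m z A := fun A => Bdd.of_mem fun z => (h1 z).mem_Icc A
  refine medial_of_ae hR X0 hX0 (fun x A => Λ x fun z => m z A) (fun x => ⟨?_, ?_, ?_⟩) ?_ ?_ ?_
  · exact fun A => (hΛ x).nonneg _ (hmb A) fun z => (h1 z).nonneg A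
  · simp only [(h1 _).univ]
    exact (hΛ x).one
  · intro A B hAB
    simp only [(h1 _).add A B hAB]
    exact (hΛ x).add _ _ (hmb A) (hmb B)
  · intro x n
    simp only [h2]
    exact (hΛ x).const 0
  · intro x hx x' hx' hxx'
    have : w x = w x' := by
      ext A
      by_cases hA : MeasurableSet[invSigma F] A
      · simp only [w, if_pos hA, Measure.real, hK x hx x' hx' hxx' A hA.1 hA.2]
      · simp only [w, if_neg hA]
    simp only [Λ, this]
  · intro S hS
    obtain ⟨Ψ, hΨ, hΨΓ⟩ := exists_section_enum (Γ := Prod.swap ⁻¹' Γ) (measurable_swap hΓ)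
      (fun z => hΓc z)
    have hsec : ∀ l, AEMeasurable (fun z => m z {n | (Ψ l z, n) ∈ S}) μ := fun l =>
      h4 {p : Z × ℕ | (Ψ l p.1, p.2) ∈ S}
        ((((hΨ l).comp measurable_fst).prodMk measurable_snd) hS)
    let H : X × Z → ℝ := fun p => m p.2 {n | (p.1, n) ∈ S}
    have hHm : AEMeasurable H (κ ⊗ₘ K) := by
      have hL : ∀ l, MeasurableSet {p : X × Z | Ψ l p.2 = p.1} := fun l =>
        measurableSet_eq_fun ((hΨ l).comp measurable_snd) measurable_fst
      have hLm : Measurable fun p : X × Z => sInf {l | Ψ l p.2 = p.1} :=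
        measurable_to_countable' fun n => by
          have e : (fun p : X × Z => sInf {l | Ψ l p.2 = p.1}) ⁻¹' {n} =
            ({p | Ψ n p.2 = p.1} ∩ ⋂ l ∈ {l | l < n}, {p : X × Z | Ψ l p.2 = p.1}ᶜ) ∪
              (if n = 0 then ⋂ l, {p : X × Z | Ψ l p.2 = p.1}ᶜ else ∅) := by
            ext p
            by_cases hp : ({l | Ψ l p.2 = p.1} : Set ℕ).Nonempty
            · have hnot : ¬ ∀ l, ¬ Ψ l p.2 = p.1 := by
                obtain ⟨l, hl⟩ := hp
                exact fun h => h l hl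
              have : (p ∈ if n = 0 then ⋂ l, {p : X × Z | Ψ l p.2 = p.1}ᶜ else ∅) ↔ False := by
                split_ifs
                · simpa using hnot
                · simp
              rw [mem_union, this, or_false]
              simp only [mem_preimage, mem_singleton_iff, mem_inter_iff, mem_iInter, mem_compl_iff,
                mem_ofPred_eq]
              constructor
              · rintro rfl
                exact ⟨Nat.sInf_mem hp, fun l hl => Nat.notMem_of_lt_sInf hl⟩
              · rintro ⟨h1, h2⟩
                exact le_antisymm (Nat.sInf_le h1)
                  (le_of_not_gt fun hlt => h2 _ hlt (Nat.sInf_mem hp))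
            · have hall : ∀ l, ¬ Ψ l p.2 = p.1 := fun l hl => hp ⟨l, hl⟩
              have hemp : ({l | Ψ l p.2 = p.1} : Set ℕ) = ∅ := not_nonempty_iff_eq_empty.1 hp
              simp only [mem_preimage, hemp, Nat.sInf_empty, mem_singleton_iff, mem_union,
                mem_inter_iff]
              split_ifs with h0
              · simp [h0, hall]
              · simp [hall, Ne.symm h0]
          rw [e]
          refine MeasurableSet.union ((hL n).inter
            (MeasurableSet.biInter (to_countable _) fun l _ => (hL l).compl)) ?_
          split_ifs
          · exact MeasurableSet.iInter fun l => (hL l).compl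
          · exact MeasurableSet.empty
      let H' : X × Z → ℝ := fun p => (hsec (sInf {l | Ψ l p.2 = p.1})).mk _ p.2
      have hH' : Measurable H' := by
        have : Measurable fun q : ℕ × Z => (hsec q.1).mk _ q.2 :=
          measurable_from_prod_countable_right fun l => (hsec l).measurable_mk
        exact this.comp (hLm.prodMk measurable_snd)
      refine ⟨H', hH', ?_⟩
      have hg : ∀ᵐ z ∂μ, ∀ l, m z {n | (Ψ l z, n) ∈ S} = (hsec l).mk _ z :=
        ae_all_iff.2 fun l => (hsec l).ae_eq_mk
      have hg' : ∀ᵐ p ∂(κ ⊗ₘ K), ∀ l, m p.2 {n | (Ψ l p.2, n) ∈ S} = (hsec l).mk _ p.2 :=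
        ae_of_ae_map measurable_snd.aemeasurable (hac.ae_le hg)
      filter_upwards [hg', hΓae] with p hp hpΓ
      have hne : ({l | Ψ l p.2 = p.1} : Set ℕ).Nonempty := hΨΓ p.2 p.1 hpΓ
      have := hp (sInf {l | Ψ l p.2 = p.1})
      rw [show Ψ (sInf {l | Ψ l p.2 = p.1}) p.2 = p.1 from Nat.sInf_mem hne] at this
      exact this
    have hHae := Measure.ae_ae_of_ae_compProd hHm.ae_eq_mk
    have hmeas : Measurable fun x => ∫ z, hHm.mk H (x, z) ∂(K x) :=
      (StronglyMeasurable.integral_kernel_prod_right' (κ := K)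
        hHm.measurable_mk.stronglyMeasurable).measurable
    refine ⟨_, hmeas, ?_⟩
    filter_upwards [hHae] with x hx
    have hax : AEMeasurable (fun z => m z {n | (x, n) ∈ S}) (K x) :=
      ⟨_, hHm.measurable_mk.comp measurable_prodMk_left, hx⟩
    rw [ext_eq_integral hF hFB hFc (K x) (hΛ x) (hΛe x) (fun z => (h1 z).mem_Icc _)
      (fun z z' hz => by rw [h3 z z' hz]) hax]
    exact integral_congr_ae hx

/-- The kernel whose fibres are the infinite products of the fibres of a family of kernels. -/
noncomputable def piKernel {W : Type*} [MeasurableSpace W] {A : ℕ → Type*}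
    [∀ k, MeasurableSpace (A k)] (κ : ∀ k, Kernel W (A k)) [∀ k, IsMarkovKernel (κ k)] :
    Kernel W (∀ k, A k) where
  toFun w := Measure.infinitePi fun k => κ k w
  measurable' := by
    have hp : ∀ w, IsProbabilityMeasure (Measure.infinitePi fun k => κ k w) := fun w => inferInstance
    refine Measurable.measure_of_isPiSystem_of_isProbabilityMeasure
      (S := squareCylinders fun i ↦ {s : Set (A i) | MeasurableSet s})
      generateFrom_squareCylinders.symm
      (isPiSystem_squareCylinders (fun i => MeasurableSpace.isPiSystem_measurableSet)
        fun i => MeasurableSet.univ) ?_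
    rintro S ⟨s, t, ht, rfl⟩
    have ht' : ∀ i, MeasurableSet (t i) := fun i => ht i (mem_univ i)
    simp_rw [Measure.infinitePi_pi _ fun i _ => ht' i]
    exact Finset.measurable_fun_prod _ fun i _ => (κ i).measurable_coe (ht' i)

theorem piKernel_apply {W : Type*} [MeasurableSpace W] {A : ℕ → Type*}
    [∀ k, MeasurableSpace (A k)] (κ : ∀ k, Kernel W (A k)) [∀ k, IsMarkovKernel (κ k)] (w : W) :
    piKernel κ w = Measure.infinitePi fun k => κ k w := rfl

instance {W : Type*} [MeasurableSpace W] {A : ℕ → Type*}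
    [∀ k, MeasurableSpace (A k)] (κ : ∀ k, Kernel W (A k)) [∀ k, IsMarkovKernel (κ k)] :
    IsMarkovKernel (piKernel κ) :=
  ⟨fun w => by rw [piKernel_apply]; infer_instance⟩

/-- Maximal coupling. -/
theorem exists_coupling {A : Type*} [MeasurableSpace A] [StandardBorelSpace A]
    (κ κ' : Measure A) [IsProbabilityMeasure κ] [IsProbabilityMeasure κ'] (c : ℝ≥0∞)
    (h : ∀ s, MeasurableSet s → κ s ≤ κ' s + c) :
    ∃ π : Measure (A × A), IsProbabilityMeasure π ∧ π.map Prod.fst = κ ∧ π.map Prod.snd = κ' ∧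
      π {p | p.1 ≠ p.2} ≤ c := by
  obtain ⟨s, hs, h1, h2⟩ := hahn_decomposition κ κ'
  set η : Measure A := κ'.restrict s + κ.restrict sᶜ with hη
  have hηκ : η ≤ κ := by
    refine Measure.le_iff.2 fun t ht => ?_
    rw [hη, Measure.add_apply, Measure.restrict_apply ht, Measure.restrict_apply ht,
      ← measure_inter_add_sdiff t hs]
    exact add_le_add (h1 _ (ht.inter hs) inter_subset_right) le_rfl
  have hηκ' : η ≤ κ' := by
    refine Measure.le_iff.2 fun t ht => ?_
    rw [hη, Measure.add_apply, Measure.restrict_apply ht, Measure.restrict_apply ht,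
      ← measure_inter_add_sdiff t hs]
    exact add_le_add le_rfl (h2 _ (ht.diff hs) fun x hx => hx.2)
  have hfin : IsFiniteMeasure η := isFiniteMeasure_of_le κ hηκ
  have ha : κ - η + η = κ := Measure.sub_add_cancel_of_le hηκ
  have ha' : κ' - η + η = κ' := Measure.sub_add_cancel_of_le hηκ'
  set α := κ - η
  set α' := κ' - η
  set t := α univ with ht
  have hs1 : α univ + η univ = 1 := by rw [← Measure.add_apply, ha, measure_univ]
  have hs2 : α' univ + η univ = 1 := by rw [← Measure.add_apply, ha', measure_univ]
  have htt : α' univ = t :=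
    (ENNReal.add_left_inj (measure_ne_top η univ)).1 (hs2.trans hs1.symm)
  have htop : t ≠ ∞ := measure_ne_top _ _
  have htc : t ≤ c := by
    have e1 : κ univ = κ s + κ sᶜ := (measure_add_measure_compl hs).symm
    have e2 : η univ = κ' s + κ sᶜ := by simp [hη]
    have e3 : t + (κ' s + κ sᶜ) = κ s + κ sᶜ := by
      rw [← e2, ← e1, measure_univ (μ := κ)]; exact hs1
    have e4 : t + κ' s = κ s := by
      rw [← add_assoc] at e3
      exact (ENNReal.add_left_inj (measure_ne_top κ sᶜ)).1 e3
    have e5 := h s hs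
    rw [← e4, add_comm] at e5
    exact (ENNReal.add_le_add_iff_left (measure_ne_top κ' s)).1 e5
  have hz : ∀ (ξ : Measure A), ξ univ = t → t⁻¹ • (t • ξ) = ξ := by
    intro ξ hξ
    rw [smul_smul]
    by_cases h0 : t = 0
    · rw [h0] at hξ
      rw [Measure.measure_univ_eq_zero.1 hξ, smul_zero]
    · rw [ENNReal.inv_mul_cancel h0 htop, one_smul]
  have hdiag : Measurable fun a : A => (a, a) := measurable_id.prodMk measurable_id
  set π : Measure (A × A) := η.map (fun a => (a, a)) + t⁻¹ • (α.prod α') with hπ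
  have hf : π.map Prod.fst = κ := by
    rw [hπ, Measure.map_add _ _ measurable_fst, Measure.map_smul,
      Measure.map_map measurable_fst hdiag, Measure.map_fst_prod, htt, hz α rfl]
    rw [show (Prod.fst ∘ fun a : A => (a, a)) = id from rfl, Measure.map_id, add_comm, ha]
  have hsn : π.map Prod.snd = κ' := by
    rw [hπ, Measure.map_add _ _ measurable_snd, Measure.map_smul,
      Measure.map_map measurable_snd hdiag, Measure.map_snd_prod, ← ht, hz α' htt]
    rw [show (Prod.snd ∘ fun a : A => (a, a)) = id from rfl, Measure.map_id, add_comm, ha']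
  have hne : MeasurableSet {p : A × A | p.1 ≠ p.2} :=
    (measurableSet_eq_fun measurable_fst measurable_snd).compl
  refine ⟨π, ⟨?_⟩, hf, hsn, ?_⟩
  · rw [← measure_univ (μ := κ), ← hf, Measure.map_apply measurable_fst MeasurableSet.univ,
      preimage_univ]
  · rw [hπ, Measure.add_apply, Measure.map_apply hdiag hne]
    simp only [Measure.smul_apply, smul_eq_mul]
    have : (fun a : A => (a, a)) ⁻¹' {p : A × A | p.1 ≠ p.2} = ∅ := by ext; simp
    rw [this, measure_empty, zero_add]
    calc t⁻¹ * (α.prod α') {p | p.1 ≠ p.2} ≤ t⁻¹ * (α.prod α') univ := by gcongr; exact subset_univ _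
      _ = t⁻¹ * (t * t) := by rw [← univ_prod_univ, Measure.prod_prod, htt]
      _ = (t⁻¹ * t) * t := (mul_assoc _ _ _).symm
      _ ≤ 1 * t := by gcongr; exact ENNReal.inv_mul_le_one t
      _ ≤ c := by rwa [one_mul]

/-- Infinite products of families with summable distances can be coupled so as to be almost surely
eventually equal. -/
theorem exists_pi_coupling {A : ℕ → Type*} [∀ k, MeasurableSpace (A k)]
    [∀ k, StandardBorelSpace (A k)]
    (κ κ' : ∀ k, Measure (A k)) [∀ k, IsProbabilityMeasure (κ k)]
    [∀ k, IsProbabilityMeasure (κ' k)] (c : ℕ → ℝ≥0∞) (hc : ∑' k, c k ≠ ∞)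
    (h : ∀ k s, MeasurableSet s → κ k s ≤ κ' k s + c k) :
    ∃ π : Measure ((∀ k, A k) × ∀ k, A k), π.map Prod.fst = Measure.infinitePi κ ∧
      π.map Prod.snd = Measure.infinitePi κ' ∧ ∀ᵐ p ∂π, ∀ᶠ k in atTop, p.1 k = p.2 k := by
  choose ρ hρ h1 h2 h3 using fun k => exists_coupling (κ k) (κ' k) (c k) (h k)
  have hm1 : Measurable fun (s : ∀ k, A k × A k) k => (s k).1 :=
    measurable_pi_lambda _ fun k => measurable_fst.comp (measurable_pi_apply k)
  have hm2 : Measurable fun (s : ∀ k, A k × A k) k => (s k).2 :=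
    measurable_pi_lambda _ fun k => measurable_snd.comp (measurable_pi_apply k)
  have key : ∀ᵐ s ∂(Measure.infinitePi ρ), ∀ᶠ k in atTop, (s k).1 = (s k).2 := by
    have hle : ∀ k, Measure.infinitePi ρ {s | (s k).1 ≠ (s k).2} ≤ c k := by
      intro k
      have hm : MeasurableSet {p : A k × A k | p.1 ≠ p.2} :=
        (measurableSet_eq_fun measurable_fst measurable_snd).compl
      refine le_trans (le_of_eq ?_) (h3 k)
      conv_rhs => rw [← Measure.infinitePi_map_eval ρ k]
      rw [Measure.map_apply (measurable_pi_apply k) hm]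
      rfl
    have := ae_eventually_notMem (μ := Measure.infinitePi ρ)
      (s := fun k => {s | (s k).1 ≠ (s k).2}) (ne_top_of_le_ne_top hc (ENNReal.tsum_le_tsum hle))
    filter_upwards [this] with s hs
    filter_upwards [hs] with k hk
    simpa using hk
  refine ⟨(Measure.infinitePi ρ).map fun s => (fun k => (s k).1, fun k => (s k).2), ?_, ?_, ?_⟩
  · rw [Measure.map_map measurable_fst (hm1.prodMk hm2)]
    have := Measure.infinitePi_map_pi (μ := ρ) (f := fun k => Prod.fst) fun k => measurable_fst
    simp_rw [h1] at this
    exact this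
  · rw [Measure.map_map measurable_snd (hm1.prodMk hm2)]
    have := Measure.infinitePi_map_pi (μ := ρ) (f := fun k => Prod.snd) fun k => measurable_snd
    simp_rw [h2] at this
    exact this
  · refine (ae_map_iff (hm1.prodMk hm2).aemeasurable ?_).2 key
    simp only [eventually_atTop, ofPred_exists, ofPred_forall]
    refine MeasurableSet.iUnion fun n => MeasurableSet.iInter fun k => MeasurableSet.iInter fun _ =>
      measurableSet_eq_fun ((measurable_pi_apply k).comp measurable_fst)
        ((measurable_pi_apply k).comp measurable_snd)

/-- Infinite products with summable distances agree on events that are invariant under eventual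
equality inside a full set `G`. -/
theorem infinitePi_eq_of_tail {A : ℕ → Type*} [∀ k, MeasurableSpace (A k)]
    [∀ k, StandardBorelSpace (A k)]
    (κ κ' : ∀ k, Measure (A k)) [∀ k, IsProbabilityMeasure (κ k)]
    [∀ k, IsProbabilityMeasure (κ' k)] (c : ℕ → ℝ≥0∞) (hc : ∑' k, c k ≠ ∞)
    (h : ∀ k s, MeasurableSet s → κ k s ≤ κ' k s + c k) {G G' U : Set (∀ k, A k)}
    (hG : ∀ᵐ s ∂(Measure.infinitePi κ), s ∈ G) (hG' : ∀ᵐ s ∂(Measure.infinitePi κ'), s ∈ G')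
    (hU : MeasurableSet U) (hUG : ∀ s ∈ G, ∀ s' ∈ G', (∀ᶠ k in atTop, s k = s' k) →
      (s ∈ U ↔ s' ∈ U)) : Measure.infinitePi κ U = Measure.infinitePi κ' U := by
  obtain ⟨π, h1, h2, h3⟩ := exists_pi_coupling κ κ' c hc h
  rw [← h1] at hG ⊢
  rw [← h2] at hG' ⊢
  rw [Measure.map_apply measurable_fst hU, Measure.map_apply measurable_snd hU]
  refine measure_congr ?_
  filter_upwards [ae_of_ae_map measurable_fst.aemeasurable hG,
    ae_of_ae_map measurable_snd.aemeasurable hG', h3] with p hp hp' hp3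
  exact propext (hUG _ hp _ hp' hp3)

/-- The length of the overlap of `[x i, x (i + 1))` and `[y j, y (j + 1))`. -/
noncomputable def ovl (x y : ℕ → ℝ) (i j : ℕ) : ℝ :=
  min (x (i + 1)) (y (j + 1)) - min (x i) (y (j + 1)) - min (x (i + 1)) (y j) + min (x i) (y j)

theorem ovl_comm (x y : ℕ → ℝ) (i j : ℕ) : ovl x y i j = ovl y x j i := by
  simp only [ovl, min_comm]; ring

theorem ovl_nonneg {x y : ℕ → ℝ} (hx : Monotone x) (hy : Monotone y) (i j : ℕ) :
    0 ≤ ovl x y i j := by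
  have h1 := hx (Nat.le_succ i)
  have h2 := hy (Nat.le_succ j)
  simp only [ovl]
  simp only [Nat.succ_eq_add_one] at h1 h2
  rcases le_total (x (i + 1)) (y (j + 1)) with a | a <;> rcases le_total (x i) (y (j + 1)) with b | b
    <;> rcases le_total (x (i + 1)) (y j) with c | c <;> rcases le_total (x i) (y j) with d | d <;>
    simp only [a, b, c, d, min_eq_left, min_eq_right] <;> linarith

theorem ovl_eq_zero {x y : ℕ → ℝ} (hx : Monotone x) (hy : Monotone y) {i j : ℕ}
    (h : x (i + 1) ≤ y j ∨ y (j + 1) ≤ x i) : ovl x y i j = 0 := by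
  have h1 := hx (Nat.le_succ i)
  have h2 := hy (Nat.le_succ j)
  simp only [ovl]
  simp only [Nat.succ_eq_add_one] at h1 h2
  rcases h with h | h
  · rw [min_eq_left (h.trans h2), min_eq_left ((h1.trans h).trans h2), min_eq_left h,
      min_eq_left (h1.trans h)]; ring
  · rw [min_eq_right (h.trans h1), min_eq_right h, min_eq_right ((h2.trans h).trans h1),
      min_eq_right (h2.trans h)]; ring

theorem sum_ovl {x y : ℕ → ℝ} (hx : Monotone x) {L M : ℕ} (hx0 : x 0 = 0)
    (hxL : x L = 1) (hy0 : y 0 = 0) (hyM : y M = 1) {i : ℕ} (hi : i < L) :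
    ∑ j ∈ Finset.range M, ovl x y i j = x (i + 1) - x i := by
  have e : ∀ j, ovl x y i j = (min (x (i + 1)) (y (j + 1)) - min (x i) (y (j + 1))) -
      (min (x (i + 1)) (y j) - min (x i) (y j)) := fun j => by simp only [ovl]; ring
  simp_rw [e]
  rw [Finset.sum_range_sub fun j => min (x (i + 1)) (y j) - min (x i) (y j), hyM, hy0]
  have h1 : x (i + 1) ≤ 1 := hxL ▸ hx hi
  have h2 : x i ≤ 1 := hxL ▸ hx hi.le
  have h3 : 0 ≤ x i := hx0 ▸ hx (Nat.zero_le i)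
  have h4 : 0 ≤ x (i + 1) := hx0 ▸ hx (Nat.zero_le _)
  rw [min_eq_left h1, min_eq_left h2, min_eq_right h3, min_eq_right h4]; ring

open scoped Classical in
/-- The index `j < M` of the interval `[y j, y (j + 1))` containing `u`. -/
noncomputable def cut (y : ℕ → ℝ) (M : ℕ) (u : ℝ) : ℕ := Nat.findGreatest (fun j => y j ≤ u) (M - 1)

theorem cut_lt (y : ℕ → ℝ) {M : ℕ} (hM : 0 < M) (u : ℝ) : cut y M u < M :=
  lt_of_le_of_lt (Nat.findGreatest_le _) (Nat.sub_lt hM one_pos)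

theorem cut_spec {y : ℕ → ℝ} {M : ℕ} {u : ℝ} (h0 : y 0 ≤ u) : y (cut y M u) ≤ u := by
  classical
  exact Nat.findGreatest_spec (P := fun j => y j ≤ u) (Nat.zero_le (M - 1)) h0

theorem lt_of_cut_lt {y : ℕ → ℝ} {M : ℕ} {u : ℝ} {j : ℕ} (hj : j < M) (h : cut y M u < j) :
    u < y j := by
  classical
  have := Nat.findGreatest_is_greatest (P := fun j => y j ≤ u) h (Nat.le_sub_one_of_lt hj)
  exact not_le.1 this

theorem sum_ovl_cut_le {x y : ℕ → ℝ} (hx : Monotone x) (hy : Monotone y) {L M : ℕ} (hx0 : x 0 = 0)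
    (hxL : x L = 1) (hy0 : y 0 = 0) (hyM : y M = 1) {δ : ℝ} (hδ0 : 0 ≤ δ)
    (hδ : ∀ i < L, x (i + 1) - x i ≤ δ) :
    ∑ i ∈ Finset.range L, ∑ j ∈ Finset.range M, (if j ≠ cut y M (x i) then ovl x y i j else 0) ≤
      M * δ := by
  classical
  have hM : 0 < M := by
    rcases Nat.eq_zero_or_pos M with h | h
    · rw [h, hy0] at hyM; norm_num at hyM
    · exact h
  have hxnn : ∀ i, 0 ≤ x i := fun i => hx0 ▸ hx (Nat.zero_le i)
  set T : ℕ → ℝ := fun i =>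
    ∑ j ∈ Finset.range M, (if j ≠ cut y M (x i) then ovl x y i j else 0) with hT
  have hTle : ∀ i < L, T i ≤ δ := by
    intro i hi
    refine le_trans (Finset.sum_le_sum fun j _ => ?_)
      ((sum_ovl hx hx0 hxL hy0 hyM hi).le.trans (hδ i hi))
    split_ifs
    · exact le_rfl
    · exact ovl_nonneg hx hy i j
  have hbad : ∀ i, T i ≠ 0 → x i < y (cut y M (x i) + 1) ∧ y (cut y M (x i) + 1) < x (i + 1) := by
    intro i hi
    obtain ⟨j, hj, hne⟩ := Finset.exists_ne_zero_of_sum_ne_zero hi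
    have hj' := Finset.mem_range.1 hj
    split_ifs at hne with hjc
    · have h1 : y j < x (i + 1) := by
        by_contra hcon
        exact hne (ovl_eq_zero hx hy (Or.inl (not_lt.1 hcon)))
      have h2 : x i < y (j + 1) := by
        by_contra hcon
        exact hne (ovl_eq_zero hx hy (Or.inr (not_lt.1 hcon)))
      have h3 : cut y M (x i) < j := by
        rcases lt_or_gt_of_ne hjc with h | h
        · have : y (j + 1) ≤ x i := (hy h).trans (cut_spec (by rw [hy0]; exact hxnn i))
          exact absurd this (not_le.2 h2)
        · exact h
      exact ⟨lt_of_cut_lt (lt_of_le_of_lt h3 hj') (Nat.lt_succ_self _), (hy h3).trans_lt h1⟩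
    · exact absurd rfl hne
  set B := (Finset.range L).filter fun i => T i ≠ 0
  have hinj : ∀ i ∈ B, ∀ i' ∈ B, cut y M (x i) = cut y M (x i') → i = i' := by
    have aux : ∀ i i', T i ≠ 0 → T i' ≠ 0 → cut y M (x i) = cut y M (x i') → ¬ i < i' := by
      intro i i' h h' he hlt
      have h1 := (hbad i h).2
      have h2 := (hbad i' h').1
      rw [← he] at h2
      have h3 : x (i + 1) ≤ x i' := hx hlt
      linarith
    intro i hi i' hi' he
    have h := (Finset.mem_filter.1 hi).2
    have h' := (Finset.mem_filter.1 hi').2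
    exact le_antisymm (not_lt.1 (aux _ _ h' h he.symm)) (not_lt.1 (aux _ _ h h' he))
  have hcard : B.card ≤ M := by
    have := Finset.card_le_card_of_injOn (s := B) (t := Finset.range M) (fun i => cut y M (x i))
      (fun i _ => Finset.mem_coe.2 (Finset.mem_range.2 (cut_lt y hM _)))
      (fun i hi i' hi' he => hinj i hi i' hi' he)
    simpa using this
  calc ∑ i ∈ Finset.range L, T i = ∑ i ∈ B, T i := (Finset.sum_filter_ne_zero _).symm
    _ ≤ ∑ i ∈ B, δ := Finset.sum_le_sum fun i hi =>
        hTle i (Finset.mem_range.1 (Finset.mem_filter.1 hi).1)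
    _ = B.card * δ := by rw [Finset.sum_const, nsmul_eq_mul]
    _ ≤ M * δ := by gcongr

/-- The partition of `[0, 1]` into `M` equal intervals. -/
noncomputable def unifPart (M : ℕ) (j : ℕ) : ℝ := j / M

theorem unifPart_mono (M : ℕ) : Monotone (unifPart M) := fun i j h => by
  simp only [unifPart]; gcongr

theorem unifPart_zero (M : ℕ) : unifPart M 0 = 0 := by simp [unifPart]

theorem unifPart_self {M : ℕ} (hM : 0 < M) : unifPart M M = 1 := by
  simp only [unifPart]; exact div_self (by positivity)

theorem unifPart_succ_sub (M j : ℕ) : unifPart M (j + 1) - unifPart M j = 1 / M := by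
  simp only [unifPart]; push_cast; ring

/-- Conditional distribution functions of a finitely valued random variable. -/
theorem exists_cdf {W V : Type*} [MeasurableSpace W] [MeasurableSpace V] (P : Measure W)
    [IsProbabilityMeasure P] {v : W → V} (hv : Measurable v) {l : W → ℕ} (hl : Measurable l)
    {L : ℕ} (hlL : ∀ w, l w < L) :
    ∃ F : V → ℕ → ℝ, (∀ e, Measurable fun x => F x e) ∧ (∀ x, Monotone (F x)) ∧
      (∀ x, F x 0 = 0) ∧ (∀ x, F x L = 1) ∧
      ∀ Ψ : V → ℕ → ℝ≥0∞, (∀ e, Measurable fun x => Ψ x e) →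
        ∫⁻ w, Ψ (v w) (l w) ∂P =
          ∫⁻ w, ∑ e ∈ Finset.range L, ENNReal.ofReal (F (v w) (e + 1) - F (v w) e) * Ψ (v w) e ∂P := by
  classical
  have hWne : Nonempty W := nonempty_of_isProbabilityMeasure P
  have hL0 : 0 < L := lt_of_le_of_lt (Nat.zero_le _) (hlL hWne.some)
  set K := condDistrib l v P with hK
  let F : V → ℕ → ℝ := fun x e => if L ≤ e then 1 else (K x).real (Iio e)
  have hjoint : P.map (fun w => (v w, l w)) = P.map v ⊗ₘ K :=
    (compProd_map_condDistrib hl.aemeasurable).symm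
  have hval : ∀ Ψ : V → ℕ → ℝ≥0∞, (∀ e, Measurable fun x => Ψ x e) →
      ∫⁻ w, Ψ (v w) (l w) ∂P = ∫⁻ w, ∑' e, K (v w) {e} * Ψ (v w) e ∂P := by
    intro Ψ hΨ
    have hm : Measurable fun p : V × ℕ => Ψ p.1 p.2 := measurable_from_prod_countable_left hΨ
    have h1 : ∫⁻ w, Ψ (v w) (l w) ∂P = ∫⁻ p, Ψ p.1 p.2 ∂(P.map fun w => (v w, l w)) :=
      (lintegral_map hm (hv.prodMk hl)).symm
    rw [h1, hjoint, Measure.lintegral_compProd hm, lintegral_map (hm.lintegral_kernel_prod_right') hv]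
    refine lintegral_congr fun w => ?_
    rw [lintegral_countable']
    exact tsum_congr fun e => mul_comm _ _
  have hnull : ∀ᵐ w ∂P, ∀ e, L ≤ e → K (v w) {e} = 0 := by
    refine ae_all_iff.2 fun e => ?_
    by_cases he : L ≤ e
    · have h1 := hval (fun _ i => if i = e then 1 else 0) fun i => measurable_const
      have h2 : ∫⁻ w, (if l w = e then 1 else 0 : ℝ≥0∞) ∂P = 0 := by
        have : ∀ w, l w ≠ e := fun w h => absurd (hlL w) (by omega)
        simp [this]
      rw [h2] at h1
      have h3 : ∀ w, ∑' i, K (v w) {i} * (if i = e then 1 else 0 : ℝ≥0∞) = K (v w) {e} := by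
        intro w
        rw [tsum_eq_single e (by intro b hb; simp [hb])]; simp
      simp_rw [h3] at h1
      have h4 : Measurable fun w => K (v w) {e} :=
        (K.measurable_coe (measurableSet_singleton e)).comp hv
      have h5 := (lintegral_eq_zero_iff h4).1 h1.symm
      filter_upwards [h5] with w hw _
      exact hw
    · exact Eventually.of_forall fun w h => absurd h he
  have hIio : ∀ x e, (K x).real (Iio (e + 1)) = (K x).real (Iio e) + (K x).real {e} := by
    intro x e
    rw [← measureReal_union (by simp) (measurableSet_singleton e)]
    congr 1; ext i; simp only [mem_Iio, mem_union, mem_singleton_iff]; omega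
  have hinc : ∀ᵐ w ∂P, ∀ e < L, ENNReal.ofReal (F (v w) (e + 1) - F (v w) e) = K (v w) {e} := by
    filter_upwards [hnull] with w hw e he
    have hIL : (K (v w)).real (Iio L) = 1 := by
      have : K (v w) (Ici L) = 0 := by
        rw [← biUnion_of_singleton (Ici L)]
        exact (measure_biUnion_null_iff (to_countable _)).2 fun e he => hw e he
      rw [← compl_Ici, measureReal_compl measurableSet_Ici]
      simp [Measure.real, this]
    have h1 : F (v w) (e + 1) = (K (v w)).real (Iio (e + 1)) := by
      simp only [F]
      split_ifs with h
      · rw [show e + 1 = L by omega, hIL]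
      · rfl
    have h2 : F (v w) e = (K (v w)).real (Iio e) := if_neg (not_le.2 he)
    rw [h1, h2, hIio, add_sub_cancel_left, Measure.real, ENNReal.ofReal_toReal (measure_ne_top _ _)]
  refine ⟨F, ?_, ?_, ?_, ?_, ?_⟩
  · intro e
    simp only [F]
    split_ifs
    · exact measurable_const
    · exact (K.measurable_coe measurableSet_Iio).ennreal_toReal
  · intro x e e' hee
    simp only [F]
    split_ifs with h h' h'
    · exact le_rfl
    · omega
    · exact measureReal_le_one
    · exact measureReal_mono (Iio_subset_Iio hee)
  · intro x
    simp only [F, if_neg (not_le.2 hL0)]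
    simp
  · intro x; simp [F]
  · intro Ψ hΨ
    rw [hval Ψ hΨ]
    refine lintegral_congr_ae ?_
    filter_upwards [hnull, hinc] with w h1 h2
    rw [tsum_eq_sum (s := Finset.range L) fun e he => by
      rw [h1 e (not_lt.1 fun h => he (Finset.mem_range.2 h)), zero_mul]]
    exact Finset.sum_congr rfl fun e he => by rw [h2 e (Finset.mem_range.1 he)]

/-- A kernel into a finite type given by its densities. -/
noncomputable def finKernel {W : Type*} [MeasurableSpace W] {M : ℕ} (d : W → Fin M → ℝ≥0∞)
    (hd : ∀ a, Measurable fun w => d w a) : Kernel W (Fin M) where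
  toFun w := ∑ a, d w a • Measure.dirac a
  measurable' := by
    refine Measure.measurable_of_measurable_coe _ fun s hs => ?_
    simp only [Measure.coe_finsetSum, Finset.sum_apply, Measure.smul_apply, smul_eq_mul]
    exact Finset.measurable_fun_sum _ fun a _ => (hd a).mul_const _

theorem finKernel_apply {W : Type*} [MeasurableSpace W] {M : ℕ} (d : W → Fin M → ℝ≥0∞)
    (hd : ∀ a, Measurable fun w => d w a) (w : W) (s : Set (Fin M)) :
    finKernel d hd w s = ∑ a, d w a * s.indicator 1 a := by
  simp [finKernel, Finset.sum_apply]

theorem finKernel_singleton {W : Type*} [MeasurableSpace W] {M : ℕ} (d : W → Fin M → ℝ≥0∞)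
    (hd : ∀ a, Measurable fun w => d w a) (w : W) (a : Fin M) :
    finKernel d hd w {a} = d w a := by
  rw [finKernel_apply, Finset.sum_eq_single a]
  · simp
  · intro b _ hb; simp [hb]
  · simp

theorem finKernel_markov {W : Type*} [MeasurableSpace W] {M : ℕ} (d : W → Fin M → ℝ≥0∞)
    (hd : ∀ a, Measurable fun w => d w a) (h1 : ∀ w, ∑ a, d w a = 1) :
    IsMarkovKernel (finKernel d hd) :=
  ⟨fun w => ⟨by rw [finKernel_apply]; simpa using h1 w⟩⟩

/-- The conditional distribution of the digit given the label. -/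
noncomputable def digitProb (F : ℕ → ℝ) (M e a : ℕ) : ℝ :=
  if F (e + 1) - F e = 0 then 1 / M else ovl F (unifPart M) e a / (F (e + 1) - F e)

theorem digitProb_nonneg {F : ℕ → ℝ} (hF : Monotone F) (M e a : ℕ) : 0 ≤ digitProb F M e a := by
  simp only [digitProb]
  split_ifs
  · positivity
  · exact div_nonneg (ovl_nonneg hF (unifPart_mono M) e a) (sub_nonneg.2 (hF (Nat.le_succ e)))

theorem sum_digitProb {F : ℕ → ℝ} (hF : Monotone F) {L M : ℕ} (hM : 0 < M) (h0 : F 0 = 0)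
    (hL : F L = 1) {e : ℕ} (he : e < L) :
    ∑ a ∈ Finset.range M, digitProb F M e a = 1 := by
  simp only [digitProb]
  split_ifs with h
  · simp; field_simp
  · rw [← Finset.sum_div, sum_ovl hF h0 hL (unifPart_zero M) (unifPart_self hM) he, div_self h]

theorem mul_digitProb {F : ℕ → ℝ} (hF : Monotone F) {L M : ℕ} (hM : 0 < M) (h0 : F 0 = 0)
    (hL : F L = 1) {e a : ℕ} (he : e < L) (ha : a < M) :
    (F (e + 1) - F e) * digitProb F M e a = ovl F (unifPart M) e a := by
  simp only [digitProb]
  split_ifs with h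
  · have h1 := sum_ovl hF h0 hL (unifPart_zero M) (unifPart_self hM) he
    rw [h] at h1
    have h2 := (Finset.sum_eq_zero_iff_of_nonneg fun a _ =>
      ovl_nonneg hF (unifPart_mono M) e a).1 h1 a (Finset.mem_range.2 ha)
    rw [h, h2, zero_mul]
  · field_simp

theorem digitProb_measurable {V : Type*} [MeasurableSpace V] {F : V → ℕ → ℝ}
    (hF : ∀ e, Measurable fun x => F x e) (M e a : ℕ) :
    Measurable fun x => digitProb (F x) M e a := by
  simp only [digitProb, ovl]
  have := hF e
  have := hF (e + 1)
  refine Measurable.ite (measurableSet_eq_fun (by fun_prop) measurable_const) (by fun_prop) ?_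
  fun_prop

/-- A random digit, uniformly distributed given `v`, that approximately encodes the label `l`. -/
theorem exists_digit {W V : Type*} [MeasurableSpace W] [MeasurableSpace V] (P : Measure W)
    [IsProbabilityMeasure P] {v : W → V} (hv : Measurable v) {l : W → ℕ} (hl : Measurable l)
    {L M : ℕ} (hM : 0 < M) {F : V → ℕ → ℝ} (hlL : ∀ w, l w < L)
    (hFm : ∀ e, Measurable fun x => F x e) (hF : ∀ x, Monotone (F x))
    (hF0 : ∀ x, F x 0 = 0) (hFL : ∀ x, F x L = 1)
    (hFΨ : ∀ Ψ : V → ℕ → ℝ≥0∞, (∀ e, Measurable fun x => Ψ x e) →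
        ∫⁻ w, Ψ (v w) (l w) ∂P = ∫⁻ w, ∑ e ∈ Finset.range L,
          ENNReal.ofReal (F (v w) (e + 1) - F (v w) e) * Ψ (v w) e ∂P) :
    ∃ κ : Kernel W (Fin M), IsMarkovKernel κ ∧
      (∀ w w', v w = v w' → l w = l w' → κ w = κ w') ∧
      (∀ Φ : V → ℕ → ℕ → ℝ≥0∞, (∀ e a, Measurable fun x => Φ x e a) →
        ∫⁻ w, ∑ a : Fin M, κ w {a} * Φ (v w) (l w) a ∂P =
        ∫⁻ w, ∑ e ∈ Finset.range L, ∑ a ∈ Finset.range M,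
          ENNReal.ofReal (ovl (F (v w)) (unifPart M) e a) * Φ (v w) e a ∂P) := by
  let d : W → Fin M → ℝ≥0∞ := fun w a => ENNReal.ofReal (digitProb (F (v w)) M (l w) a)
  have hd : ∀ a, Measurable fun w => d w a := by
    intro a
    have : Measurable fun p : V × ℕ => digitProb (F p.1) M p.2 a :=
      measurable_from_prod_countable_left fun e => digitProb_measurable hFm M e a
    exact (this.comp (hv.prodMk hl)).ennreal_ofReal
  have hsum : ∀ w, ∑ a, d w a = 1 := by
    intro w
    simp only [d]
    rw [← ENNReal.ofReal_sum_of_nonneg fun a _ => digitProb_nonneg (hF _) _ _ _,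
      Fin.sum_univ_eq_sum_range (fun a => digitProb (F (v w)) M (l w) a),
      sum_digitProb (hF _) hM (hF0 _) (hFL _) (hlL w), ENNReal.ofReal_one]
  refine ⟨finKernel d hd, finKernel_markov d hd hsum, ?_, ?_⟩
  · intro w w' h1 h2
    have : d w = d w' := by funext a; simp only [d, h1, h2]
    refine Measure.ext fun s _ => ?_
    rw [finKernel_apply, finKernel_apply, this]
  · intro Φ hΦ
    simp_rw [finKernel_singleton]
    have h1 := hFΨ (fun x e => ∑ a ∈ Finset.range M, ENNReal.ofReal (digitProb (F x) M e a) * Φ x e a)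
      (fun e => Finset.measurable_fun_sum _ fun a _ =>
        (digitProb_measurable hFm M e a).ennreal_ofReal.mul (hΦ e a))
    have h2 : ∀ w, ∑ a : Fin M, d w a * Φ (v w) (l w) a = ∑ a ∈ Finset.range M,
        ENNReal.ofReal (digitProb (F (v w)) M (l w) a) * Φ (v w) (l w) a := fun w =>
      Fin.sum_univ_eq_sum_range
        (fun a => ENNReal.ofReal (digitProb (F (v w)) M (l w) a) * Φ (v w) (l w) a) M
    simp_rw [h2, h1]
    refine lintegral_congr fun w => Finset.sum_congr rfl fun e he => ?_
    rw [Finset.mul_sum]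
    refine Finset.sum_congr rfl fun a ha => ?_
    rw [← mul_assoc, ← ENNReal.ofReal_mul (sub_nonneg.2 (hF _ (Nat.le_succ e))),
      mul_digitProb (hF _) hM (hF0 _) (hFL _) (Finset.mem_range.1 he) (Finset.mem_range.1 ha)]

theorem finMeasure_apply {M : ℕ} (m : Measure (Fin M)) (s : Set (Fin M)) :
    m s = ∑ a : Fin M, m {a} * s.indicator 1 a := by
  classical
  have := lintegral_fintype (μ := m) (s.indicator 1)
  rw [lintegral_indicator_one (Set.toFinite s).measurableSet] at this
  rw [this]
  exact Finset.sum_congr rfl fun a _ => mul_comm _ _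

theorem measurable_cut {V : Type*} [MeasurableSpace V] {y : V → ℕ → ℝ} {u : V → ℝ}
    (hy : ∀ e, Measurable fun x => y x e) (hu : Measurable u) (M : ℕ) :
    Measurable fun x => cut (y x) M (u x) := by
  classical
  exact measurable_findGreatest fun k _ => measurableSet_le (hy k) hu

section DigitConsequences

variable {W V : Type*} [MeasurableSpace W] [MeasurableSpace V] {P : Measure W}
    {v : W → V} {l : W → ℕ}
    {L M : ℕ} {F : V → ℕ → ℝ} {κ : Kernel W (Fin M)}

theorem lintegral_digit_uniform (hM : 0 < M)
    (hF : ∀ x, Monotone (F x)) (hF0 : ∀ x, F x 0 = 0) (hFL : ∀ x, F x L = 1)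
    (hκ : ∀ Φ : V → ℕ → ℕ → ℝ≥0∞, (∀ e a, Measurable fun x => Φ x e a) →
        ∫⁻ w, ∑ a : Fin M, κ w {a} * Φ (v w) (l w) a ∂P =
        ∫⁻ w, ∑ e ∈ Finset.range L, ∑ a ∈ Finset.range M,
          ENNReal.ofReal (ovl (F (v w)) (unifPart M) e a) * Φ (v w) e a ∂P)
    (hv : Measurable v) (a : Fin M) {g : V → ℝ≥0∞} (hg : Measurable g) :
    ∫⁻ w, κ w {a} * g (v w) ∂P = (M : ℝ≥0∞)⁻¹ * ∫⁻ w, g (v w) ∂P := by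
  have h := hκ (fun x _ i => if i = a then g x else 0) fun e i => by
    split_ifs
    · exact hg
    · exact measurable_const
  have h1 : ∀ w, ∑ i : Fin M, κ w {i} * (if (i : ℕ) = a then g (v w) else 0) =
      κ w {a} * g (v w) := by
    intro w
    rw [Finset.sum_eq_single a]
    · simp
    · intro b _ hb
      rw [if_neg fun h => hb (Fin.ext h), mul_zero]
    · simp
  simp_rw [h1] at h
  rw [h, ← lintegral_const_mul _ (show Measurable fun w => g (v w) from hg.comp hv)]
  refine lintegral_congr fun w => ?_
  rw [Finset.sum_comm, Finset.sum_eq_single (a : ℕ)]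
  · simp only [if_true]
    rw [← Finset.sum_mul, ← ENNReal.ofReal_sum_of_nonneg fun e _ =>
      ovl_nonneg (hF _) (unifPart_mono M) e a]
    simp_rw [ovl_comm (F (v w))]
    rw [sum_ovl (unifPart_mono M) (unifPart_zero M) (unifPart_self hM) (hF0 _) (hFL _) a.2,
      unifPart_succ_sub, one_div, ENNReal.ofReal_inv_of_pos (by exact_mod_cast hM),
      ENNReal.ofReal_natCast]
  · intro b _ hb
    simp [hb]
  · intro h; exact absurd (Finset.mem_range.2 a.2) h

theorem lintegral_digit_event
    (hκ : ∀ Φ : V → ℕ → ℕ → ℝ≥0∞, (∀ e a, Measurable fun x => Φ x e a) →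
        ∫⁻ w, ∑ a : Fin M, κ w {a} * Φ (v w) (l w) a ∂P =
        ∫⁻ w, ∑ e ∈ Finset.range L, ∑ a ∈ Finset.range M,
          ENNReal.ofReal (ovl (F (v w)) (unifPart M) e a) * Φ (v w) e a ∂P)
    (p : V → ℕ → ℕ → Prop) [∀ x e a, Decidable (p x e a)]
    (hp : ∀ e a, MeasurableSet {x | p x e a}) (hF : ∀ x, Monotone (F x)) :
    ∫⁻ w, κ w {a | p (v w) (l w) a} ∂P =
        ∫⁻ w, ENNReal.ofReal (∑ e ∈ Finset.range L, ∑ a ∈ Finset.range M,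
          if p (v w) e a then ovl (F (v w)) (unifPart M) e a else 0) ∂P := by
  have h := hκ (fun x e a => if p x e a then 1 else 0) fun e a =>
    Measurable.ite (hp e a) measurable_const measurable_const
  have h1 : ∀ w, κ w {a | p (v w) (l w) a} =
      ∑ a : Fin M, κ w {a} * (if p (v w) (l w) a then 1 else 0) := by
    intro w
    rw [finMeasure_apply]
    refine Finset.sum_congr rfl fun a _ => ?_
    simp [indicator_apply]
  simp_rw [h1]
  rw [h]
  refine lintegral_congr fun w => ?_
  have nn : ∀ e a, 0 ≤ if p (v w) e a then ovl (F (v w)) (unifPart M) e a else 0 := fun e a => by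
    split_ifs
    · exact ovl_nonneg (hF _) (unifPart_mono M) e a
    · exact le_rfl
  rw [ENNReal.ofReal_sum_of_nonneg fun e _ => Finset.sum_nonneg fun a _ => nn e a]
  refine Finset.sum_congr rfl fun e _ => ?_
  rw [ENNReal.ofReal_sum_of_nonneg fun a _ => nn e a]
  refine Finset.sum_congr rfl fun a _ => ?_
  split_ifs <;> simp

theorem lintegral_digit_encode_le (hM : 0 < M) (hFm : ∀ e, Measurable fun x => F x e)
    (hF : ∀ x, Monotone (F x)) (hF0 : ∀ x, F x 0 = 0) (hFL : ∀ x, F x L = 1)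
    (hκ : ∀ Φ : V → ℕ → ℕ → ℝ≥0∞, (∀ e a, Measurable fun x => Φ x e a) →
        ∫⁻ w, ∑ a : Fin M, κ w {a} * Φ (v w) (l w) a ∂P =
        ∫⁻ w, ∑ e ∈ Finset.range L, ∑ a ∈ Finset.range M,
          ENNReal.ofReal (ovl (F (v w)) (unifPart M) e a) * Φ (v w) e a ∂P)
    {δ : V → ℝ} (hδ0 : ∀ x, 0 ≤ δ x)
    (hδ : ∀ᵐ w ∂P, ∀ e < L, F (v w) (e + 1) - F (v w) e ≤ δ (v w)) :
    ∫⁻ w, κ w {a | (a : ℕ) ≠ cut (unifPart M) M (F (v w) (l w))} ∂P ≤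
      M * ∫⁻ w, ENNReal.ofReal (δ (v w)) ∂P := by
  classical
  have h := lintegral_digit_event hκ (fun x e a => a ≠ cut (unifPart M) M (F x e)) (fun e a =>
    (measurableSet_eq_fun measurable_const
      (measurable_cut (y := fun _ => unifPart M) (fun _ => measurable_const) (hFm e) M)).compl) hF
  rw [h]
  rw [← lintegral_const_mul' _ _ (ENNReal.natCast_ne_top M)]
  refine lintegral_mono_ae ?_
  filter_upwards [hδ] with w hw
  rw [← ENNReal.ofReal_natCast M, ← ENNReal.ofReal_mul (by positivity)]
  exact ENNReal.ofReal_le_ofReal (sum_ovl_cut_le (hF _) (unifPart_mono M) (hF0 _) (hFL _)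
    (unifPart_zero M) (unifPart_self hM) (hδ0 _) hw)

theorem lintegral_digit_decode_le (hM : 0 < M) (hFm : ∀ e, Measurable fun x => F x e)
    (hF : ∀ x, Monotone (F x)) (hF0 : ∀ x, F x 0 = 0) (hFL : ∀ x, F x L = 1)
    (hκ : ∀ Φ : V → ℕ → ℕ → ℝ≥0∞, (∀ e a, Measurable fun x => Φ x e a) →
        ∫⁻ w, ∑ a : Fin M, κ w {a} * Φ (v w) (l w) a ∂P =
        ∫⁻ w, ∑ e ∈ Finset.range L, ∑ a ∈ Finset.range M,
          ENNReal.ofReal (ovl (F (v w)) (unifPart M) e a) * Φ (v w) e a ∂P)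
    [IsProbabilityMeasure P] :
    ∫⁻ w, κ w {a | l w ≠ cut (F (v w)) L (unifPart M a)} ∂P ≤ ENNReal.ofReal (L / M) := by
  classical
  have h := lintegral_digit_event hκ (fun x e a => e ≠ cut (F x) L (unifPart M a)) (fun e a =>
    (measurableSet_eq_fun measurable_const (measurable_cut hFm measurable_const L)).compl) hF
  rw [h]
  calc _ ≤ ∫⁻ w, ENNReal.ofReal (L / M) ∂P := by
        refine lintegral_mono fun w => ENNReal.ofReal_le_ofReal ?_
        rw [Finset.sum_comm]
        simp_rw [ovl_comm (F (v w))]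
        refine (sum_ovl_cut_le (unifPart_mono M) (hF _) (unifPart_zero M) (unifPart_self hM) (hF0 _)
          (hFL _) (δ := 1 / M) (by positivity) fun i _ => (unifPart_succ_sub M i).le).trans ?_
        rw [mul_one_div]
    _ = ENNReal.ofReal (L / M) := by simp

end DigitConsequences

/-- The uniform distribution on `Fin M`. -/
noncomputable def unifFin (M : ℕ) : Measure (Fin M) := (M : ℝ≥0∞)⁻¹ • Measure.count

instance (M : ℕ) [NeZero M] : IsProbabilityMeasure (unifFin M) :=
  ⟨by
    simp only [unifFin, Measure.smul_apply, smul_eq_mul]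
    rw [Measure.count_univ, ENat.card_eq_coe_fintype_card, Fintype.card_fin]
    exact ENNReal.inv_mul_cancel (by simpa using NeZero.ne M) (ENNReal.natCast_ne_top M)⟩

theorem unifFin_singleton (M : ℕ) (a : Fin M) : unifFin M {a} = (M : ℝ≥0∞)⁻¹ := by
  simp [unifFin]

/-- The product of the uniform distributions. -/
noncomputable def bern (M : ℕ → ℕ) [∀ k, NeZero (M k)] : Measure (∀ k, Fin (M k)) :=
  Measure.infinitePi fun k => unifFin (M k)

instance (M : ℕ → ℕ) [∀ k, NeZero (M k)] : IsProbabilityMeasure (bern M) := by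
  unfold bern; infer_instance

/-- The cylinder of sequences agreeing with `c` on `s`. -/
def cyl {M : ℕ → ℕ} (s : Finset ℕ) (c : ∀ k, Fin (M k)) : Set (∀ k, Fin (M k)) :=
  {b | ∀ i ∈ s, b i = c i}

theorem cyl_eq_pi {M : ℕ → ℕ} (s : Finset ℕ) (c : ∀ k, Fin (M k)) :
    cyl s c = Set.pi s fun i => {c i} := by
  ext b; simp [cyl]

theorem measurableSet_cyl {M : ℕ → ℕ} (s : Finset ℕ) (c : ∀ k, Fin (M k)) :
    MeasurableSet (cyl s c) := by
  rw [cyl_eq_pi]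
  exact MeasurableSet.pi s.countable_toSet fun i _ => measurableSet_singleton _

theorem infinitePi_cyl {M : ℕ → ℕ} (m : ∀ k, Measure (Fin (M k))) [∀ k, IsProbabilityMeasure (m k)]
    (s : Finset ℕ) (c : ∀ k, Fin (M k)) :
    Measure.infinitePi m (cyl s c) = ∏ i ∈ s, m i {c i} := by
  rw [cyl_eq_pi, Measure.infinitePi_pi _ fun i _ => measurableSet_singleton _]

theorem bern_cyl {M : ℕ → ℕ} [∀ k, NeZero (M k)] (s : Finset ℕ) (c : ∀ k, Fin (M k)) :
    bern M (cyl s c) = ∏ i ∈ s, (M i : ℝ≥0∞)⁻¹ := by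
  rw [bern, infinitePi_cyl]
  exact Finset.prod_congr rfl fun i _ => unifFin_singleton _ _

/-- Finite measures on a product of finite sets agreeing on long cylinders are equal. -/
theorem ext_cyl {M : ℕ → ℕ} [∀ k, NeZero (M k)] {m m' : Measure (∀ k, Fin (M k))}
    [IsFiniteMeasure m] (k₀ : ℕ)
    (h : ∀ j ≥ k₀, ∀ c, m (cyl (Finset.range j) c) = m' (cyl (Finset.range j) c)) : m = m' := by
  classical
  have hfin : ∀ j, ({S | ∃ c : ∀ k, Fin (M k), S = cyl (Finset.range j) c}).Finite := by
    intro j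
    refine (Set.finite_range fun (c : ∀ k : Fin j, Fin (M k)) =>
      cyl (Finset.range j) fun k => if hk : k < j then c ⟨k, hk⟩ else 0).subset ?_
    rintro S ⟨c, rfl⟩
    refine ⟨fun k => c k, ?_⟩
    ext b
    simp only [cyl, Finset.mem_range]
    exact forall_congr' fun i => forall_congr' fun hi => by simp [hi]
  have huniv : m univ = m' univ := by
    have e : (univ : Set (∀ k, Fin (M k))) =
        ⋃ S ∈ {S | ∃ c : ∀ k, Fin (M k), S = cyl (Finset.range k₀) c}, S := by
      refine (eq_univ_of_forall fun b => ?_).symm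
      exact mem_biUnion (x := cyl (Finset.range k₀) b) ⟨b, rfl⟩ fun i _ => rfl
    have hd : ({S | ∃ c : ∀ k, Fin (M k), S = cyl (Finset.range k₀) c}).PairwiseDisjoint id := by
      rintro S ⟨c, rfl⟩ S' ⟨c', rfl⟩ hne
      refine Set.disjoint_left.2 fun b hb hb' => hne ?_
      ext x
      exact forall_congr' fun i => forall_congr' fun hi => by rw [← hb i hi, ← hb' i hi]
    have hm : ∀ S ∈ {S | ∃ c : ∀ k, Fin (M k), S = cyl (Finset.range k₀) c},
        MeasurableSet (id S) := by
      rintro S ⟨c, rfl⟩; exact measurableSet_cyl _ _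
    have h1 := measure_biUnion (μ := m) (hfin k₀).countable hd hm
    have h2 := measure_biUnion (μ := m') (hfin k₀).countable hd hm
    simp only [id] at h1 h2
    rw [e, h1, h2]
    refine tsum_congr ?_
    rintro ⟨S, c, rfl⟩
    exact h k₀ le_rfl c
  refine ext_of_generate_finite {S | ∃ j ≥ k₀, ∃ c : ∀ k, Fin (M k), S = cyl (Finset.range j) c}
    ?_ ?_ ?_ huniv
  · refine le_antisymm ?_ (MeasurableSpace.generateFrom_le ?_)
    · refine iSup_le fun i => ?_
      rintro S ⟨s, -, rfl⟩
      have : Function.eval i ⁻¹' s = ⋃ S ∈ {S | (∃ c : ∀ k, Fin (M k),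
          S = cyl (Finset.range (max (i + 1) k₀)) c) ∧ S ⊆ Function.eval i ⁻¹' s}, S := by
        refine Subset.antisymm (fun b hb => ?_) (iUnion₂_subset fun S hS => hS.2)
        refine mem_biUnion (x := cyl (Finset.range (max (i + 1) k₀)) b)
          ⟨⟨b, rfl⟩, fun x hx => ?_⟩ fun i _ => rfl
        rw [mem_preimage, Function.eval, hx i (by simp)]; exact hb
      rw [this]
      refine @MeasurableSet.biUnion _ _ (_) _ _
        (((hfin (max (i + 1) k₀)).subset fun S hS => hS.1).countable) ?_
      rintro S ⟨⟨c, rfl⟩, -⟩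
      exact MeasurableSpace.measurableSet_generateFrom ⟨_, le_max_right _ _, c, rfl⟩
    · rintro S ⟨j, -, c, rfl⟩; exact measurableSet_cyl _ _
  · rintro S ⟨j, hj, c, rfl⟩ S' ⟨j', hj', c', rfl⟩ ⟨b, hb, hb'⟩
    refine ⟨max j j', le_max_of_le_left hj, b, ?_⟩
    ext x
    simp only [cyl, Finset.mem_range, lt_max_iff, mem_inter_iff] at hb hb' ⊢
    constructor
    · rintro ⟨h1, h2⟩ i (hi | hi)
      · exact (h1 i hi).trans (hb i hi).symm
      · exact (h2 i hi).trans (hb' i hi).symm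
    · intro h
      exact ⟨fun i hi => (h i (Or.inl hi)).trans (hb i hi),
        fun i hi => (h i (Or.inr hi)).trans (hb' i hi)⟩
  · rintro S ⟨j, hj, c, rfl⟩
    exact h j hj c

/-- A sequence of random digits along a chain `ρ` of maps: the `k`-th digit depends only on `ρ k`
and is uniform given `ρ (k + 1)`. -/
structure IsDigits {W : Type*} [MeasurableSpace W] (P : Measure W) (ρ : ℕ → W → W) (M : ℕ → ℕ)
    (κ : ∀ k, Kernel W (Fin (M k))) : Prop where
  meas : ∀ k, Measurable (ρ k)
  zero : ∀ w, ρ 0 w = w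
  comp : ∀ j k, j ≤ k → ∀ w, ρ k (ρ j w) = ρ k w
  inv : ∀ k w, κ k (ρ k w) = κ k w
  unif : ∀ k a (g : W → ℝ≥0∞), Measurable g →
    ∫⁻ w, κ k w {a} * g (ρ (k + 1) w) ∂P = (M k : ℝ≥0∞)⁻¹ * ∫⁻ w, g (ρ (k + 1) w) ∂P

namespace IsDigits

variable {W : Type*} [MeasurableSpace W] {P : Measure W} {ρ : ℕ → W → W}
  {M : ℕ → ℕ} {κ : ∀ k, Kernel W (Fin (M k))}

theorem inv_le (h : IsDigits P ρ M κ) {j k : ℕ} (hjk : j ≤ k) (w : W) :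
    κ k (ρ j w) = κ k w := by
  rw [← h.inv k (ρ j w), h.comp j k hjk, h.inv]

theorem prod_law (h : IsDigits P ρ M κ) (c : ∀ k, Fin (M k)) (k : ℕ) :
    ∀ g : W → ℝ≥0∞, Measurable g →
    ∫⁻ w, (∏ i ∈ Finset.range k, κ i w {c i}) * g (ρ k w) ∂P =
      (∏ i ∈ Finset.range k, (M i : ℝ≥0∞)⁻¹) * ∫⁻ w, g (ρ k w) ∂P := by
  induction k with
  | zero => intro g _; simp
  | succ k ih =>
    intro g hg
    have h1 : Measurable fun v => κ k v {c k} * g (ρ (k + 1) v) :=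
      ((κ k).measurable_coe (measurableSet_singleton _)).mul (hg.comp (h.meas _))
    have h2 := ih _ h1
    simp_rw [h.inv, h.comp k (k + 1) (Nat.le_succ k)] at h2
    rw [h.unif k (c k) g hg] at h2
    simp_rw [Finset.prod_range_succ, mul_assoc]
    exact h2

variable [∀ k, NeZero (M k)] [∀ k, IsMarkovKernel (κ k)] [IsProbabilityMeasure P]

/-- The digits are independent of everything depending only on the far part of the chain. -/
theorem map_snd_prod (h : IsDigits P ρ M κ) {V : Type*} [MeasurableSpace V] {I : W → V}
    (hI : Measurable I) (hinv : ∀ k w, I (ρ k w) = I w) :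
    (P ⊗ₘ piKernel κ).map (fun p => (p.2, I p.1)) = (bern M).prod (P.map I) := by
  have hmm : Measurable fun p : W × (∀ k, Fin (M k)) => (p.2, I p.1) :=
    measurable_snd.prodMk (hI.comp measurable_fst)
  have hPI : IsProbabilityMeasure (P.map I) := Measure.isProbabilityMeasure_map hI.aemeasurable
  refine (Measure.prod_eq fun s t hs ht => ?_).symm
  have e : (((P ⊗ₘ piKernel κ).restrict (Prod.fst ⁻¹' (I ⁻¹' t))).map Prod.snd) =
      P.map I t • bern M := by
    refine ext_cyl 0 fun j _ c => ?_
    rw [Measure.map_apply measurable_snd (measurableSet_cyl _ _),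
      Measure.restrict_apply (measurable_snd (measurableSet_cyl _ _)), Measure.smul_apply, bern_cyl,
      Measure.compProd_apply ((measurable_snd (measurableSet_cyl _ _)).inter
        (measurable_fst (hI ht)))]
    have h1 : ∀ w, piKernel κ w (Prod.mk w ⁻¹' (Prod.snd ⁻¹' cyl (Finset.range j) c ∩
        Prod.fst ⁻¹' (I ⁻¹' t))) =
        (∏ i ∈ Finset.range j, κ i w {c i}) * (I ⁻¹' t).indicator 1 (ρ j w) := by
      intro w
      rw [← infinitePi_cyl, ← piKernel_apply]
      by_cases hw : I w ∈ t
      · have : ρ j w ∈ I ⁻¹' t := by rw [mem_preimage, hinv]; exact hw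
        rw [indicator_of_mem this, Pi.one_apply, mul_one]
        congr 1; ext b; simp [hw]
      · have : ρ j w ∉ I ⁻¹' t := by rw [mem_preimage, hinv]; exact hw
        rw [indicator_of_notMem this, mul_zero]
        convert measure_empty (μ := piKernel κ w)
        ext b; simp [hw]
    simp_rw [h1]
    rw [h.prod_law c j _ (measurable_one.indicator (hI ht)), smul_eq_mul, mul_comm]
    congr 1
    rw [Measure.map_apply hI ht, ← lintegral_indicator_one (hI ht)]
    refine lintegral_congr fun w => ?_
    by_cases hw : I w ∈ t
    · rw [indicator_of_mem (show ρ j w ∈ I ⁻¹' t by rw [mem_preimage, hinv]; exact hw),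
        indicator_of_mem (show w ∈ I ⁻¹' t from hw)]; rfl
    · rw [indicator_of_notMem (show ρ j w ∉ I ⁻¹' t by rw [mem_preimage, hinv]; exact hw),
        indicator_of_notMem (show w ∉ I ⁻¹' t from hw)]
  have e2 := congrArg (fun m => m s) e
  rw [Measure.map_apply measurable_snd hs, Measure.restrict_apply (measurable_snd hs),
    Measure.smul_apply, smul_eq_mul, mul_comm] at e2
  rw [Measure.map_apply hmm (hs.prod ht), ← e2]
  congr 1

theorem map_snd (h : IsDigits P ρ M κ) : (P ⊗ₘ piKernel κ).map Prod.snd = bern M := by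
  have h1 := h.map_snd_prod (I := fun _ => ()) measurable_const fun _ _ => rfl
  have h2 := congrArg (fun m => Measure.map Prod.fst m) h1
  have hp : IsProbabilityMeasure (P.map fun _ : W => ()) :=
    Measure.isProbabilityMeasure_map measurable_const.aemeasurable
  rw [Measure.map_map measurable_fst (measurable_snd.prodMk measurable_const),
    Measure.map_fst_prod, measure_univ, one_smul] at h2
  exact h2

end IsDigits

/-- Eventual equality of sequences. -/
def Tail {A : ℕ → Type*} (b b' : ∀ k, A k) : Prop := ∃ n, ∀ k, n ≤ k → b k = b' k

theorem tail_equivalence {A : ℕ → Type*} : Equivalence (Tail (A := A)) where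
  refl _ := ⟨0, fun _ _ => rfl⟩
  symm := fun ⟨n, h⟩ => ⟨n, fun k hk => (h k hk).symm⟩
  trans := fun ⟨n, h⟩ ⟨n', h'⟩ => ⟨max n n', fun k hk =>
    (h k (le_of_max_le_left hk)).trans (h' k (le_of_max_le_right hk))⟩

theorem measurableSet_tail {A : ℕ → Type*} [∀ k, MeasurableSpace (A k)]
    [∀ k, StandardBorelSpace (A k)] :
    MeasurableSet {p : (∀ k, A k) × (∀ k, A k) | Tail p.1 p.2} := by
  simp only [Tail, ofPred_exists, ofPred_forall]
  refine MeasurableSet.iUnion fun n => MeasurableSet.iInter fun k => MeasurableSet.iInter fun _ =>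
    measurableSet_eq_fun ((measurable_pi_apply k).comp measurable_fst)
      ((measurable_pi_apply k).comp measurable_snd)

theorem countable_tail {A : ℕ → Type*} [∀ k, Countable (A k)] (b : ∀ k, A k) :
    {b' | Tail b b'}.Countable := by
  classical
  refine (countable_range fun p : Σ n : ℕ, ∀ k : Fin n, A k =>
    (fun k => if hk : k < p.1 then p.2 ⟨k, hk⟩ else b k : ∀ k, A k)).mono ?_
  rintro b' ⟨n, hn⟩
  refine ⟨⟨n, fun k => b' k⟩, ?_⟩
  funext k
  by_cases hk : k < n
  · simp [hk]
  · simp [hk, hn k (not_lt.1 hk)]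

/-- Erase the first `k` digits. -/
def erase {M : ℕ → ℕ} [∀ k, NeZero (M k)] (k : ℕ) (b : ∀ k, Fin (M k)) : ∀ k, Fin (M k) :=
  fun i => if i < k then 0 else b i

theorem measurable_erase {M : ℕ → ℕ} [∀ k, NeZero (M k)] (k : ℕ) :
    Measurable (erase (M := M) k) :=
  measurable_pi_lambda _ fun i => by
    simp only [erase]
    split_ifs
    · exact measurable_const
    · exact measurable_pi_apply i

theorem bern_restrict_map_erase {M : ℕ → ℕ} [∀ k, NeZero (M k)] (k : ℕ) (c : ∀ k, Fin (M k)) :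
    ((bern M).restrict (cyl (Finset.range k) c)).map (erase k) =
      (∏ i ∈ Finset.range k, (M i : ℝ≥0∞)⁻¹) • (bern M).map (erase k) := by
  classical
  refine ext_cyl 0 fun j _ c' => ?_
  rw [Measure.smul_apply, Measure.map_apply (measurable_erase k) (measurableSet_cyl _ _),
    Measure.map_apply (measurable_erase k) (measurableSet_cyl _ _),
    Measure.restrict_apply (measurable_erase k (measurableSet_cyl _ _))]
  by_cases h0 : ∀ i, i < j → i < k → c' i = 0
  · have e1 : erase k ⁻¹' cyl (Finset.range j) c' =
        cyl ((Finset.range j).filter fun i => k ≤ i) c' := by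
      ext b
      simp only [cyl, erase, mem_preimage, mem_ofPred_eq, Finset.mem_range, Finset.mem_filter]
      constructor
      · rintro h i ⟨hi, hk⟩
        have := h i hi
        rwa [if_neg (not_lt.2 hk)] at this
      · intro h i hi
        split_ifs with hk
        · exact (h0 i hi hk).symm
        · exact h i ⟨hi, not_lt.1 hk⟩
    have hdisj : Disjoint ((Finset.range j).filter fun i => k ≤ i) (Finset.range k) := by
      refine Finset.disjoint_left.2 fun i hi hi' => ?_
      have := (Finset.mem_filter.1 hi).2
      have := Finset.mem_range.1 hi'
      omega
    have e2 : cyl ((Finset.range j).filter fun i => k ≤ i) c' ∩ cyl (Finset.range k) c =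
        cyl (((Finset.range j).filter fun i => k ≤ i) ∪ Finset.range k)
          (fun i => if i < k then c i else c' i) := by
      ext b
      simp only [cyl, mem_inter_iff, mem_ofPred_eq, Finset.mem_union, Finset.mem_range,
        Finset.mem_filter]
      constructor
      · rintro ⟨h1, h2⟩ i (hi | hi)
        · rw [if_neg (not_lt.2 hi.2)]; exact h1 i hi
        · rw [if_pos hi]; exact h2 i hi
      · intro h
        refine ⟨fun i hi => ?_, fun i hi => ?_⟩
        · have := h i (Or.inl hi)
          rwa [if_neg (not_lt.2 hi.2)] at this
        · have := h i (Or.inr hi)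
          rwa [if_pos hi] at this
    rw [e1, e2, bern_cyl, bern_cyl, Finset.prod_union hdisj, smul_eq_mul, mul_comm]
  · push Not at h0
    obtain ⟨i, hij, hik, hi⟩ := h0
    have e1 : erase k ⁻¹' cyl (Finset.range j) c' = ∅ := by
      refine eq_empty_of_forall_notMem fun b hb => hi ?_
      have := hb i (Finset.mem_range.2 hij)
      simp only [erase, if_pos hik] at this
      exact this.symm
    rw [e1, empty_inter, measure_empty, smul_zero]

section

variable {W : Type*} [MeasurableSpace W] {P : Measure W} {ρ : ℕ → W → W}
  {M : ℕ → ℕ} {κ : ∀ k, Kernel W (Fin (M k))}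
  [∀ k, NeZero (M k)] [∀ k, IsMarkovKernel (κ k)] [IsProbabilityMeasure P]

/-- The conditional law of `ρ k` given the digits depends only on the digits from `k` on. -/
theorem IsDigits.compProd_erase [StandardBorelSpace W] (h : IsDigits P ρ M κ) (k : ℕ)
    (Q : Kernel (∀ k, Fin (M k)) W) [IsMarkovKernel Q]
    (hQ : (P ⊗ₘ piKernel κ).map Prod.swap = bern M ⊗ₘ Q)
    (R : Kernel (∀ k, Fin (M k)) W) [IsMarkovKernel R]
    (hR : (P ⊗ₘ piKernel κ).map (fun p => (erase k p.2, ρ k p.1)) =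
      (bern M).map (erase k) ⊗ₘ R) :
    ∀ᵐ b ∂(bern M), (Q b).map (ρ k) = R (erase k b) := by
  have hm := h.meas k
  have hswap : Measurable (Prod.swap : W × (∀ k, Fin (M k)) → _) := measurable_swap
  have key : bern M ⊗ₘ (Q.map (ρ k)) = bern M ⊗ₘ (R.comap (erase k) (measurable_erase k)) := by
    refine Measure.ext_prod fun {S U} hS hU => ?_
    rw [Measure.compProd_apply_prod hS hU, Measure.compProd_apply_prod hS hU]
    have hQU : ∀ b, Q.map (ρ k) b U = Q b (ρ k ⁻¹' U) := fun b => Kernel.map_apply' Q hm b hU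
    simp_rw [hQU, Kernel.comap_apply]
    have hmR : Measurable fun b => R (erase k b) U :=
      (R.measurable_coe hU).comp (measurable_erase k)
    have hmQ : Measurable fun b => Q b (ρ k ⁻¹' U) := Q.measurable_coe (hm hU)
    suffices hsuff : (bern M).withDensity (fun b => Q b (ρ k ⁻¹' U)) =
        (bern M).withDensity fun b => R (erase k b) U by
      have := congrArg (fun m => m S) hsuff
      rwa [withDensity_apply _ hS, withDensity_apply _ hS] at this
    have hfin : IsFiniteMeasure ((bern M).withDensity fun b => Q b (ρ k ⁻¹' U)) := by
      refine isFiniteMeasure_withDensity ?_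
      refine ne_top_of_le_ne_top ENNReal.one_ne_top ((lintegral_mono fun b => ?_).trans_eq
        (lintegral_one.trans (measure_univ (μ := bern M))))
      exact prob_le_one
    refine ext_cyl k fun j hj c => ?_
    have hcm := measurableSet_cyl (Finset.range j) c
    rw [withDensity_apply _ hcm, withDensity_apply _ hcm]
    rw [← Measure.compProd_apply_prod hcm (hm hU), ← hQ,
      Measure.map_apply hswap (hcm.prod (hm hU)), preimage_swap_prod,
      Measure.compProd_apply_prod (hm hU) hcm]
    set p := ∏ i ∈ Finset.range k, (M i : ℝ≥0∞)⁻¹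
    set S' := cyl (Finset.Ico k j) c
    have hS'm : MeasurableSet S' := measurableSet_cyl _ _
    have hsplit : cyl (Finset.range j) c = S' ∩ cyl (Finset.range k) c := by
      ext b
      simp only [cyl, S', mem_inter_iff, mem_ofPred_eq, Finset.mem_Ico, Finset.mem_range]
      constructor
      · intro h; exact ⟨fun i hi => h i hi.2, fun i hi => h i (by omega)⟩
      · rintro ⟨h1, h2⟩ i hi
        rcases lt_or_ge i k with hk | hk
        · exact h2 i hk
        · exact h1 i ⟨hk, hi⟩
    have hS'e : erase k ⁻¹' S' = S' := by
      ext b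
      simp only [S', cyl, erase, mem_preimage, mem_ofPred_eq, Finset.mem_Ico]
      exact forall_congr' fun i => forall_congr' fun hi => by rw [if_neg (not_lt.2 hi.1)]
    -- the far part
    have far : ∫⁻ w in ρ k ⁻¹' U, piKernel κ w S' ∂P = ∫⁻ b in S', R (erase k b) U ∂(bern M) := by
      have := congrArg (fun m => m (S' ×ˢ U)) hR
      have hmm : Measurable fun q : W × (∀ k, Fin (M k)) => (erase k q.2, ρ k q.1) :=
        ((measurable_erase k).comp measurable_snd).prodMk (hm.comp measurable_fst)
      rw [Measure.map_apply hmm (hS'm.prod hU), Measure.compProd_apply_prod hS'm hU,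
        setLIntegral_map hS'm (R.measurable_coe hU) (measurable_erase k), hS'e] at this
      rw [← this, ← Measure.compProd_apply_prod (hm hU) hS'm]
      congr 1
      ext ⟨w, b⟩
      have : erase k b ∈ S' ↔ b ∈ S' := by rw [← mem_preimage, hS'e]
      simp [this, and_comm]
    have left : ∫⁻ w in ρ k ⁻¹' U, piKernel κ w (cyl (Finset.range j) c) ∂P =
        p * ∫⁻ w in ρ k ⁻¹' U, piKernel κ w S' ∂P := by
      have hg : Measurable (U.indicator fun w => piKernel κ w S') :=
        ((piKernel κ).measurable_coe hS'm).indicator hU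
      have e := h.prod_law c k _ hg
      have e1 : ∀ w, U.indicator (fun w => piKernel κ w S') (ρ k w) =
          (ρ k ⁻¹' U).indicator (fun w => piKernel κ w S') w := by
        intro w
        by_cases hw : ρ k w ∈ U
        · rw [indicator_of_mem hw, indicator_of_mem (show w ∈ ρ k ⁻¹' U from hw)]
          simp only [S', piKernel_apply, infinitePi_cyl]
          refine Finset.prod_congr rfl fun i hi => ?_
          rw [h.inv_le (Finset.mem_Ico.1 hi).1]
        · rw [indicator_of_notMem hw, indicator_of_notMem (show w ∉ ρ k ⁻¹' U from hw)]
      simp_rw [e1] at e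
      rw [lintegral_indicator (hm hU)] at e
      rw [← e, ← lintegral_indicator (hm hU)]
      refine lintegral_congr fun w => ?_
      by_cases hw : w ∈ ρ k ⁻¹' U
      · rw [indicator_of_mem hw, indicator_of_mem hw]
        simp only [S', piKernel_apply, infinitePi_cyl]
        rw [Finset.prod_range_mul_prod_Ico _ hj]
      · rw [indicator_of_notMem hw, indicator_of_notMem hw, mul_zero]
    have right : ∫⁻ b in cyl (Finset.range j) c, R (erase k b) U ∂(bern M) =
        p * ∫⁻ b in S', R (erase k b) U ∂(bern M) := by
      have e := bern_restrict_map_erase k c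
      have e2 := congrArg (fun m => ∫⁻ b in S', R b U ∂m) e
      rw [Measure.restrict_smul, lintegral_smul_measure,
        setLIntegral_map hS'm (R.measurable_coe hU) (measurable_erase k),
        setLIntegral_map hS'm (R.measurable_coe hU) (measurable_erase k), hS'e,
        Measure.restrict_restrict hS'm, ← hsplit] at e2
      exact e2
    rw [left, right, far]
  filter_upwards [Kernel.ae_eq_of_compProd_eq key] with b hb
  rw [← Kernel.map_apply Q hm, hb, Kernel.comap_apply]

/-- If the digits are almost surely eventually computable from the point, then means for the
relation on the point space transfer to means for eventual equality of digits. -/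
theorem IsDigits.medial_tail [StandardBorelSpace W] (h : IsDigits P ρ M κ)
    {F : W → W → Prop} (hF : Equivalence F) (hFB : MeasurableSet {p : W × W | F p.1 p.2})
    (hFc : ∀ w, {w' | F w w'}.Countable) (hmed : Medial P F) (hFρ : ∀ k w, F w (ρ k w))
    (enc : ∀ k, W → Fin (M k)) (henc : ∀ k, Measurable (enc k))
    (herr : ∑' k, ∫⁻ w, κ k w {a | a ≠ enc k w} ∂P ≠ ∞) :
    Medial (bern M) Tail := by
  have hW : Nonempty W := nonempty_of_isProbabilityMeasure P
  set J := P ⊗ₘ piKernel κ with hJ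
  set Q : Kernel (∀ k, Fin (M k)) W := condDistrib Prod.fst Prod.snd J with hQdef
  have hQ : J.map Prod.swap = bern M ⊗ₘ Q := by
    rw [← h.map_snd, compProd_map_condDistrib measurable_fst.aemeasurable]; rfl
  set R : ℕ → Kernel (∀ k, Fin (M k)) W := fun k =>
    condDistrib (fun p : W × (∀ k, Fin (M k)) => ρ k p.1) (fun p => erase k p.2) J with hRdef
  have hR : ∀ k, J.map (fun p => (erase k p.2, ρ k p.1)) = (bern M).map (erase k) ⊗ₘ R k := by
    intro k
    have e : (bern M).map (erase k) = J.map fun p => erase k p.2 := by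
      rw [← h.map_snd, Measure.map_map (measurable_erase k) measurable_snd]; rfl
    rw [e]
    exact (compProd_map_condDistrib (Y := fun p : W × (∀ k, Fin (M k)) => ρ k p.1)
      ((h.meas k).comp measurable_fst).aemeasurable).symm
  have hgood : ∀ᵐ b ∂(bern M), ∀ k, (Q b).map (ρ k) = R k (erase k b) :=
    ae_all_iff.2 fun k => h.compProd_erase k Q hQ (R k) (hR k)
  have hΓm : MeasurableSet {q : (∀ k, Fin (M k)) × W | ∃ n, ∀ k, n ≤ k → q.1 k = enc k q.2} := by
    simp only [ofPred_exists, ofPred_forall]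
    exact MeasurableSet.iUnion fun n => MeasurableSet.iInter fun k => MeasurableSet.iInter fun _ =>
      measurableSet_eq_fun ((measurable_pi_apply k).comp measurable_fst)
        ((henc k).comp measurable_snd)
  refine Medial.transfer hF hFB hFc hmed (bern M) Q ?_ hΓm ?_ ?_ tail_equivalence
    {b | ∀ k, (Q b).map (ρ k) = R k (erase k b)} hgood ?_
  · rw [← hQ, Measure.snd, Measure.map_map measurable_snd measurable_swap]
    have : (P ⊗ₘ piKernel κ).fst = P := Measure.fst_compProd P _
    exact (Measure.absolutelyContinuous_of_eq this)
  · rw [← hQ]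
    refine (ae_map_iff measurable_swap.aemeasurable hΓm).2 ?_
    have hle : ∀ k, J {p | p.2 k ≠ enc k p.1} = ∫⁻ w, κ k w {a | a ≠ enc k w} ∂P := by
      intro k
      have hm : MeasurableSet {p : W × (∀ k, Fin (M k)) | p.2 k ≠ enc k p.1} :=
        (measurableSet_eq_fun ((measurable_pi_apply k).comp measurable_snd)
          ((henc k).comp measurable_fst)).compl
      rw [hJ, Measure.compProd_apply hm]
      refine lintegral_congr fun w => ?_
      rw [piKernel_apply, ← Measure.infinitePi_map_eval (fun k => κ k w) k,
        Measure.map_apply (measurable_pi_apply k) (Set.toFinite _).measurableSet]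
      rfl
    have := ae_eventually_notMem (μ := J) (s := fun k => {p | p.2 k ≠ enc k p.1})
      (by simp_rw [hle]; exact herr)
    filter_upwards [this] with p hp
    obtain ⟨n, hn⟩ := eventually_atTop.1 hp
    exact ⟨n, fun k hk => by simpa using hn k hk⟩
  · intro w
    refine (countable_tail fun k => enc k w).mono ?_
    rintro b ⟨n, hn⟩
    exact ⟨n, fun k hk => (hn k hk).symm⟩
  · rintro b hb b' hb' ⟨n, hn⟩ U hU hUinv
    have e : erase n b = erase n b' := by
      funext i
      simp only [erase]
      split_ifs with hi
      · rfl
      · exact hn i (not_lt.1 hi)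
    have hpre : ρ n ⁻¹' U = U := by
      ext w; exact (hUinv _ _ (hFρ n w)).symm
    have e1 := hb n
    have e2 := hb' n
    rw [← e, ← e1] at e2
    have e3 := congrArg (fun m => m U) e2
    rw [Measure.map_apply (h.meas n) hU, Measure.map_apply (h.meas n) hU, hpre] at e3
    exact e3.symm

end

theorem measurable_digits : Measurable fun u : unitInterval => Real.digits (u : ℝ) 2 := by
  refine measurable_pi_lambda _ fun i => ?_
  simp only [Real.digits]
  exact (measurable_of_countable (Fin.ofNat 2)).comp
    (Nat.measurable_floor.comp (measurable_subtype_coe.mul_const _))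

theorem digits_initial_iff (u : ℝ) (hu : u ∈ Ico (0 : ℝ) 1) (c : ℕ → Fin 2) (k : ℕ) :
    (∀ i < k, Real.digits u 2 i = c i) ↔
      ⌊u * 2 ^ k⌋₊ = Nat.rec 0 (fun i m => 2 * m + (c i : ℕ)) k := by
  induction k with
  | zero =>
    simp only [not_lt_zero, IsEmpty.forall_iff, implies_true, true_iff, pow_zero, mul_one]
    exact Nat.floor_eq_zero.2 hu.2
  | succ k ih =>
    rw [Nat.forall_lt_succ_right, ih]
    have h2 : ⌊u * 2 ^ (k + 1)⌋₊ / 2 = ⌊u * 2 ^ k⌋₊ := by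
      rw [← Nat.floor_div_ofNat, pow_succ, ← mul_assoc, mul_div_assoc]
      norm_num
    have h3 : (Real.digits u 2 k : ℕ) = ⌊u * 2 ^ (k + 1)⌋₊ % 2 := by
      simp [Real.digits, Fin.ofNat]
    rw [Fin.ext_iff, h3, ← h2]
    have := (c k).2
    simp only
    omega

theorem map_digits : (volume : Measure unitInterval).map (fun u : unitInterval => Real.digits (u : ℝ) 2) =
    bern fun _ => 2 := by
  refine ext_cyl 0 fun k _ c => ?_
  rw [Measure.map_apply measurable_digits (measurableSet_cyl _ _), bern_cyl]
  set m : ℕ := Nat.rec 0 (fun i m => 2 * m + (c i : ℕ)) k with hm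
  have hmlt : m + 1 ≤ 2 ^ k := by
    rw [hm]
    clear hm m
    induction k with
    | zero => simp
    | succ k ih =>
      have := (c k).2
      simp only [pow_succ]
      have ih := ih (by omega)
      omega
  have hmR : ((m : ℝ) + 1) ≤ 2 ^ k := by exact_mod_cast hmlt
  have hp : (0 : ℝ) < 2 ^ k := by positivity
  have ha : (m : ℝ) / 2 ^ k ∈ unitInterval :=
    ⟨by positivity, by rw [div_le_one hp]; linarith⟩
  have hb : ((m : ℝ) + 1) / 2 ^ k ∈ unitInterval := ⟨by positivity, by rwa [div_le_one hp]⟩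
  have hset : ((fun u : unitInterval => Real.digits (u : ℝ) 2) ⁻¹' cyl (Finset.range k) c :
      Set unitInterval) =ᵐ[volume] Ico ⟨_, ha⟩ ⟨_, hb⟩ := by
    have h1 : ∀ᵐ u : unitInterval, u ≠ 1 := by
      rw [ae_iff]; simp
    filter_upwards [h1] with u hu
    have hu1 : (u : ℝ) ∈ Ico (0 : ℝ) 1 :=
      ⟨u.2.1, lt_of_le_of_ne u.2.2 fun h => hu (Subtype.ext h)⟩
    refine propext ?_
    change (∀ i ∈ Finset.range k, Real.digits (u : ℝ) 2 i = c i) ↔ _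
    simp only [Finset.mem_range]
    rw [digits_initial_iff _ hu1 c k, ← hm,
      Nat.floor_eq_iff (mul_nonneg hu1.1 hp.le)]
    change _ ↔ ((m : ℝ) / 2 ^ k ≤ u ∧ (u : ℝ) < ((m : ℝ) + 1) / 2 ^ k)
    rw [div_le_iff₀ hp, lt_div_iff₀ hp]
  rw [measure_congr hset, unitInterval.volume_Ico]
  simp only [Finset.prod_const, Finset.card_range]
  rw [← sub_div, add_sub_cancel_left, one_div, ENNReal.ofReal_inv_of_pos hp,
    ENNReal.ofReal_pow (by norm_num), ← ENNReal.inv_pow]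
  simp

theorem exists_bern_map {Y : Type*} [MeasurableSpace Y] [StandardBorelSpace Y]
    (ρ : Measure Y) [IsProbabilityMeasure ρ] :
    ∃ φ : (ℕ → Fin 2) → Y, Measurable φ ∧ (bern fun _ => 2).map φ = ρ := by
  have : Nonempty Y := nonempty_of_isProbabilityMeasure ρ
  obtain ⟨f, hf, hfρ⟩ := Measure.exists_measurable_map_eq ρ
  have hψ : Measurable fun o : ℕ → Fin 2 => (⟨Real.ofDigits o, Real.ofDigits_nonneg o,
      Real.ofDigits_le_one o⟩ : unitInterval) :=
    Measurable.subtype_mk Real.continuous_ofDigits.measurable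
  refine ⟨_, hf.comp hψ, ?_⟩
  rw [← map_digits, Measure.map_map (hf.comp hψ) measurable_digits, ← hfρ]
  refine Measure.map_congr ?_
  have h1 : ∀ᵐ u : unitInterval, u ≠ 1 := by
    rw [ae_iff]; simp
  filter_upwards [h1] with u hu
  have hu1 : (u : ℝ) ∈ Ico (0 : ℝ) 1 :=
    ⟨u.2.1, lt_of_le_of_ne u.2.2 fun h => hu (Subtype.ext h)⟩
  simp only [Function.comp]
  congr 1
  exact Subtype.ext (Real.ofDigits_digits one_lt_two hu1)

/-- Interleave a digit sequence with a binary sequence. -/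
def pairDigits {M : ℕ → ℕ} (p : (∀ k, Fin (M k)) × (ℕ → Fin 2)) : ∀ k, Fin (M k * 2) :=
  fun k => finProdFinEquiv (p.1 k, p.2 k)

theorem measurable_pairDigits {M : ℕ → ℕ} : Measurable (pairDigits (M := M)) :=
  measurable_pi_lambda _ fun k => (measurable_of_finite (finProdFinEquiv)).comp
    (((measurable_pi_apply k).comp measurable_fst).prodMk
      ((measurable_pi_apply k).comp measurable_snd))

theorem map_pairDigits {M : ℕ → ℕ} [∀ k, NeZero (M k)] :
    ((bern M).prod (bern fun _ => 2)).map pairDigits = bern fun k => M k * 2 := by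
  refine ext_cyl 0 fun k _ c => ?_
  rw [Measure.map_apply measurable_pairDigits (measurableSet_cyl _ _), bern_cyl]
  have : pairDigits ⁻¹' cyl (Finset.range k) c =
      cyl (Finset.range k) (fun i => (finProdFinEquiv.symm (c i)).1) ×ˢ
        cyl (Finset.range k) (fun i => (finProdFinEquiv.symm (c i)).2) := by
    ext ⟨b, o⟩
    simp only [cyl, pairDigits, mem_preimage, mem_ofPred_eq, mem_prod, ← forall_and]
    refine forall_congr' fun i => ?_
    rw [← Equiv.eq_symm_apply, Prod.ext_iff]
  rw [this, Measure.prod_prod, bern_cyl, bern_cyl, ← Finset.prod_mul_distrib]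
  refine Finset.prod_congr rfl fun i _ => ?_
  rw [Nat.cast_mul, ENNReal.mul_inv (Or.inr (by simp)) (Or.inr (by simp))]

/-- Means for eventual equality of independent uniform digits absorb independent parameters. -/
theorem medial_bern_prod
    (hT : ∀ (M : ℕ → ℕ) [∀ k, NeZero (M k)], Medial (bern M) (Tail (A := fun k => Fin (M k))))
    (M : ℕ → ℕ) [∀ k, NeZero (M k)] {Y : Type*} [MeasurableSpace Y] [StandardBorelSpace Y]
    (ρ : Measure Y) [IsProbabilityMeasure ρ] :
    Medial ((bern M).prod ρ) (fun p q => Tail p.1 q.1 ∧ p.2 = q.2) := by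
  obtain ⟨φ, hφ, hφρ⟩ := exists_bern_map ρ
  set Q : Kernel Y (ℕ → Fin 2) := condDistrib id φ (bern fun _ => 2) with hQd
  have hQ : ρ ⊗ₘ Q = (bern fun _ => 2).map fun o => (φ o, o) := by
    rw [← hφρ]
    exact compProd_map_condDistrib (X := φ) (Y := id) measurable_id.aemeasurable
  set K : Kernel ((∀ k, Fin (M k)) × Y) (∀ k, Fin (M k * 2)) :=
    ((Kernel.id ∥ₖ Q).map pairDigits) with hKd
  have : IsMarkovKernel K := Kernel.IsMarkovKernel.map _ measurable_pairDigits
  have hK : ∀ b y, K (b, y) = (Q y).map fun o => pairDigits (b, o) := by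
    intro b y
    rw [hKd, Kernel.map_apply _ measurable_pairDigits, Kernel.parallelComp_apply, Kernel.id_apply,
      Measure.dirac_prod, Measure.map_map measurable_pairDigits (by fun_prop)]
    rfl
  have hmo : ∀ b : ∀ k, Fin (M k), Measurable fun o => pairDigits (b, o) := fun b =>
    measurable_pairDigits.comp measurable_prodMk_left
  -- the joint law
  have hjoint : ((bern M).prod ρ) ⊗ₘ K = ((bern M).prod (bern fun _ => 2)).map
      fun p => ((p.1, φ p.2), pairDigits p) := by
    have hmm : Measurable fun p : (∀ k, Fin (M k)) × (ℕ → Fin 2) =>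
        ((p.1, φ p.2), pairDigits p) :=
      (measurable_fst.prodMk (hφ.comp measurable_snd)).prodMk measurable_pairDigits
    refine Measure.ext_of_lintegral _ fun f hf => ?_
    rw [Measure.lintegral_compProd hf, lintegral_map hf hmm,
      lintegral_prod _ (Measurable.lintegral_kernel_prod_right' (κ := K) hf).aemeasurable,
      lintegral_prod (fun p => f ((p.1, φ p.2), pairDigits p)) (hf.comp hmm).aemeasurable]
    · refine lintegral_congr fun b => ?_
      have e := congrArg (fun m => ∫⁻ q, f ((b, q.1), pairDigits (b, q.2)) ∂m) hQ
      have hfm : Measurable fun q : Y × (ℕ → Fin 2) => f ((b, q.1), pairDigits (b, q.2)) :=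
        hf.comp ((measurable_const.prodMk measurable_fst).prodMk ((hmo b).comp measurable_snd))
      rw [Measure.lintegral_compProd hfm, lintegral_map (g := fun o => (φ o, o)) hfm (hφ.prodMk measurable_id)] at e
      rw [← e]
      refine lintegral_congr fun y => ?_
      rw [hK, lintegral_map (f := fun z => f ((b, y), z)) (hf.comp measurable_prodMk_left) (hmo b)]
  have hR : Equivalence fun p q : (∀ k, Fin (M k)) × Y => Tail p.1 q.1 ∧ p.2 = q.2 :=
    ⟨fun p => ⟨tail_equivalence.refl _, rfl⟩, fun h => ⟨tail_equivalence.symm h.1, h.2.symm⟩,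
      fun h h' => ⟨tail_equivalence.trans h.1 h'.1, h.2.trans h'.2⟩⟩
  have hm1 : Measurable fun z : ∀ k, Fin (M k * 2) => fun k => (finProdFinEquiv.symm (z k)).1 :=
    measurable_pi_lambda _ fun k => (measurable_of_finite
      fun a => (finProdFinEquiv.symm a).1).comp (measurable_pi_apply k)
  have hm2 : Measurable fun z : ∀ k, Fin (M k * 2) => fun k => (finProdFinEquiv.symm (z k)).2 :=
    measurable_pi_lambda _ fun k => (measurable_of_finite
      fun a => (finProdFinEquiv.symm a).2).comp (measurable_pi_apply k)
  have hΓ : MeasurableSet {p : ((∀ k, Fin (M k)) × Y) × (∀ k, Fin (M k * 2)) |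
      p.1 = ((fun k => (finProdFinEquiv.symm (p.2 k)).1),
        φ fun k => (finProdFinEquiv.symm (p.2 k)).2)} :=
    measurableSet_eq_fun measurable_fst
      ((hm1.comp measurable_snd).prodMk (hφ.comp (hm2.comp measurable_snd)))
  refine Medial.transfer tail_equivalence measurableSet_tail countable_tail
    (hT fun k => M k * 2) _ K ?_ hΓ ?_ ?_ hR univ (by simp) ?_
  · rw [hjoint, Measure.snd, Measure.map_map measurable_snd (by
      exact (measurable_fst.prodMk (hφ.comp measurable_snd)).prodMk measurable_pairDigits)]
    exact Measure.absolutelyContinuous_of_eq map_pairDigits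
  · rw [hjoint]
    refine (ae_map_iff ((measurable_fst.prodMk
        (hφ.comp measurable_snd)).prodMk measurable_pairDigits).aemeasurable hΓ).2 ?_
    refine ae_of_all _ fun p => ?_
    simp [pairDigits]
  · intro z
    refine (countable_singleton ((fun k => (finProdFinEquiv.symm (z k)).1),
        φ fun k => (finProdFinEquiv.symm (z k)).2)).mono ?_
    intro p hp
    exact hp
  · rintro ⟨b, y⟩ - ⟨b', y'⟩ - ⟨⟨n, hn⟩, hy⟩ U hU hUinv
    obtain rfl : y = y' := hy
    rw [hK, hK, Measure.map_apply (hmo b) hU, Measure.map_apply (hmo b') hU]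
    congr 1
    ext o
    exact hUinv _ _ ⟨n, fun k hk => by
      have := hn k hk
      simp only at this
      simp only [pairDigits, this]⟩

/-- `h ∘ v` is a version of the conditional probability of `A` given `v`. -/
structure IsCond {W V : Type*} [MeasurableSpace W] [MeasurableSpace V] (P : Measure W) (v : W → V)
    (A : Set W) (h : V → ℝ) : Prop where
  meas : Measurable h
  nonneg : ∀ x, 0 ≤ h x
  le_one : ∀ x, h x ≤ 1
  eq : ∀ u : V → ℝ≥0∞, Measurable u →
    ∫⁻ w in A, u (v w) ∂P = ∫⁻ w, ENNReal.ofReal (h (v w)) * u (v w) ∂P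

theorem IsCond.integral_mul {W V : Type*} [MeasurableSpace W] [MeasurableSpace V] {P : Measure W}
    {v : W → V} (hv : Measurable v) {A : Set W} {h : V → ℝ} (H : IsCond P v A h) {u : V → ℝ}
    (hu : Measurable u) (hu0 : ∀ x, 0 ≤ u x) :
    ∫ w, h (v w) * u (v w) ∂P = ∫ w in A, u (v w) ∂P := by
  rw [integral_eq_lintegral_of_nonneg_ae (ae_of_all _ fun w => mul_nonneg (H.nonneg _) (hu0 _))
      ((H.meas.comp hv).mul (hu.comp hv)).aestronglyMeasurable,
    integral_eq_lintegral_of_nonneg_ae (ae_of_all _ fun w => hu0 _)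
      (hu.comp hv).aestronglyMeasurable, H.eq (fun x => ENNReal.ofReal (u x)) hu.ennreal_ofReal]
  simp_rw [ENNReal.ofReal_mul (H.nonneg _)]

theorem exists_isCond {W V : Type*} [MeasurableSpace W] [MeasurableSpace V] (P : Measure W)
    [IsProbabilityMeasure P] {v : W → V} (hv : Measurable v) {A : Set W} (hA : MeasurableSet A) :
    ∃ h, IsCond P v A h := by
  classical
  have hl : Measurable fun w => if w ∈ A then (0 : ℕ) else 1 :=
    Measurable.ite hA measurable_const measurable_const
  obtain ⟨F, h1, h2, h3, h4, h5⟩ := exists_cdf P hv hl (L := 2)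
    (fun w => by split_ifs <;> norm_num)
  refine ⟨fun x => F x 1, h1 1, fun x => h3 x ▸ h2 x (Nat.zero_le 1),
    fun x => h4 x ▸ h2 x (Nat.le_succ 1), fun u hu => ?_⟩
  have := h5 (fun x e => if e = 0 then u x else 0) fun e => by
    split_ifs
    · exact hu
    · exact measurable_const
  simp only [Finset.sum_range_succ, Finset.sum_range_zero, h3] at this
  simp only [zero_add, ↓reduceIte, sub_zero, one_ne_zero, mul_zero, add_zero] at this
  rw [← this, ← lintegral_indicator hA]
  refine lintegral_congr fun w => ?_
  by_cases hw : w ∈ A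
  · rw [indicator_of_mem hw]; simp [hw]
  · rw [indicator_of_notMem hw]; simp [hw]

/-- Conditional probabilities given a coarser map: Pythagoras. -/
theorem IsCond.integral_sub_sq {W : Type*} [MeasurableSpace W] {P : Measure W}
    [IsProbabilityMeasure P] {v v' : W → W} (hv : Measurable v) (hv' : Measurable v')
    (hvv : ∀ w, v' (v w) = v' w) {A : Set W} {h h' : W → ℝ} (H : IsCond P v A h)
    (H' : IsCond P v' A h') :
    ∫ w, (h (v w) - h' (v' w)) ^ 2 ∂P = ∫ w, h (v w) ^ 2 ∂P - ∫ w, h' (v' w) ^ 2 ∂P := by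
  have m1 : Measurable fun w => h (v w) := H.meas.comp hv
  have m2 : Measurable fun w => h' (v' w) := H'.meas.comp hv'
  have b1 : ∀ w, ‖h (v w)‖ ≤ 1 := fun w => by
    rw [Real.norm_eq_abs, abs_le]; constructor <;> linarith [H.nonneg (v w), H.le_one (v w)]
  have b2 : ∀ w, ‖h' (v' w)‖ ≤ 1 := fun w => by
    rw [Real.norm_eq_abs, abs_le]; constructor <;> linarith [H'.nonneg (v' w), H'.le_one (v' w)]
  have int : ∀ {p q : W → ℝ}, Measurable p → Measurable q → (∀ w, ‖p w‖ ≤ 1) → (∀ w, ‖q w‖ ≤ 1) →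
      Integrable (fun w => p w * q w) P := fun hp hq hp1 hq1 =>
    Integrable.of_bound (hp.mul hq).aestronglyMeasurable 1 (ae_of_all _ fun w => by
      rw [norm_mul]; exact mul_le_one₀ (hp1 w) (norm_nonneg _) (hq1 w))
  have c1 : ∫ w, h (v w) * h' (v' w) ∂P = ∫ w in A, h' (v' w) ∂P := by
    have := H.integral_mul hv (u := fun x => h' (v' x)) (H'.meas.comp hv') fun x => H'.nonneg _
    simpa only [hvv] using this
  have c2 : ∫ w, h' (v' w) * h' (v' w) ∂P = ∫ w in A, h' (v' w) ∂P :=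
    H'.integral_mul hv' H'.meas H'.nonneg
  have e : ∀ w, (h (v w) - h' (v' w)) ^ 2 = h (v w) * h (v w) -
      2 * (h (v w) * h' (v' w)) + h' (v' w) * h' (v' w) := fun w => by ring
  simp_rw [e]
  have i12 : Integrable (fun w => h (v w) * h (v w) - 2 * (h (v w) * h' (v' w))) P :=
    (int m1 m1 b1 b1).sub ((int m1 m2 b1 b2).const_mul 2)
  rw [integral_add i12 (int m2 m2 b2 b2),
    integral_sub (int m1 m1 b1 b1) ((int m1 m2 b1 b2).const_mul 2), integral_const_mul, c1, ← c2]
  simp_rw [sq]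
  ring

theorem sq_integral_abs_le {W : Type*} [MeasurableSpace W] {P : Measure W}
    [IsProbabilityMeasure P] {f : W → ℝ} (hf : Measurable f) {C : ℝ} (hC : ∀ w, |f w| ≤ C) :
    (∫ w, |f w| ∂P) ^ 2 ≤ ∫ w, f w ^ 2 ∂P := by
  have i1 : Integrable (fun w => |f w|) P :=
    Integrable.of_bound hf.abs.aestronglyMeasurable C (ae_of_all _ fun w => by simpa using hC w)
  have i2 : Integrable (fun w => f w ^ 2) P :=
    Integrable.of_bound (hf.pow_const 2).aestronglyMeasurable (C ^ 2) (ae_of_all _ fun w => by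
      rw [Real.norm_eq_abs, abs_pow]; exact pow_le_pow_left₀ (abs_nonneg _) (hC w) 2)
  set a := ∫ w, |f w| ∂P with ha
  have h : 0 ≤ ∫ w, (|f w| - a) ^ 2 ∂P := integral_nonneg fun w => sq_nonneg _
  have e : ∀ w, (|f w| - a) ^ 2 = f w ^ 2 - (2 * a) * |f w| + a ^ 2 := fun w => by
    rw [sub_sq, sq_abs]; ring
  simp_rw [e] at h
  have i12 : Integrable (fun w => f w ^ 2 - (2 * a) * |f w|) P := i2.sub (i1.const_mul _)
  rw [integral_add i12 (integrable_const _),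
    integral_sub i2 (i1.const_mul _), integral_const_mul, ← ha] at h
  simp at h
  nlinarith

/-- Conditional probabilities along a decreasing sequence of σ-algebras converge in mean to an
exactly invariant function. -/
theorem exists_tail_limit {W : Type*} [MeasurableSpace W] (P : Measure W)
    [IsProbabilityMeasure P] {r : ℕ → W → W} (hr : ∀ n, Measurable (r n))
    (hrr : ∀ i j, i ≤ j → ∀ w, r j (r i w) = r j w) {A : Set W} (hA : MeasurableSet A) :
    ∃ g : W → ℝ, Measurable g ∧ (∀ n w w', r n w = r n w' → g w = g w') ∧
      ∀ ε : ℝ, 0 < ε → ∃ n₀, ∀ j ≥ n₀, ∀ h, IsCond P (r j) A h →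
        ∫⁻ w, ENNReal.ofReal |h (r j w) - g w| ∂P ≤ ENNReal.ofReal ε := by
  choose h H using fun j => exists_isCond P (hr j) hA
  set q : ℕ → ℝ := fun j => ∫ w, h j (r j w) ^ 2 ∂P with hq
  have hm : ∀ j, Measurable fun w => h j (r j w) := fun j => (H j).meas.comp (hr j)
  have hdiff : ∀ i j, i ≤ j → ∀ k, IsCond P (r j) A k →
      ∫ w, (h i (r i w) - k (r j w)) ^ 2 ∂P = q i - ∫ w, k (r j w) ^ 2 ∂P := fun i j hij k hk =>
    (H i).integral_sub_sq (hr i) (hr j) (hrr i j hij) hk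
  have hver : ∀ j k, IsCond P (r j) A k → ∫ w, k (r j w) ^ 2 ∂P = q j := by
    intro j k hk
    have h1 := hdiff j j le_rfl k hk
    have h2 := hk.integral_sub_sq (hr j) (hr j) (hrr j j le_rfl) (H j)
    have h3 : 0 ≤ ∫ w, (h j (r j w) - k (r j w)) ^ 2 ∂P := integral_nonneg fun w => sq_nonneg _
    have h4 : 0 ≤ ∫ w, (k (r j w) - h j (r j w)) ^ 2 ∂P := integral_nonneg fun w => sq_nonneg _
    simp only [hq] at *
    linarith
  have hqanti : Antitone q := by
    intro i j hij
    have h1 := hdiff i j hij _ (H j)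
    have h3 : 0 ≤ ∫ w, (h i (r i w) - h j (r j w)) ^ 2 ∂P := integral_nonneg fun w => sq_nonneg _
    simp only [hq] at *
    linarith
  have hq0 : ∀ j, 0 ≤ q j := fun j => integral_nonneg fun w => sq_nonneg _
  have hqlim : Tendsto q atTop (𝓝 (⨅ j, q j)) :=
    tendsto_atTop_ciInf hqanti ⟨0, by rintro _ ⟨j, rfl⟩; exact hq0 j⟩
  have hqinf : ∀ j, ⨅ j, q j ≤ q j := fun j => ciInf_le ⟨0, by rintro _ ⟨j, rfl⟩; exact hq0 j⟩ j
  -- mean distance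
  have hL1 : ∀ i j, i ≤ j → ∀ k, IsCond P (r j) A k → ∀ δ : ℝ, 0 ≤ δ → q i - (⨅ j, q j) ≤ δ ^ 2 →
      ∫ w, |h i (r i w) - k (r j w)| ∂P ≤ δ := by
    intro i j hij k hk δ hδ hi
    have h1 := hdiff i j hij k hk
    rw [hver j k hk] at h1
    have h2 := sq_integral_abs_le (P := P) (f := fun w => h i (r i w) - k (r j w)) (C := 1)
      ((hm i).sub (hk.meas.comp (hr j))) fun w => by
        rw [abs_le]
        constructor <;> linarith [(H i).nonneg (r i w), (H i).le_one (r i w), hk.nonneg (r j w),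
          hk.le_one (r j w)]
    refine le_of_sq_le_sq (h2.trans ?_) hδ
    linarith [hqinf j]
  have hN : ∀ i : ℕ, ∃ N, q N - (⨅ j, q j) ≤ ((1 / 2 : ℝ) ^ i) ^ 2 := by
    intro i
    have : ∀ᶠ j in atTop, q j < (⨅ j, q j) + ((1 / 2 : ℝ) ^ i) ^ 2 :=
      hqlim.eventually (gt_mem_nhds (by linarith [show (0 : ℝ) < ((1 / 2 : ℝ) ^ i) ^ 2 by positivity]))
    obtain ⟨N, hN⟩ := this.exists
    exact ⟨N, by linarith⟩
  choose N0 hN0 using hN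
  set N : ℕ → ℕ := fun i => ∑ k ∈ Finset.range (i + 1), (N0 k + 1) with hNdef
  have hNmono : Monotone N := fun i j hij =>
    Finset.sum_le_sum_of_subset (Finset.range_mono (by omega))
  have hN : ∀ i, q (N i) - (⨅ j, q j) ≤ ((1 / 2 : ℝ) ^ i) ^ 2 := fun i => by
    have : N0 i + 1 ≤ N i := Finset.single_le_sum (f := fun k => N0 k + 1)
      (fun _ _ => Nat.zero_le _) (Finset.mem_range.2 (Nat.lt_succ_self i))
    have : N0 i ≤ N i := by omega
    linarith [hN0 i, hqanti this]
  have hNge : ∀ i, i ≤ N i := fun i => by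
    have : ∑ k ∈ Finset.range (i + 1), 1 ≤ N i :=
      Finset.sum_le_sum fun k _ => Nat.le_add_left 1 (N0 k)
    simp at this
    omega
  set f : ℕ → W → ℝ := fun i w => h (N i) (r (N i) w) with hf
  have hfm : ∀ i, Measurable (f i) := fun i => hm (N i)
  have hf0 : ∀ i w, 0 ≤ f i w := fun i w => (H _).nonneg _
  have hf1 : ∀ i w, f i w ≤ 1 := fun i w => (H _).le_one _
  have hfb : ∀ i w, ‖f i w‖ ≤ 1 := fun i w => by
    rw [Real.norm_eq_abs, abs_le]; constructor <;> linarith [hf0 i w, hf1 i w]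
  have hfint : ∀ i, Integrable (f i) P := fun i =>
    Integrable.of_bound (hfm i).aestronglyMeasurable 1 (ae_of_all _ (hfb i))
  have hd : ∀ i j, i ≤ j → ∫ w, |f i w - f j w| ∂P ≤ (1 / 2) ^ i := fun i j hij =>
    hL1 _ _ (hNmono hij) _ (H _) _ (by positivity) (hN i)
  have hd2 : ∀ n i j, n ≤ i → n ≤ j → ∫ w, |f i w - f j w| ∂P ≤ 2 * (1 / 2) ^ n := by
    intro n i j hi hj
    rcases le_total i j with hij | hij
    · refine (hd i j hij).trans ?_
      have := pow_le_pow_of_le_one (by norm_num : (0 : ℝ) ≤ 1 / 2) (by norm_num) hi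
      have : (0 : ℝ) < (1 / 2) ^ n := by positivity
      linarith
    · simp_rw [abs_sub_comm (f i _)]
      refine (hd j i hij).trans ?_
      have := pow_le_pow_of_le_one (by norm_num : (0 : ℝ) ≤ 1 / 2) (by norm_num) hj
      have : (0 : ℝ) < (1 / 2) ^ n := by positivity
      linarith
  have hconv : ∀ᵐ w ∂P, ∃ l, Tendsto (fun i => f i w) atTop (𝓝 l) := by
    refine Lp.ae_tendsto_of_cauchy_eLpNorm (p := 1) (fun n => (hfm n).aestronglyMeasurable) le_rfl
      (B := fun n => ENNReal.ofReal (3 * (1 / 2) ^ n)) ?_ ?_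
    · rw [← ENNReal.ofReal_tsum_of_nonneg (fun n => by positivity)]
      · exact ENNReal.ofReal_ne_top
      · exact (summable_geometric_of_lt_one (by norm_num) (by norm_num)).mul_left 3
    · intro n i j hi hj
      rw [eLpNorm_one_eq_lintegral_enorm]
      have e : ∀ w, ‖(f i - f j) w‖ₑ = ENNReal.ofReal |f i w - f j w| := fun w => by
        rw [← ofReal_norm, Real.norm_eq_abs, Pi.sub_apply]
      simp_rw [e]
      have iab : Integrable (fun w => |f i w - f j w|) P := ((hfint i).sub (hfint j)).abs
      rw [← ofReal_integral_eq_lintegral_ofReal iab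
        (ae_of_all _ fun w => abs_nonneg _)]
      have : (0 : ℝ) < (1 / 2) ^ n := by positivity
      refine (ENNReal.ofReal_lt_ofReal_iff (by positivity)).2 ((hd2 n i j hi hj).trans_lt ?_)
      linarith
  set g : W → ℝ := fun w => max 0 (min 1 (limsup (fun i => f i w) atTop)) with hg
  have hgm : Measurable g := measurable_const.max (measurable_const.min (Measurable.limsup hfm))
  have hgb : ∀ w, ‖g w‖ ≤ 1 := fun w => by
    rw [Real.norm_eq_abs, abs_of_nonneg (le_max_left _ _)]
    exact max_le zero_le_one (min_le_left _ _)
  have hgint : Integrable g P :=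
    Integrable.of_bound hgm.aestronglyMeasurable 1 (ae_of_all _ hgb)
  have hglim : ∀ᵐ w ∂P, Tendsto (fun i => f i w) atTop (𝓝 (g w)) := by
    filter_upwards [hconv] with w ⟨l, hl⟩
    have h0 : 0 ≤ l := ge_of_tendsto' hl fun i => hf0 i w
    have h1 : l ≤ 1 := le_of_tendsto' hl fun i => hf1 i w
    rw [hg]
    simp only [hl.limsup_eq, min_eq_right h1, max_eq_right h0]
    exact hl
  refine ⟨g, hgm, fun n w w' hw => ?_, fun ε hε => ?_⟩
  · have : ∀ᶠ i in atTop, f i w = f i w' := by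
      filter_upwards [eventually_ge_atTop n] with i hi
      simp only [hf]
      rw [← hrr n (N i) (hi.trans (hNge i)) w, hw, hrr n (N i) (hi.trans (hNge i)) w']
    simp only [hg, limsup_congr this]
  · have hlim : Tendsto (fun i => ∫ w, |f i w - g w| ∂P) atTop (𝓝 0) := by
      have := tendsto_integral_of_dominated_convergence (μ := P) (F := fun i w => |f i w - g w|)
        (f := fun _ => (0 : ℝ)) (fun _ => 2)
        (fun i => ((hfm i).sub hgm).abs.aestronglyMeasurable) (integrable_const _)
        (fun i => ae_of_all _ fun w => by
          rw [Real.norm_eq_abs, abs_abs]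
          have := norm_sub_le (f i w) (g w)
          rw [Real.norm_eq_abs] at this
          linarith [hfb i w, hgb w])
        (by
          filter_upwards [hglim] with w hw
          have := (hw.sub_const (g w)).abs
          simpa using this)
      simpa using this
    obtain ⟨i, hi1, hi2⟩ := ((hlim.eventually (gt_mem_nhds (half_pos hε))).and
      ((tendsto_pow_atTop_nhds_zero_of_lt_one (r := (1 / 2 : ℝ)) (by norm_num)
        (by norm_num)).eventually (gt_mem_nhds (half_pos hε)))).exists
    refine ⟨N i, fun j hj k hk => ?_⟩
    have hkm : Measurable fun w => k (r j w) := hk.meas.comp (hr j)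
    have hkint : Integrable (fun w => k (r j w)) P :=
      Integrable.of_bound hkm.aestronglyMeasurable 1 (ae_of_all _ fun w => by
        rw [Real.norm_eq_abs, abs_le]
        constructor <;> linarith [hk.nonneg (r j w), hk.le_one (r j w)])
    have i1 : Integrable (fun w => |k (r j w) - g w|) P := (hkint.sub hgint).abs
    have i2 : Integrable (fun w => |f i w - k (r j w)|) P := ((hfint i).sub hkint).abs
    have i3 : Integrable (fun w => |f i w - g w|) P := ((hfint i).sub hgint).abs
    rw [← ofReal_integral_eq_lintegral_ofReal i1 (ae_of_all _ fun w => abs_nonneg _)]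
    refine ENNReal.ofReal_le_ofReal ?_
    have h1 := hL1 (N i) j hj k hk _ (by positivity) (hN i)
    have h2 : ∫ w, |k (r j w) - g w| ∂P ≤ ∫ w, (|f i w - k (r j w)| + |f i w - g w|) ∂P := by
      refine integral_mono i1 (i2.add i3) fun w => ?_
      rw [abs_sub_comm (f i w)]
      exact abs_sub_le _ _ _
    rw [integral_add i2 i3] at h2
    linarith

theorem cut_congr {y y' : ℕ → ℝ} {M : ℕ} {u : ℝ} (h : ∀ j < M, (y j ≤ u ↔ y' j ≤ u))
    (hM : 0 < M) (h0 : y 0 ≤ u) : cut y M u = cut y' M u := by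
  have h0' : y' 0 ≤ u := (h 0 hM).1 h0
  refine le_antisymm ?_ ?_
  · by_contra hcon
    have h1 := lt_of_cut_lt (cut_lt y hM u) (not_le.1 hcon)
    exact absurd ((h _ (cut_lt y hM u)).1 (cut_spec h0)) (not_le.2 h1)
  · by_contra hcon
    have h1 := lt_of_cut_lt (cut_lt y' hM u) (not_le.1 hcon)
    exact absurd ((h _ (cut_lt y' hM u)).2 (cut_spec h0')) (not_le.2 h1)

theorem cut_eq {y : ℕ → ℝ} {M : ℕ} {u : ℝ} {c : ℕ} (hy : Monotone y) (hc : c < M) (h1 : y c ≤ u)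
    (h2 : c + 1 < M → u < y (c + 1)) : cut y M u = c := by
  have hle : c ≤ cut y M u := by
    by_contra hcon
    exact absurd (lt_of_cut_lt hc (not_le.1 hcon)) (not_lt.2 h1)
  refine le_antisymm ?_ hle
  by_contra hcon
  have hlt := cut_lt y (lt_of_le_of_lt (Nat.zero_le _) hc) u
  have h3 : y (cut y M u) ≤ u := cut_spec ((hy (Nat.zero_le c)).trans h1)
  have h4 : y (c + 1) ≤ u := (hy (by omega)).trans h3
  exact absurd (h2 (by omega)) (not_lt.2 h4)

theorem cut_block {F : ℕ → ℝ} (hF : Monotone F) {L B : ℕ} (hB : 0 < B) {u : ℝ}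
    (h0 : F 0 ≤ u) : cut F (L * B) u / B = cut (fun s => F (s * B)) L u := by
  rcases Nat.eq_zero_or_pos L with rfl | hL
  · simp [cut]
  symm
  have hlt := cut_lt F (Nat.mul_pos hL hB) u
  refine cut_eq (fun i j h => hF (Nat.mul_le_mul_right B h)) ((Nat.div_lt_iff_lt_mul hB).2 hlt)
    ((hF (Nat.div_mul_le_self _ _)).trans (cut_spec h0)) fun h => ?_
  refine lt_of_cut_lt ((Nat.mul_lt_mul_right hB).2 h) ?_
  rw [← Nat.div_lt_iff_lt_mul hB]
  exact Nat.lt_succ_self _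

theorem card_between_le {M : ℕ} (hM : 0 < M) {y g : ℝ} (hy : 0 ≤ y) (hyg : y ≤ g) :
    (((Finset.range M).filter fun a => y ≤ unifPart M a ∧ unifPart M a < g).card : ℝ) ≤
      M * (g - y) + 1 := by
  have hM' : (0 : ℝ) < M := by exact_mod_cast hM
  have hsub : ((Finset.range M).filter fun a => y ≤ unifPart M a ∧ unifPart M a < g) ⊆
      Finset.Ico ⌈M * y⌉₊ ⌈M * g⌉₊ := by
    intro a ha
    obtain ⟨-, h1, h2⟩ := Finset.mem_filter.1 ha
    simp only [unifPart] at h1 h2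
    rw [le_div_iff₀ hM'] at h1
    rw [div_lt_iff₀ hM'] at h2
    exact Finset.mem_Ico.2 ⟨Nat.ceil_le.2 (by linarith), Nat.lt_ceil.2 (by linarith)⟩
  have h1 := Finset.card_le_card hsub
  rw [Nat.card_Ico] at h1
  have h2 : ⌈(M : ℝ) * y⌉₊ ≤ ⌈(M : ℝ) * g⌉₊ := Nat.ceil_le_ceil (by gcongr)
  have h3 : (((Finset.range M).filter fun a => y ≤ unifPart M a ∧ unifPart M a < g).card : ℝ) ≤
      (⌈(M : ℝ) * g⌉₊ : ℝ) - ⌈(M : ℝ) * y⌉₊ := by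
    rw [← Nat.cast_sub h2]; exact_mod_cast h1
  have h4 := Nat.ceil_lt_add_one (show 0 ≤ (M : ℝ) * g from mul_nonneg hM'.le (hy.trans hyg))
  have h5 := Nat.le_ceil ((M : ℝ) * y)
  linarith

theorem card_separated_le {M : ℕ} (hM : 0 < M) {y g : ℝ} (hy : 0 ≤ y) (hg : 0 ≤ g) :
    (((Finset.range M).filter fun a => ¬ (y ≤ unifPart M a ↔ g ≤ unifPart M a)).card : ℝ) ≤
      M * |y - g| + 1 := by
  rcases le_total y g with h | h
  · have := card_between_le hM hy h
    rw [abs_sub_comm, abs_of_nonneg (sub_nonneg.2 h)]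
    refine le_trans ?_ this
    exact_mod_cast Finset.card_le_card fun a ha => by
      obtain ⟨h1, h2⟩ := Finset.mem_filter.1 ha
      refine Finset.mem_filter.2 ⟨h1, ?_⟩
      by_contra hcon
      refine h2 ⟨fun h3 => ?_, fun h3 => h.trans h3⟩
      by_contra h4
      exact hcon ⟨h3, not_le.1 h4⟩
  · have := card_between_le hM hg h
    rw [abs_of_nonneg (sub_nonneg.2 h)]
    refine le_trans ?_ this
    exact_mod_cast Finset.card_le_card fun a ha => by
      obtain ⟨h1, h2⟩ := Finset.mem_filter.1 ha
      refine Finset.mem_filter.2 ⟨h1, ?_⟩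
      by_contra hcon
      refine h2 ⟨fun h3 => h.trans h3, fun h3 => ?_⟩
      by_contra h4
      exact hcon ⟨h3, not_le.1 h4⟩

theorem exists_measure_gt_le {W : Type*} [MeasurableSpace W] (P : Measure W) [IsFiniteMeasure P]
    {f : W → ℕ} (hf : Measurable f) {ε : ℝ} (hε : 0 < ε) :
    ∃ L, P {w | L < f w} ≤ ENNReal.ofReal ε := by
  have h := tendsto_measure_iInter_atTop (μ := P) (s := fun L : ℕ => {w | L < f w})
    (fun L => (measurableSet_lt measurable_const hf).nullMeasurableSet)
    (fun i j hij w hw => lt_of_le_of_lt hij hw) ⟨0, measure_ne_top _ _⟩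
  have e : ⋂ L : ℕ, {w | L < f w} = ∅ := by
    ext w; simp only [mem_iInter, mem_ofPred_eq, mem_empty_iff_false, iff_false]
    intro h; exact lt_irrefl _ (h (f w))
  rw [e, measure_empty] at h
  obtain ⟨L, hL⟩ := (h.eventually (gt_mem_nhds (ENNReal.ofReal_pos.2 hε))).exists
  exact ⟨L, hL.le⟩

theorem isCond_of_cdf {W V : Type*} [MeasurableSpace W] [MeasurableSpace V] {P : Measure W}
    {v : W → V} {l : W → ℕ} (hl : Measurable l) {L : ℕ} {F : V → ℕ → ℝ}
    (hFm : ∀ e, Measurable fun x => F x e) (hF : ∀ x, Monotone (F x)) (hF0 : ∀ x, F x 0 = 0)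
    (hFL : ∀ x, F x L = 1)
    (hFΨ : ∀ Ψ : V → ℕ → ℝ≥0∞, (∀ e, Measurable fun x => Ψ x e) →
        ∫⁻ w, Ψ (v w) (l w) ∂P = ∫⁻ w, ∑ e ∈ Finset.range L,
          ENNReal.ofReal (F (v w) (e + 1) - F (v w) e) * Ψ (v w) e ∂P) {c : ℕ} (hc : c ≤ L) :
    IsCond P v {w | l w < c} fun x => F x c := by
  classical
  refine ⟨hFm c, fun x => hF0 x ▸ hF x (Nat.zero_le c), fun x => hFL x ▸ hF x hc, fun u hu => ?_⟩
  have h := hFΨ (fun x e => if e < c then u x else 0) fun e => by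
    split_ifs
    · exact hu
    · exact measurable_const
  have hset : MeasurableSet {w | l w < c} := measurableSet_lt hl measurable_const
  rw [← lintegral_indicator hset]
  refine Eq.trans (lintegral_congr fun w => ?_) (h.trans (lintegral_congr fun w => ?_))
  · by_cases hw : l w < c
    · rw [indicator_of_mem (by exact hw), if_pos hw]
    · rw [indicator_of_notMem (by exact hw), if_neg hw]
  · have e1 : Finset.range c ⊆ Finset.range L := Finset.range_mono hc
    rw [← Finset.sum_subset e1 (fun e _ he => by
      rw [if_neg (by simpa using he), mul_zero])]
    rw [Finset.sum_congr rfl (fun e he => by rw [if_pos (Finset.mem_range.1 he)]),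
      ← Finset.sum_mul, ← ENNReal.ofReal_sum_of_nonneg
      (fun e _ => sub_nonneg.2 (hF _ (Nat.le_succ e))), Finset.sum_range_sub, hF0, sub_zero]

/-- Digits separating two conditional probabilities are rare. -/
theorem lintegral_digit_separated_le {W : Type*} [MeasurableSpace W] {P : Measure W}
    [IsProbabilityMeasure P] {v : W → W} (hv : Measurable v) {M : ℕ} (hM : 0 < M)
    {κ : Kernel W (Fin M)}
    (hunif : ∀ (a : Fin M) (g : W → ℝ≥0∞), Measurable g →
      ∫⁻ w, κ w {a} * g (v w) ∂P = (M : ℝ≥0∞)⁻¹ * ∫⁻ w, g (v w) ∂P)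
    {y g : W → ℝ} (hy : Measurable y) (hg : Measurable g) (hy0 : ∀ x, 0 ≤ y x)
    (hg0 : ∀ x, 0 ≤ g x) (hgv : ∀ w, g (v w) = g w) {ε : ℝ}
    (hε : ∫⁻ w, ENNReal.ofReal |y (v w) - g w| ∂P ≤ ENNReal.ofReal ε) (hε0 : 0 ≤ ε) :
    ∫⁻ w, κ w {a | ¬ (y (v w) ≤ unifPart M a ↔ g w ≤ unifPart M a)} ∂P ≤
      ENNReal.ofReal (ε + 1 / M) := by
  classical
  have hM' : (0 : ℝ) < M := by exact_mod_cast hM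
  set b : Fin M → W → ℝ≥0∞ := fun a x =>
    if ¬ (y x ≤ unifPart M a ↔ g x ≤ unifPart M a) then 1 else 0 with hb
  have hbm : ∀ a, Measurable (b a) := fun a => by
    refine Measurable.ite (MeasurableSet.compl ?_) measurable_const measurable_const
    have h1 : MeasurableSet {x | y x ≤ unifPart M a} := measurableSet_le hy measurable_const
    have h2 : MeasurableSet {x | g x ≤ unifPart M a} := measurableSet_le hg measurable_const
    exact h1.iff h2
  have h1 : ∀ w, κ w {a | ¬ (y (v w) ≤ unifPart M a ↔ g w ≤ unifPart M a)} =
      ∑ a : Fin M, κ w {a} * b a (v w) := fun w => by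
    rw [finMeasure_apply]
    refine Finset.sum_congr rfl fun a _ => ?_
    simp only [hb, hgv]
    by_cases h : y (v w) ≤ unifPart M a ↔ g w ≤ unifPart M a <;> simp [h]
  simp_rw [h1]
  have hm1 : ∀ a, Measurable fun w => b a (v w) := fun a => (hbm a).comp hv
  have hm2 : ∀ a, Measurable fun w => κ w {a} * b a (v w) := fun a =>
    (Kernel.measurable_coe κ (measurableSet_singleton a)).mul (hm1 a)
  rw [lintegral_finsetSum _ fun a _ => hm2 a]
  simp_rw [hunif _ _ (hbm _)]
  rw [← Finset.mul_sum, ← lintegral_finsetSum _ fun a _ => hm1 a]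
  have h2 : ∀ w, ∑ a : Fin M, b a (v w) ≤
      M * ENNReal.ofReal |y (v w) - g w| + 1 := fun w => by
    have e : ∑ a : Fin M, b a (v w) = ENNReal.ofReal (((Finset.range M).filter fun a =>
        ¬ (y (v w) ≤ unifPart M a ↔ g w ≤ unifPart M a)).card : ℝ) := by
      simp only [hb, hgv]
      rw [Fin.sum_univ_eq_sum_range (fun a => if ¬ (y (v w) ≤ unifPart M a ↔ g w ≤ unifPart M a)
        then (1 : ℝ≥0∞) else 0) M, Finset.sum_boole]
      simp
    rw [e]
    refine (ENNReal.ofReal_le_ofReal (card_separated_le hM (hy0 _) (hg0 _))).trans_eq ?_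
    rw [ENNReal.ofReal_add (by positivity) zero_le_one, ENNReal.ofReal_mul hM'.le]
    simp
  calc (M : ℝ≥0∞)⁻¹ * ∫⁻ w, ∑ a : Fin M, b a (v w) ∂P
      ≤ (M : ℝ≥0∞)⁻¹ * ∫⁻ w, (M * ENNReal.ofReal |y (v w) - g w| + 1) ∂P := by
        gcongr with w; exact h2 w
    _ = (M : ℝ≥0∞)⁻¹ * (M * ∫⁻ w, ENNReal.ofReal |y (v w) - g w| ∂P + 1) := by
        have hm : Measurable fun w => ENNReal.ofReal |y (v w) - g w| :=
          ((hy.comp hv).sub hg).abs.ennreal_ofReal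
        rw [lintegral_add_right _ measurable_const, lintegral_const_mul _ hm]
        simp
    _ ≤ (M : ℝ≥0∞)⁻¹ * (M * ENNReal.ofReal ε + 1) := by gcongr
    _ = ENNReal.ofReal (ε + 1 / M) := by
        rw [mul_add, ← mul_assoc, ENNReal.inv_mul_cancel (by simpa using hM.ne')
          (ENNReal.natCast_ne_top M), one_mul, mul_one, ENNReal.ofReal_add hε0 (by positivity),
          one_div, ENNReal.ofReal_inv_of_pos hM', ENNReal.ofReal_natCast]

theorem measurable_kernel_set {W : Type*} [MeasurableSpace W] {M : ℕ} (κ : Kernel W (Fin M))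
    {p : W → Fin M → Prop} (hp : ∀ a, MeasurableSet {w | p w a}) :
    Measurable fun w => κ w {a | p w a} := by
  classical
  have e : ∀ w, κ w {a | p w a} = ∑ a, κ w {a} * if p w a then 1 else 0 := fun w => by
    rw [finMeasure_apply]
    refine Finset.sum_congr rfl fun a _ => ?_
    by_cases h : p w a <;> simp [h]
  simp_rw [e]
  exact Finset.measurable_fun_sum _ fun a _ => (Kernel.measurable_coe κ
    (measurableSet_singleton a)).mul (Measurable.ite (hp a) measurable_const measurable_const)

/-- One step of the encoding of a hyperfinite chain by independent uniform digits. -/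
theorem exists_step {W : Type*} [MeasurableSpace W] [StandardBorelSpace W] (P : Measure W)
    [IsProbabilityMeasure P] {r : ℕ → W → W} (hr : ∀ n, Measurable (r n))
    (hrr : ∀ i j, i ≤ j → ∀ w, r j (r i w) = r j w)
    (hrc : ∀ n w, {w' | r n w' = w}.Countable) (n : ℕ) {τ : W → ℕ} (hτ : Measurable τ) {ε : ℝ}
    (hε : 0 < ε) :
    ∃ n' > n, ∃ M > 0, ∃ κ : Kernel W (Fin M), IsMarkovKernel κ ∧ (∀ w, κ (r n w) = κ w) ∧
      (∀ (a : Fin M) (g : W → ℝ≥0∞), Measurable g →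
        ∫⁻ w, κ w {a} * g (r n' w) ∂P = (M : ℝ≥0∞)⁻¹ * ∫⁻ w, g (r n' w) ∂P) ∧
      (∃ dec : Fin M → W → W, (∀ a, Measurable (dec a)) ∧
        ∫⁻ w, κ w {a | dec a (r n' w) ≠ r n w} ∂P ≤ ENNReal.ofReal ε) ∧
      ∃ τ' : Fin M → W → ℕ, (∀ a, Measurable (τ' a)) ∧
        (∀ a j w w', r j w = r j w' → τ' a w = τ' a w') ∧
        ∫⁻ w, κ w {a | τ' a w ≠ τ (r n w)} ∂P ≤ ENNReal.ofReal ε := by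
  classical
  have hWne : Nonempty W := nonempty_of_isProbabilityMeasure P
  have hτn : Measurable fun w => τ (r n w) := hτ.comp (hr n)
  obtain ⟨L, hL⟩ := exists_measure_gt_le P hτn (show 0 < ε / 4 by positivity)
  set t : W → ℕ := fun w => min (τ (r n w)) L with ht
  have htm : Measurable t := hτn.min measurable_const
  have htL : ∀ w, t w < L + 1 := fun w => Nat.lt_succ_of_le (min_le_right _ _)
  choose g0 hg0m hg0inv hg0lim using fun s : ℕ =>
    exists_tail_limit P hr hrr (A := {w | t w < s}) (measurableSet_lt htm measurable_const)
  choose N hN using fun s : ℕ => hg0lim s (ε / (4 * (L + 1))) (by positivity)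
  set n' : ℕ := n + 1 + ∑ s ∈ Finset.range (L + 1), N s with hn'
  have hn'n : n < n' := by omega
  have hn'N : ∀ s < L + 1, N s ≤ n' := fun s hs => by
    have : N s ≤ ∑ s ∈ Finset.range (L + 1), N s :=
      Finset.single_le_sum (fun _ _ => Nat.zero_le _) (Finset.mem_range.2 hs)
    omega
  -- the fibres of the later retraction
  obtain ⟨e, hem, he⟩ := exists_section_enum (Z := W) (X := W) (Γ := {p | r n' p.2 = p.1})
    (measurableSet_eq_fun ((hr n').comp measurable_snd) measurable_fst) (fun z => hrc n' z)
  have hex : ∀ w, ∃ j, e j (r n' w) = r n w := fun w => he _ _ (hrr n n' hn'n.le w)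
  set ι : W → ℕ := fun w => Nat.find (hex w) with hι
  have hιm : Measurable ι := measurable_find hex fun j =>
    measurableSet_eq_fun ((hem j).comp (hr n')) (hr n)
  obtain ⟨L', hL'⟩ := exists_measure_gt_le P hιm (show 0 < ε / 2 by positivity)
  set B : ℕ := L' + 1 with hB
  have hB0 : 0 < B := Nat.succ_pos _
  set l : W → ℕ := fun w => t w * B + min (ι w) L' with hl
  have hlB : ∀ w, min (ι w) L' < B := fun w => Nat.lt_succ_of_le (min_le_right _ _)
  have hlm : Measurable l := (htm.mul measurable_const).add (hιm.min measurable_const)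
  have hldiv : ∀ w, l w / B = t w := fun w => by
    simp only [hl]
    rw [mul_comm, Nat.mul_add_div hB0, Nat.div_eq_of_lt (hlB w), add_zero]
  have hlmod : ∀ w, l w % B = min (ι w) L' := fun w => by
    simp only [hl]
    rw [mul_comm, Nat.mul_add_mod, Nat.mod_eq_of_lt (hlB w)]
  have hlL : ∀ w, l w < (L + 1) * B := fun w => by
    rw [← Nat.div_lt_iff_lt_mul hB0, hldiv]; exact htL w
  obtain ⟨M, hM⟩ := exists_nat_gt ((((L + 1) * B : ℕ) + (L : ℝ) + 1) / (ε / 4))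
  have hM0' : (0 : ℝ) < M := lt_of_le_of_lt (by positivity) hM
  have hM0 : 0 < M := by exact_mod_cast hM0'
  have hMε : (((L + 1) * B : ℕ) : ℝ) / M + L / M ≤ ε / 4 := by
    rw [div_lt_iff₀ (by positivity)] at hM
    rw [← add_div, div_le_iff₀ hM0']
    nlinarith
  obtain ⟨F, hFm, hF, hF0, hFL, hFΨ⟩ := exists_cdf P (hr n') hlm hlL
  obtain ⟨κ, hκM, hκinv, hκ⟩ := exists_digit P (hr n') hlm hM0 hlL hFm hF hF0 hFL hFΨ
  have hunif := fun (a : Fin M) (g : W → ℝ≥0∞) (hg : Measurable g) =>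
    lintegral_digit_uniform hM0 hF hF0 hFL hκ (hr n') a hg
  have hdec := lintegral_digit_decode_le hM0 hFm hF hF0 hFL hκ (P := P)
  have hu0 : ∀ a, 0 ≤ unifPart M a := fun a => by simp only [unifPart]; positivity
  set bad : W → Set (Fin M) := fun w => {a | l w ≠ cut (F (r n' w)) ((L + 1) * B) (unifPart M a)}
    with hbad
  refine ⟨n', hn'n, M, hM0, κ, hκM, fun w => hκinv _ _ (hrr n n' hn'n.le w) ?_, hunif, ?_, ?_⟩
  · simp only [hl, ht, hι, hrr n n' hn'n.le w, hrr n n le_rfl w]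
  · refine ⟨fun a x => e (cut (F x) ((L + 1) * B) (unifPart M a) % B) x, fun a => ?_, ?_⟩
    · have h1 : Measurable fun x => cut (F x) ((L + 1) * B) (unifPart M a) % B :=
        (measurable_from_top (f := fun k : ℕ => k % B)).comp (measurable_cut hFm measurable_const _)
      have h2 : Measurable fun p : ℕ × W => e p.1 p.2 := measurable_from_prod_countable_right hem
      exact h2.comp (h1.prodMk measurable_id)
    · have hsub : ∀ w, κ w {a | e (cut (F (r n' w)) ((L + 1) * B) (unifPart M a) % B) (r n' w) ≠
          r n w} ≤ κ w (bad w) + {w | L' < ι w}.indicator 1 w := fun w => by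
        by_cases hw : L' < ι w
        · rw [indicator_of_mem (by exact hw)]
          exact prob_le_one.trans le_add_self
        · refine le_add_right (measure_mono fun a ha => ?_)
          intro hcon
          refine ha ?_
          rw [← hcon, hlmod, min_eq_left (not_lt.1 hw)]
          exact Nat.find_spec (hex w)
      refine (lintegral_mono hsub).trans ?_
      have hm : Measurable ({w | L' < ι w}.indicator (1 : W → ℝ≥0∞)) :=
        measurable_one.indicator (measurableSet_lt measurable_const hιm)
      rw [lintegral_add_right _ hm, lintegral_indicator_one (measurableSet_lt measurable_const hιm)]
      refine (add_le_add hdec hL').trans ?_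
      rw [← ENNReal.ofReal_add (by positivity) (by positivity)]
      refine ENNReal.ofReal_le_ofReal ?_
      have : 0 ≤ (L : ℝ) / M := by positivity
      linarith
  · set g : ℕ → W → ℝ := fun s w => if s = 0 then 0 else max 0 (g0 s w) with hg
    have hgm : ∀ s, Measurable (g s) := fun s => by
      by_cases hs : s = 0
      · simp only [hg, hs, ↓reduceIte]; exact measurable_const
      · simp only [hg, hs, ↓reduceIte]; exact measurable_const.max (hg0m s)
    have hg0 : ∀ s w, 0 ≤ g s w := fun s w => by
      simp only [hg]; split_ifs
      · exact le_rfl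
      · exact le_max_left _ _
    have hginv : ∀ s j w w', r j w = r j w' → g s w = g s w' := fun s j w w' h => by
      simp only [hg, hg0inv s j w w' h]
    refine ⟨fun a w => cut (fun s => g s w) (L + 1) (unifPart M a), fun a =>
      measurable_cut (y := fun w s => g s w) hgm measurable_const _, fun a j w w' h => ?_, ?_⟩
    · simp only [hginv _ j w w' h]
    · have hsep : ∀ s ∈ Finset.range (L + 1), s ≠ 0 →
          ∫⁻ w, κ w {a | ¬ (F (r n' w) (s * B) ≤ unifPart M a ↔ g s w ≤ unifPart M a)} ∂P ≤
          ENNReal.ofReal (ε / (4 * (L + 1)) + 1 / M) := fun s hs hs0 => by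
        have hsL := Finset.mem_range.1 hs
        refine lintegral_digit_separated_le (y := fun x => F x (s * B)) (hr n') hM0 hunif (hFm _)
          (hgm s) (fun x => hF0 x ▸ hF x (Nat.zero_le _)) (hg0 s)
          (fun w => hginv s n' _ _ (hrr n' n' le_rfl w)) ?_ (by positivity)
        have hc := isCond_of_cdf hlm hFm hF hF0 hFL hFΨ (c := s * B)
          (Nat.mul_le_mul_right B hsL.le)
        have hA : {w | l w < s * B} = {w | t w < s} := by
          ext w; simp only [mem_ofPred_eq]; rw [← hldiv, Nat.div_lt_iff_lt_mul hB0]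
        rw [hA] at hc
        refine (lintegral_mono fun w => ENNReal.ofReal_le_ofReal ?_).trans
          (hN s n' (hn'N s hsL) _ hc)
        simp only [hg, if_neg hs0]
        have h1 : 0 ≤ F (r n' w) (s * B) := hc.nonneg _
        rcases le_total 0 (g0 s w) with h | h
        · rw [max_eq_right h]
        · rw [max_eq_left h, abs_of_nonneg (by linarith), abs_of_nonneg (by linarith)]
          linarith
      set sep : ℕ → W → Set (Fin M) := fun s w =>
        {a | ¬ (F (r n' w) ((s + 1) * B) ≤ unifPart M a ↔ g (s + 1) w ≤ unifPart M a)} with hsepd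
      have hsepm : ∀ s, Measurable fun w => κ w (sep s w) := fun s =>
        measurable_kernel_set κ fun a => MeasurableSet.compl (MeasurableSet.iff
          (measurableSet_le ((hFm _).comp (hr n')) measurable_const)
          (measurableSet_le (hgm _) measurable_const))
      have hIm : MeasurableSet {w | L < τ (r n w)} := measurableSet_lt measurable_const hτn
      have hm1 : Measurable ({w | L < τ (r n w)}.indicator (1 : W → ℝ≥0∞)) :=
        measurable_one.indicator hIm
      have hm2 : Measurable fun w => ∑ s ∈ Finset.range L, κ w (sep s w) :=
        Finset.measurable_fun_sum _ fun s _ => hsepm s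
      have hsub : ∀ w, κ w {a | cut (fun s => g s w) (L + 1) (unifPart M a) ≠ τ (r n w)} ≤
          (κ w (bad w) + ∑ s ∈ Finset.range L, κ w (sep s w)) +
            {w | L < τ (r n w)}.indicator 1 w := fun w => by
        by_cases hw : L < τ (r n w)
        · rw [indicator_of_mem (by exact hw)]
          exact prob_le_one.trans le_add_self
        · refine le_add_right ?_
          refine le_trans (measure_mono (t := bad w ∪ ⋃ s ∈ Finset.range L, sep s w) fun a ha => ?_)
            ((measure_union_le _ _).trans (add_le_add le_rfl (measure_biUnion_finset_le _ _)))
          by_contra hcon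
          simp only [mem_union, mem_iUnion, not_or, not_exists] at hcon
          have h1 : l w = cut (F (r n' w)) ((L + 1) * B) (unifPart M a) := not_not.1 hcon.1
          refine ha ?_
          have h2 : cut (fun s => g s w) (L + 1) (unifPart M a) =
              cut (fun s => F (r n' w) (s * B)) (L + 1) (unifPart M a) := by
            refine cut_congr (fun j hj => ?_) (Nat.succ_pos L) ?_
            · rcases Nat.eq_zero_or_pos j with rfl | hj0
              · simp only [hg, ↓reduceIte, zero_mul, hF0]
              · have h3 := hcon.2 (j - 1) (Finset.mem_range.2 (by omega))
                have h4 : j - 1 + 1 = j := by omega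
                simp only [hsepd, h4, mem_ofPred_eq, not_not] at h3
                exact h3.symm
            · simp only [hg, ↓reduceIte]; exact hu0 a
          rw [h2, ← cut_block (hF _) hB0 (by rw [hF0]; exact hu0 a), ← h1, hldiv]
          exact min_eq_left (not_lt.1 hw)
      refine (lintegral_mono hsub).trans ?_
      rw [lintegral_add_right _ hm1, lintegral_add_right _ hm2, lintegral_indicator_one hIm,
        lintegral_finsetSum _ fun s _ => hsepm s]
      have hsum : ∑ s ∈ Finset.range L, ∫⁻ w, κ w (sep s w) ∂P ≤
          ENNReal.ofReal (L * (ε / (4 * (L + 1)) + 1 / M)) := by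
        refine (Finset.sum_le_sum fun s hs => hsep (s + 1) (Finset.mem_range.2 (by
          have := Finset.mem_range.1 hs; omega)) (Nat.succ_ne_zero s)).trans_eq ?_
        rw [Finset.sum_const, Finset.card_range, nsmul_eq_mul, ENNReal.ofReal_mul (by positivity),
          ENNReal.ofReal_natCast]
      refine (add_le_add (add_le_add hdec hsum) hL).trans ?_
      rw [← ENNReal.ofReal_add (by positivity) (by positivity),
        ← ENNReal.ofReal_add (by positivity) (by positivity)]
      refine ENNReal.ofReal_le_ofReal ?_
      have h1 : L * (ε / (4 * (L + 1)) + 1 / M) ≤ ε / 4 + (L : ℝ) / M := by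
        have : L * (ε / (4 * (L + 1))) ≤ ε / 4 := by
          rw [← mul_div_assoc, div_le_div_iff₀ (by positivity) (by norm_num)]
          nlinarith
        rw [mul_add, mul_one_div]
        linarith
      linarith

/-- Encoding of a hyperfinite chain by independent uniform digits and tail-invariant data. -/
theorem exists_encoding {W : Type*} [MeasurableSpace W] [StandardBorelSpace W] (P : Measure W)
    [IsProbabilityMeasure P] {r : ℕ → W → W} (hr : ∀ n, Measurable (r n))
    (hrr : ∀ i j, i ≤ j → ∀ w, r j (r i w) = r j w)
    (hrc : ∀ n w, {w' | r n w' = w}.Countable) {bit : W → ℕ → Bool} (hbit : Measurable bit) :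
    ∃ (nn M : ℕ → ℕ) (κ : ∀ k, Kernel W (Fin (M k))) (dec : ∀ k, Fin (M k) → W → W)
      (τ' : ∀ k, Fin (M k) → W → ℕ) (t : ℕ → ℕ → W → ℕ),
      nn 0 = 0 ∧ (∀ k, nn k < nn (k + 1)) ∧ (∀ k, 0 < M k) ∧ (∀ k, IsMarkovKernel (κ k)) ∧
      (∀ k w, κ k (r (nn k) w) = κ k w) ∧
      (∀ k (a : Fin (M k)) (g : W → ℝ≥0∞), Measurable g →
        ∫⁻ w, κ k w {a} * g (r (nn (k + 1)) w) ∂P =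
          (M k : ℝ≥0∞)⁻¹ * ∫⁻ w, g (r (nn (k + 1)) w) ∂P) ∧
      (∀ k a, Measurable (dec k a)) ∧
      (∀ k, ∫⁻ w, κ k w {a | dec k a (r (nn (k + 1)) w) ≠ r (nn k) w} ∂P ≤
        ENNReal.ofReal ((1 / 2) ^ k)) ∧
      (∀ k a, Measurable (τ' k a)) ∧
      (∀ k a j w w', r j w = r j w' → τ' k a w = τ' k a w') ∧
      (∀ k, ∫⁻ w, κ k w {a | τ' k a w ≠ t k k (r (nn k) w)} ∂P ≤ ENNReal.ofReal ((1 / 2) ^ k)) ∧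
      (∀ k p, Measurable (t k p)) ∧
      (∀ k p v v', t k p v = t k p v' → ∀ j < p, bit v j = bit v' j) ∧
      ∀ k p v v', t (k + 1) p v = t (k + 1) p v' → ∀ a, t k p (dec k a v) = t k p (dec k a v') := by
  classical
  choose n' hn' M hM κ hκ hinv hunif hd hτall using
    fun (k n : ℕ) (τ : W → ℕ) (hτ : Measurable τ) =>
      exists_step P hr hrr hrc n hτ (show (0 : ℝ) < (1 / 2) ^ k by positivity)
  choose dec hdec hdec2 using hd
  choose τ' hτ' hτ'inv hτ'2 using hτall
  choose E hE using fun p m : ℕ => exists_injective_nat ((Fin p → Bool) × (Fin m → ℕ))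
  choose E0 hE0 using fun p : ℕ => exists_injective_nat (Fin p → Bool)
  have hbm : ∀ p, Measurable fun w => fun i : Fin p => bit w i := fun p =>
    measurable_pi_lambda _ fun i => (measurable_pi_apply _).comp hbit
  let St := {s : ℕ × (ℕ → W → ℕ) // (∀ p, Measurable (s.2 p)) ∧
    ∀ p v v', s.2 p v = s.2 p v' → ∀ j < p, bit v j = bit v' j}
  let s0 : St := ⟨(0, fun p v => E0 p fun i : Fin p => bit v i),
    fun p => (measurable_of_countable (E0 p)).comp (hbm p),
    fun p v v' h j hj => congrFun (hE0 p h) ⟨j, hj⟩⟩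
  let next : ℕ → St → St := fun k s => ⟨(n' k s.1.1 (s.1.2 k) (s.2.1 k), fun p v =>
    E p _ (fun i : Fin p => bit v i,
      fun a : Fin (M k s.1.1 (s.1.2 k) (s.2.1 k)) => s.1.2 p (dec k s.1.1 (s.1.2 k) (s.2.1 k) a v))),
    fun p => (measurable_of_countable (E p _)).comp ((hbm p).prodMk (measurable_pi_lambda _ fun a =>
      (s.2.1 p).comp (hdec k _ _ _ a))),
    fun p v v' h j hj => congrFun (Prod.ext_iff.1 (hE p _ h)).1 ⟨j, hj⟩⟩
  let S : ℕ → St := fun k => Nat.rec s0 next k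
  have hS : ∀ k, S (k + 1) = next k (S k) := fun k => rfl
  refine ⟨fun k => (S k).1.1, fun k => M k (S k).1.1 ((S k).1.2 k) ((S k).2.1 k),
    fun k => κ k (S k).1.1 ((S k).1.2 k) ((S k).2.1 k),
    fun k => dec k (S k).1.1 ((S k).1.2 k) ((S k).2.1 k),
    fun k => τ' k (S k).1.1 ((S k).1.2 k) ((S k).2.1 k), fun k => (S k).1.2, rfl,
    fun k => hn' _ _ _ _, fun k => hM _ _ _ _, fun k => hκ _ _ _ _, fun k => hinv _ _ _ _,
    fun k => hunif _ _ _ _, fun k => hdec _ _ _ _, fun k => hdec2 _ _ _ _, fun k => hτ' _ _ _ _,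
    fun k => hτ'inv _ _ _ _, fun k => hτ'2 _ _ _ _, fun k => (S k).2.1, fun k => (S k).2.2, ?_⟩
  intro k p v v' h a
  exact congrFun (Prod.ext_iff.1 (hE p _ h)).2 a

theorem measurableSet_prod_countable {W A : Type*} [MeasurableSpace W] [MeasurableSpace A]
    [Countable A] [MeasurableSingletonClass A] {p : W → A → Prop}
    (hp : ∀ a, MeasurableSet {w | p w a}) : MeasurableSet {q : W × A | p q.1 q.2} := by
  have : {q : W × A | p q.1 q.2} = ⋃ a, {w | p w a} ×ˢ {a} := by
    ext ⟨w, a⟩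
    simp
  rw [this]
  exact MeasurableSet.iUnion fun a => (hp a).prod (measurableSet_singleton a)

theorem measure_digit_event {W : Type*} [MeasurableSpace W] {P : Measure W}
    [IsProbabilityMeasure P] {M : ℕ → ℕ} (κ : ∀ k, Kernel W (Fin (M k)))
    [∀ k, IsMarkovKernel (κ k)] (k : ℕ) {p : W → Fin (M k) → Prop}
    (hp : ∀ a, MeasurableSet {w | p w a}) :
    (P ⊗ₘ piKernel κ) {q | p q.1 (q.2 k)} = ∫⁻ w, κ k w {a | p w a} ∂P := by
  have hm : MeasurableSet {q : W × (∀ k, Fin (M k)) | p q.1 (q.2 k)} := by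
    have h1 : MeasurableSet {q : W × Fin (M k) | p q.1 q.2} :=
      measurableSet_prod_countable hp
    have h2 : Measurable fun q : W × (∀ k, Fin (M k)) => (q.1, q.2 k) :=
      measurable_fst.prodMk ((measurable_pi_apply k).comp measurable_snd)
    exact h2 h1
  rw [Measure.compProd_apply hm]
  refine lintegral_congr fun w => ?_
  rw [piKernel_apply, ← Measure.infinitePi_map_eval (fun k => κ k w) k,
    Measure.map_apply (measurable_pi_apply k) (Set.toFinite _).measurableSet]
  rfl

theorem medial_chain
    (hT : ∀ (M : ℕ → ℕ) [∀ k, NeZero (M k)], Medial (bern M) (Tail (A := fun k => Fin (M k))))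
    {W : Type*} [MeasurableSpace W] [StandardBorelSpace W] (P : Measure W)
    [IsProbabilityMeasure P] {r : ℕ → W → W} (hr : ∀ n, Measurable (r n)) (hr0 : ∀ w, r 0 w = w)
    (hrr : ∀ i j, i ≤ j → ∀ w, r j (r i w) = r j w)
    (hrc : ∀ n w, {w' | r n w' = w}.Countable) :
    Medial P fun w w' => ∃ n, r n w = r n w' := by
  obtain ⟨bit, hbit, hbitinj⟩ :=
    MeasurableSpace.measurable_injection_nat_bool_of_countablySeparated W
  obtain ⟨nn, M, κ, dec, τ', t, h0, hlt, hM, hκ, hinv, hunif, hdec, hdec2, hτ', hτ'inv, hτ'2, htm,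
    htbit, htdec⟩ := exists_encoding P hr hrr hrc hbit
  have hMne : ∀ k, NeZero (M k) := fun k => ⟨(hM k).ne'⟩
  have hmono : StrictMono nn := strictMono_nat_of_lt_succ hlt
  have hD : IsDigits P (fun k => r (nn k)) M κ := ⟨fun k => hr _, fun w => by rw [h0, hr0],
    fun j k hjk w => hrr _ _ (hmono.monotone hjk) w, hinv, hunif⟩
  set I : W → (∀ k, Fin (M k) → ℕ) := fun w k a => τ' k a w with hI
  have hIm : Measurable I := measurable_pi_lambda _ fun k => measurable_pi_lambda _ fun a => hτ' k a
  have hIinv : ∀ j w w', r j w = r j w' → I w = I w' := fun j w w' h => by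
    funext k a; exact hτ'inv k a j w w' h
  have hIp : IsProbabilityMeasure (P.map I) := Measure.isProbabilityMeasure_map hIm.aemeasurable
  have hmed := medial_bern_prod hT M (P.map I)
  set K : Kernel W ((∀ k, Fin (M k)) × (∀ k, Fin (M k) → ℕ)) :=
    piKernel κ ×ₖ Kernel.deterministic I hIm with hK
  have hj : ∀ w, Measurable fun c : (∀ k, Fin (M k)) => (c, I w) :=
    fun w => measurable_id.prodMk measurable_const
  have hKw : ∀ w, K w = (piKernel κ w).map fun c => (c, I w) := fun w => by
    rw [hK, Kernel.prod_apply, Kernel.deterministic_apply, Measure.prod_dirac]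
  have hφ : Measurable fun p : W × (∀ k, Fin (M k)) => (p.1, (p.2, I p.1)) :=
    measurable_fst.prodMk (measurable_snd.prodMk (hIm.comp measurable_fst))
  have hPK : P ⊗ₘ K = (P ⊗ₘ piKernel κ).map fun p => (p.1, (p.2, I p.1)) := by
    ext s hs
    rw [Measure.map_apply hφ hs, Measure.compProd_apply hs, Measure.compProd_apply (hφ hs)]
    refine lintegral_congr fun w => ?_
    rw [hKw, Measure.map_apply (hj _) (measurable_prodMk_left hs)]
    rfl
  set Γ : Set (W × ((∀ k, Fin (M k)) × (∀ k, Fin (M k) → ℕ))) := {q | q.2.2 = I q.1 ∧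
    ∃ i, ∀ k, i ≤ k → dec k (q.2.1 k) (r (nn (k + 1)) q.1) = r (nn k) q.1 ∧
      τ' k (q.2.1 k) q.1 = t k k (r (nn k) q.1)} with hΓ
  have hdm : ∀ k a, MeasurableSet {w | dec k a (r (nn (k + 1)) w) = r (nn k) w} := fun k a =>
    measurableSet_eq_fun ((hdec k a).comp (hr _)) (hr _)
  have htm' : ∀ k a, MeasurableSet {w | τ' k a w = t k k (r (nn k) w)} := fun k a =>
    measurableSet_eq_fun (hτ' k a) ((htm k k).comp (hr _))
  have hΓm : MeasurableSet Γ := by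
    have hc : ∀ k, Measurable fun q : W × ((∀ k, Fin (M k)) × (∀ k, Fin (M k) → ℕ)) =>
        (q.1, q.2.1 k) := fun k =>
      measurable_fst.prodMk ((measurable_pi_apply k).comp (measurable_fst.comp measurable_snd))
    rw [hΓ, ofPred_and]
    refine (measurableSet_eq_fun (measurable_snd.comp measurable_snd)
      (hIm.comp measurable_fst)).inter ?_
    simp only [ofPred_exists, ofPred_forall]
    refine MeasurableSet.iUnion fun i => MeasurableSet.iInter fun k => MeasurableSet.iInter fun _ =>
      MeasurableSet.inter ?_ ?_
    · have : MeasurableSet {q : W × Fin (M k) | dec k q.2 (r (nn (k + 1)) q.1) = r (nn k) q.1} :=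
        measurableSet_prod_countable (p := fun w a => dec k a (r (nn (k + 1)) w) = r (nn k) w) (hdm k)
      exact hc k this
    · have : MeasurableSet {q : W × Fin (M k) | τ' k q.2 q.1 = t k k (r (nn k) q.1)} :=
        measurableSet_prod_countable (p := fun w a => τ' k a w = t k k (r (nn k) w)) (htm' k)
      exact hc k this
  have hsum : ∑' k : ℕ, ENNReal.ofReal ((1 / 2) ^ k) ≠ ∞ := by
    rw [← ENNReal.ofReal_tsum_of_nonneg (fun n => by positivity)
      (summable_geometric_of_lt_one (by norm_num) (by norm_num))]
    exact ENNReal.ofReal_ne_top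
  have hfibre : ∀ c : ∀ k, Fin (M k), ∀ i k, i ≤ k → ∀ p w w',
      (∀ k, i ≤ k → dec k (c k) (r (nn (k + 1)) w) = r (nn k) w) →
      (∀ k, i ≤ k → dec k (c k) (r (nn (k + 1)) w') = r (nn k) w') →
      t k p (r (nn k) w) = t k p (r (nn k) w') → t i p (r (nn i) w) = t i p (r (nn i) w') := by
    intro c i k hik p w w' hw hw'
    induction k, hik using Nat.le_induction with
    | base => exact id
    | succ k hik ih =>
      intro h
      refine ih ?_
      have := htdec k p _ _ h (c k)
      rwa [hw k hik, hw' k hik] at this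
  refine Medial.transfer (F := fun p q => Tail p.1 q.1 ∧ p.2 = q.2) ?_ ?_ ?_ hmed P K ?_ hΓm ?_ ?_ ?_
    univ (ae_of_all _ fun _ => mem_univ _) ?_
  · exact ⟨fun p => ⟨tail_equivalence.refl _, rfl⟩, fun h => ⟨tail_equivalence.symm h.1, h.2.symm⟩,
      fun h h' => ⟨tail_equivalence.trans h.1 h'.1, h.2.trans h'.2⟩⟩
  · refine MeasurableSet.inter ?_ (measurableSet_eq_fun (measurable_snd.comp measurable_fst)
      (measurable_snd.comp measurable_snd))
    have h1 := measurableSet_tail (A := fun k => Fin (M k))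
    exact ((measurable_fst.comp measurable_fst).prodMk (measurable_fst.comp measurable_snd)) h1
  · intro z
    refine ((countable_tail z.1).image fun c => (c, z.2)).mono ?_
    rintro ⟨c, y⟩ ⟨h1, h2⟩
    exact ⟨c, h1, Prod.ext rfl h2⟩
  · rw [hPK, Measure.snd, Measure.map_map measurable_snd hφ]
    exact Measure.absolutelyContinuous_of_eq
      (hD.map_snd_prod hIm fun k w => hIinv (nn k) _ _ (hrr _ _ le_rfl w))
  · rw [hPK]
    refine (ae_map_iff hφ.aemeasurable hΓm).2 ?_
    have h1 := ae_eventually_notMem (μ := P ⊗ₘ piKernel κ)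
      (s := fun k => {q | dec k (q.2 k) (r (nn (k + 1)) q.1) ≠ r (nn k) q.1}) (by
        refine ne_top_of_le_ne_top hsum (ENNReal.tsum_le_tsum fun k => ?_)
        rw [measure_digit_event κ k (p := fun w a => dec k a (r (nn (k + 1)) w) ≠ r (nn k) w)
          fun a => (hdm k a).compl]
        exact hdec2 k)
    have h2 := ae_eventually_notMem (μ := P ⊗ₘ piKernel κ)
      (s := fun k => {q | τ' k (q.2 k) q.1 ≠ t k k (r (nn k) q.1)}) (by
        refine ne_top_of_le_ne_top hsum (ENNReal.tsum_le_tsum fun k => ?_)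
        rw [measure_digit_event κ k (p := fun w a => τ' k a w ≠ t k k (r (nn k) w))
          fun a => (htm' k a).compl]
        exact hτ'2 k)
    filter_upwards [h1, h2] with q hq1 hq2
    obtain ⟨i, hi⟩ := eventually_atTop.1 (hq1.and hq2)
    exact ⟨rfl, i, fun k hk => ⟨not_not.1 (hi k hk).1, not_not.1 (hi k hk).2⟩⟩
  · rintro ⟨c, y⟩
    set Gi : ℕ → Set W := fun i => {w | y = I w ∧ ∀ k, i ≤ k →
      dec k (c k) (r (nn (k + 1)) w) = r (nn k) w ∧ τ' k (c k) w = t k k (r (nn k) w)} with hGi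
    have hsub : {w | (w, (c, y)) ∈ Γ} ⊆ ⋃ i, Gi i := by
      rintro w ⟨h1, i, h2⟩
      exact mem_iUnion.2 ⟨i, h1, h2⟩
    refine (countable_iUnion fun i => ?_).mono hsub
    rcases (Gi i).eq_empty_or_nonempty with he | ⟨w0, hw0⟩
    · rw [he]; exact countable_empty
    refine (hrc (nn i) (r (nn i) w0)).mono fun w hw => ?_
    refine hbitinj (funext fun j => ?_)
    set k := max i (j + 1) with hk
    refine htbit i k _ _ (hfibre c i k (le_max_left _ _) k w w0 (fun k hk => (hw.2 k hk).1)
      (fun k hk => (hw0.2 k hk).1) ?_) j (lt_of_lt_of_le (Nat.lt_succ_self j) (le_max_right _ _))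
    rw [← (hw.2 k (le_max_left _ _)).2, ← (hw0.2 k (le_max_left _ _)).2]
    exact congrFun (congrFun (hw.1.symm.trans hw0.1) k) (c k)
  · exact ⟨fun w => ⟨0, rfl⟩, fun ⟨n, h⟩ => ⟨n, h.symm⟩, fun {w w' w''} ⟨n, h⟩ ⟨m, h'⟩ =>
      ⟨max n m, by
        rw [← hrr n _ (le_max_left n m) w, h, hrr n _ (le_max_left n m),
          ← hrr m _ (le_max_right n m) w', h', hrr m _ (le_max_right n m)]⟩⟩
  · rintro w - w' - ⟨n, hn⟩ U hU hUinv
    have hIe : I w = I w' := hIinv n w w' hn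
    have hUm : MeasurableSet {c : ∀ k, Fin (M k) | (c, I w') ∈ U} :=
      (measurable_id.prodMk measurable_const) hU
    rw [hKw, hKw, Measure.map_apply (hj _) hU,
      Measure.map_apply (hj _) hU, piKernel_apply, piKernel_apply,
      hIe]
    refine infinitePi_eq_of_tail (fun k => κ k w) (fun k => κ k w')
      (fun k => if k < n then 1 else 0) ?_ (fun k s _ => ?_) (G := univ) (G' := univ)
      (ae_of_all _ fun _ => mem_univ _) (ae_of_all _ fun _ => mem_univ _) hUm ?_
    · rw [tsum_eq_sum (s := Finset.range n) fun k hk => if_neg (by simpa using hk)]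
      exact ENNReal.sum_ne_top.2 fun k _ => by split_ifs <;> simp
    · split_ifs with hk
      · exact prob_le_one.trans le_add_self
      · have hnk : n ≤ nn k := (not_lt.1 hk).trans hmono.le_apply
        have e : r (nn k) w = r (nn k) w' := by
          rw [← hrr n _ hnk w, hn, hrr n _ hnk w']
        rw [← hinv k w, e, hinv k w', add_zero]
    · intro c _ c' _ hcc
      obtain ⟨i, hi⟩ := eventually_atTop.1 hcc
      exact hUinv (c, I w') (c', I w') ⟨⟨i, hi⟩, rfl⟩

section Patterns

open scoped Classical in
/-- The set of times in `[n, n + N)`, counted from `n`, at which `w` lies in `c`. -/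
noncomputable def pat {W : Type*} (c : ℕ → Set W) (n N : ℕ) (w : W) : Finset ℕ :=
  (Finset.range N).filter fun i => w ∈ c (n + i)

variable {W : Type*} [MeasurableSpace W] {P : Measure W} {r : ℕ → W → W} {c : ℕ → Set W}

theorem mem_pat {n N : ℕ} {w : W} {i : ℕ} : i ∈ pat c n N w ↔ i < N ∧ w ∈ c (n + i) := by
  simp [pat]

theorem pat_erase (n N : ℕ) (w : W) : (pat c n (N + 1) w).erase N = pat c n N w := by
  ext i
  rw [Finset.mem_erase, mem_pat, mem_pat]
  constructor
  · rintro ⟨h1, h2, h3⟩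
    exact ⟨by omega, h3⟩
  · rintro ⟨h1, h2⟩
    exact ⟨by omega, by omega, h2⟩

theorem measurableSet_pat (hc : ∀ n, MeasurableSet (c n)) (n N : ℕ) (s : Finset ℕ) :
    MeasurableSet {w | pat c n N w = s} := by
  have : {w | pat c n N w = s} = ⋂ i, {w | (i < N ∧ w ∈ c (n + i)) ↔ i ∈ s} := by
    ext w
    simp only [mem_ofPred_eq, mem_iInter, Finset.ext_iff, mem_pat]
  rw [this]
  refine MeasurableSet.iInter fun i => MeasurableSet.iff ?_ (MeasurableSet.const _)
  exact (MeasurableSet.const _).inter (hc _)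

theorem measure_pat_le (hr : ∀ n, Measurable (r n)) (hc : ∀ n, MeasurableSet (c n))
    (hrr : ∀ i j, i ≤ j → ∀ w, r j (r i w) = r j w)
    (hcr : ∀ n w, r n w ∈ c n ↔ w ∈ c n)
    (hhalf : ∀ n U, MeasurableSet U → P (c n ∩ r (n + 1) ⁻¹' U) ≤ 2⁻¹ * P (r (n + 1) ⁻¹' U))
    (n N : ℕ) (s : Finset ℕ) {U : Set W} (hU : MeasurableSet U) :
    P ({w | pat c n N w = s} ∩ r (n + N) ⁻¹' U) ≤ 2⁻¹ ^ s.card * P (r (n + N) ⁻¹' U) := by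
  induction N generalizing s U with
  | zero =>
    by_cases hs : s = ∅
    · subst hs
      simpa using measure_mono inter_subset_right
    · have : {w | pat c n 0 w = s} = ∅ := by
        ext w
        simp only [mem_ofPred_eq, mem_empty_iff_false, iff_false]
        intro h
        exact hs (by rw [← h]; simp [pat])
      simp [this]
  | succ N ih =>
    have hpre : ∀ w, r (n + N + 1) (r (n + N) w) = r (n + N + 1) w := hrr _ _ (Nat.le_succ _)
    by_cases hN : N ∈ s
    · have hV : MeasurableSet (c (n + N) ∩ r (n + N + 1) ⁻¹' U) := (hc _).inter (hr _ hU)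
      have hVe : r (n + N) ⁻¹' (c (n + N) ∩ r (n + N + 1) ⁻¹' U) =
          c (n + N) ∩ r (n + N + 1) ⁻¹' U := by
        ext w; simp only [mem_preimage, mem_inter_iff, hcr, hpre]
      have h1 := ih (s.erase N) hV
      rw [hVe] at h1
      refine (measure_mono ?_).trans (h1.trans ?_)
      · rintro w ⟨hw, hwU⟩
        have hw' : pat c n (N + 1) w = s := hw
        refine ⟨?_, ?_, hwU⟩
        · change pat c n N w = _
          rw [← pat_erase, hw']
        · exact (mem_pat.1 (hw'.symm ▸ hN : N ∈ pat c n (N + 1) w)).2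
      · refine (mul_le_mul_right (hhalf (n + N) U hU) _).trans_eq ?_
        rw [← mul_assoc, ← pow_succ, Finset.card_erase_add_one hN]
        rfl
    · have hV : MeasurableSet (r (n + N + 1) ⁻¹' U) := hr _ hU
      have hVe : r (n + N) ⁻¹' (r (n + N + 1) ⁻¹' U) = r (n + N + 1) ⁻¹' U := by
        ext w; simp only [mem_preimage, hpre]
      have h1 := ih s hV
      rw [hVe] at h1
      refine (measure_mono ?_).trans h1
      rintro w ⟨hw, hwU⟩
      have hw' : pat c n (N + 1) w = s := hw
      refine ⟨?_, hwU⟩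
      change pat c n N w = _
      rw [← pat_erase, hw', Finset.erase_eq_of_notMem hN]

theorem exists_measure_card_pat_le [IsFiniteMeasure P] (hc : ∀ n, MeasurableSet (c n))
    (hinf : ∀ᵐ w ∂P, ∃ᶠ n in atTop, w ∈ c n) (n m : ℕ) {ε : ℝ≥0∞} (hε : 0 < ε) :
    ∃ N, P {w | (pat c n N w).card < m} ≤ ε := by
  have hanti : Antitone fun N => {w | (pat c n N w).card < m} := fun N N' h w hw =>
    lt_of_le_of_lt (Finset.card_le_card fun i hi => by
      rw [mem_pat] at hi ⊢
      exact ⟨hi.1.trans_le h, hi.2⟩) hw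
  have hm : ∀ N, MeasurableSet {w | (pat c n N w).card < m} := fun N => by
    have : {w | (pat c n N w).card < m} = ⋃ s ∈ {s : Finset ℕ | s.card < m},
        {w | pat c n N w = s} := by ext w; simp
    rw [this]
    exact MeasurableSet.biUnion (to_countable _) fun s _ => measurableSet_pat hc n N s
  have hlim := tendsto_measure_iInter_atTop (μ := P) (fun N => (hm N).nullMeasurableSet) hanti
    ⟨0, measure_ne_top _ _⟩
  have h0 : P (⋂ N, {w | (pat c n N w).card < m}) = 0 := by
    refine measure_mono_null (fun w hw => ?_) (ae_iff.1 hinf)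
    intro hcon
    have hcon' : {i | w ∈ c (n + i)}.Infinite := by
      rw [← Nat.frequently_atTop_iff_infinite, frequently_atTop]
      intro a
      obtain ⟨b, hb, hb'⟩ := frequently_atTop.1 hcon (n + a)
      exact ⟨b - n, by omega, by rwa [Nat.add_sub_cancel' (by omega)]⟩
    obtain ⟨t, ht, htm⟩ := hcon'.exists_subset_card_eq m
    have := mem_iInter.1 hw (t.sup id + 1)
    refine absurd (show (pat c n (t.sup id + 1) w).card < m from this) (not_lt.2 ?_)
    rw [← htm]
    refine Finset.card_le_card fun i hi => mem_pat.2 ⟨Nat.lt_succ_of_le ?_, ht hi⟩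
    exact Finset.le_sup (f := id) hi
  rw [h0] at hlim
  obtain ⟨N, hN⟩ := ((tendsto_order.1 hlim).2 ε hε).exists
  exact ⟨N, hN.le⟩

theorem exists_step_pat [IsProbabilityMeasure P] (hr : ∀ n, Measurable (r n))
    (hc : ∀ n, MeasurableSet (c n)) (hrr : ∀ i j, i ≤ j → ∀ w, r j (r i w) = r j w)
    (hcr : ∀ n w, r n w ∈ c n ↔ w ∈ c n)
    (hhalf : ∀ n U, MeasurableSet U → P (c n ∩ r (n + 1) ⁻¹' U) ≤ 2⁻¹ * P (r (n + 1) ⁻¹' U))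
    (hinf : ∀ᵐ w ∂P, ∃ᶠ n in atTop, w ∈ c n) (n M : ℕ) (hM : 0 < M) {ε : ℝ} (hε : 0 < ε) :
    ∃ n' ≥ n, ∃ κ : Kernel W (Fin M), IsMarkovKernel κ ∧ (∀ w, κ (r n w) = κ w) ∧
      (∀ (a : Fin M) (g : W → ℝ≥0∞), Measurable g →
        ∫⁻ w, κ w {a} * g (r n' w) ∂P = (M : ℝ≥0∞)⁻¹ * ∫⁻ w, g (r n' w) ∂P) ∧
      ∃ enc : W → Fin M, Measurable enc ∧
        ∫⁻ w, κ w {a | a ≠ enc w} ∂P ≤ ENNReal.ofReal ε := by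
  classical
  obtain ⟨m, hm⟩ := exists_pow_lt_of_lt_one (show 0 < ε / (2 * M) by positivity)
    (show (1 / 2 : ℝ) < 1 by norm_num)
  obtain ⟨N, hN⟩ := exists_measure_card_pat_le hc hinf n m
    (ENNReal.ofReal_pos.2 (show 0 < ε / (2 * M) by positivity))
  set L : ℕ := (Finset.range N).powerset.sup (Encodable.encode : Finset ℕ → ℕ) + 1 with hL
  set l : W → ℕ := fun w => Encodable.encode (pat c n N w) with hl
  have hlm : Measurable l := by
    refine measurable_to_countable' fun e => ?_
    by_cases he : ∃ s : Finset ℕ, Encodable.encode s = e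
    · obtain ⟨s, rfl⟩ := he
      have : l ⁻¹' {Encodable.encode s} = {w | pat c n N w = s} := by
        ext w; simp [hl]
      rw [this]
      exact measurableSet_pat hc n N s
    · have : l ⁻¹' {e} = ∅ := by
        ext w
        simp only [mem_preimage, mem_singleton_iff, mem_empty_iff_false, iff_false]
        exact fun h => he ⟨_, h⟩
      rw [this]; exact MeasurableSet.empty
  have hlL : ∀ w, l w < L := fun w => Nat.lt_succ_of_le
    (Finset.le_sup (f := (Encodable.encode : Finset ℕ → ℕ)) (Finset.mem_powerset.2
      (Finset.filter_subset _ _)))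
  set n' := n + N with hn'
  have hnn' : n ≤ n' := Nat.le_add_right _ _
  obtain ⟨F, hFm, hF, hF0, hFL, hFΨ⟩ := exists_cdf P (hr n') hlm hlL
  obtain ⟨κ, hκM, hκinv, hκ⟩ := exists_digit P (hr n') hlm hM hlL hFm hF hF0 hFL hFΨ
  have hunif := fun (a : Fin M) (g : W → ℝ≥0∞) (hg : Measurable g) =>
    lintegral_digit_uniform hM hF hF0 hFL hκ (hr n') a hg
  set big : ℕ → Prop := fun e => ∃ s : Finset ℕ, Encodable.encode s = e ∧ m ≤ s.card with hbig
  set δ : W → ℝ := fun x => (1 / 2) ^ m +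
    ∑ e ∈ Finset.range L, if big e then 0 else F x (e + 1) - F x e with hδ
  have hq0 : ∀ x e, 0 ≤ F x (e + 1) - F x e := fun x e => sub_nonneg.2 (hF x (Nat.le_succ e))
  have ht0 : ∀ x e, 0 ≤ if big e then 0 else F x (e + 1) - F x e := fun x e => by
    split_ifs
    exacts [le_rfl, hq0 x e]
  have hδ0 : ∀ x, 0 ≤ δ x := fun x => add_nonneg (by positivity)
    (Finset.sum_nonneg fun e _ => ht0 x e)
  have hae : ∀ᵐ w ∂P, ∀ e < L, F (r n' w) (e + 1) - F (r n' w) e ≤ δ (r n' w) := by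
    rw [ae_all_iff]; intro e
    by_cases heL : e < L
    swap; · exact ae_of_all _ fun w h => absurd h heL
    by_cases hbe : big e
    swap
    · refine ae_of_all _ fun w _ => ?_
      have h1 : F (r n' w) (e + 1) - F (r n' w) e ≤
          ∑ e ∈ Finset.range L, if big e then 0 else F (r n' w) (e + 1) - F (r n' w) e := by
        refine le_trans (le_of_eq ?_) (Finset.single_le_sum
          (f := fun e => if big e then 0 else F (r n' w) (e + 1) - F (r n' w) e)
          (fun e _ => ht0 _ e) (Finset.mem_range.2 heL))
        simp only [if_neg hbe]
      refine h1.trans ?_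
      simp only [hδ]
      exact le_add_of_nonneg_left (by positivity)
    obtain ⟨s, hse, hsm⟩ := hbe
    have key : ∀ᵐ x ∂(P.map (r n')), ENNReal.ofReal (F x (e + 1) - F x e) ≤ 2⁻¹ ^ m := by
      have hqm : Measurable fun x => ENNReal.ofReal (F x (e + 1) - F x e) :=
        ((hFm _).sub (hFm _)).ennreal_ofReal
      have hPm : IsFiniteMeasure (P.map (r n')) := inferInstance
      refine ae_le_of_forall_setLIntegral_le_of_sigmaFinite (g := fun _ => 2⁻¹ ^ m) hqm
        fun U hU _ => ?_
      rw [setLIntegral_const, setLIntegral_map hU hqm (hr n'), Measure.map_apply (hr n') hU]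
      have h1 := hFΨ (fun x e' => if e' = e then U.indicator 1 x else 0) fun e' => by
        split_ifs
        · exact measurable_one.indicator hU
        · exact measurable_const
      have h2 : ∫⁻ w, (if l w = e then U.indicator (1 : W → ℝ≥0∞) (r n' w) else 0) ∂P =
          P ({w | pat c n N w = s} ∩ r n' ⁻¹' U) := by
        rw [← lintegral_indicator_one ((measurableSet_pat hc n N s).inter (hr n' hU))]
        refine lintegral_congr fun w => ?_
        have : l w = e ↔ pat c n N w = s := by rw [hl, ← hse]; simp
        by_cases hw : pat c n N w = s
        · rw [if_pos (this.2 hw)]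
          by_cases hwU : r n' w ∈ U
          · rw [indicator_of_mem hwU, indicator_of_mem (by exact ⟨hw, hwU⟩)]; rfl
          · rw [indicator_of_notMem hwU, indicator_of_notMem (by exact fun h => hwU h.2)]
        · rw [if_neg (fun h => hw (this.1 h)), indicator_of_notMem (by exact fun h => hw h.1)]
      have h3 : ∫⁻ w, ∑ e' ∈ Finset.range L, ENNReal.ofReal (F (r n' w) (e' + 1) - F (r n' w) e') *
          (if e' = e then U.indicator 1 (r n' w) else 0) ∂P =
          ∫⁻ w in r n' ⁻¹' U, ENNReal.ofReal (F (r n' w) (e + 1) - F (r n' w) e) ∂P := by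
        rw [← lintegral_indicator (hr n' hU)]
        refine lintegral_congr fun w => ?_
        rw [Finset.sum_eq_single_of_mem e (Finset.mem_range.2 heL) fun e' _ h => by
          rw [if_neg h, mul_zero], if_pos rfl]
        by_cases hwU : r n' w ∈ U
        · rw [indicator_of_mem hwU, indicator_of_mem (by exact hwU), Pi.one_apply, mul_one]
        · rw [indicator_of_notMem hwU, indicator_of_notMem (by exact hwU), mul_zero]
      rw [← h3, ← h1, h2]
      refine (measure_pat_le hr hc hrr hcr hhalf n N s hU).trans ?_
      exact mul_le_mul_left (pow_le_pow_right_of_le_one' (by simp) hsm) _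
    filter_upwards [ae_of_ae_map (hr n').aemeasurable key] with w hw _
    have e2 : (2⁻¹ : ℝ≥0∞) ^ m = ENNReal.ofReal ((1 / 2) ^ m) := by
      rw [ENNReal.ofReal_pow (by norm_num), one_div, ENNReal.ofReal_inv_of_pos (by norm_num)]
      simp
    rw [e2] at hw
    refine ((ENNReal.ofReal_le_ofReal_iff (by positivity)).1 hw).trans ?_
    simp only [hδ]
    exact le_add_of_nonneg_right (Finset.sum_nonneg fun e _ => ht0 _ e)
  have herr := lintegral_digit_encode_le hM hFm hF hF0 hFL hκ hδ0 hae
  have hFl : Measurable fun w => F (r n' w) (l w) := by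
    have h2 : Measurable fun p : W × ℕ => F p.1 p.2 := measurable_from_prod_countable_left hFm
    exact h2.comp ((hr n').prodMk hlm)
  have hu : Measurable fun w => cut (unifPart M) M (F (r n' w) (l w)) :=
    measurable_cut (y := fun _ => unifPart M) (fun _ => measurable_const) hFl M
  refine ⟨n', hnn', κ, hκM, fun w => hκinv _ _ (hrr n n' hnn' w) ?_, hunif,
    fun w => ⟨cut (unifPart M) M (F (r n' w) (l w)), cut_lt _ hM _⟩, ?_, ?_⟩
  · have : ∀ i w, r n w ∈ c (n + i) ↔ w ∈ c (n + i) := fun i w => by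
      rw [← hcr (n + i) (r n w), hrr _ _ (Nat.le_add_right _ _), hcr]
    simp only [hl, pat, this]
  · refine measurable_to_countable' fun a => ?_
    have := hu (measurableSet_singleton (a : ℕ))
    convert this using 1
    ext w
    simp [Fin.ext_iff]
  · have hset : ∀ w, {a : Fin M | a ≠ ⟨cut (unifPart M) M (F (r n' w) (l w)), cut_lt _ hM _⟩} =
        {a : Fin M | (a : ℕ) ≠ cut (unifPart M) M (F (r n' w) (l w))} := fun w => by
      ext a; simp [Fin.ext_iff]
    simp only [hset]
    refine herr.trans ?_
    have h1 := hFΨ (fun x e => if big e then 0 else 1) fun e => measurable_const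
    have h2 : ∫⁻ w, ENNReal.ofReal (δ (r n' w)) ∂P =
        ENNReal.ofReal ((1 / 2) ^ m) + ∫⁻ w, (if big (l w) then 0 else 1) ∂P := by
      have hpt : ∀ w, ENNReal.ofReal (δ (r n' w)) = ENNReal.ofReal ((1 / 2) ^ m) +
          ∑ e ∈ Finset.range L, ENNReal.ofReal (F (r n' w) (e + 1) - F (r n' w) e) *
            (if big e then 0 else 1) := fun w => by
        simp only [hδ]
        rw [ENNReal.ofReal_add (by positivity) (Finset.sum_nonneg fun e _ => ht0 _ e),
          ENNReal.ofReal_sum_of_nonneg fun e _ => ht0 _ e]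
        congr 1
        refine Finset.sum_congr rfl fun e _ => ?_
        split_ifs <;> simp
      rw [h1, lintegral_congr hpt, lintegral_add_left measurable_const, lintegral_const,
        measure_univ, mul_one]
    have h3 : ∫⁻ w, (if big (l w) then 0 else 1) ∂P ≤ ENNReal.ofReal (ε / (2 * M)) := by
      refine le_trans ?_ hN
      have hpt : ∀ w, (if big (l w) then (0 : ℝ≥0∞) else 1) ≤
          {w | (pat c n N w).card < m}.indicator 1 w := fun w => by
        by_cases hw : (pat c n N w).card < m
        · rw [indicator_of_mem (by exact hw)]
          split_ifs <;> simp
        · rw [if_pos ⟨_, rfl, not_lt.1 hw⟩]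
          exact zero_le
      exact (lintegral_mono hpt).trans (lintegral_indicator_one_le _)
    rw [h2]
    have hM' : (0 : ℝ) < M := by exact_mod_cast hM
    calc (M : ℝ≥0∞) * (ENNReal.ofReal ((1 / 2) ^ m) + ∫⁻ w, (if big (l w) then 0 else 1) ∂P)
        ≤ ENNReal.ofReal M * (ENNReal.ofReal (ε / (2 * M)) + ENNReal.ofReal (ε / (2 * M))) := by
          rw [ENNReal.ofReal_natCast]
          gcongr
      _ = ENNReal.ofReal ε := by
          rw [← ENNReal.ofReal_add (by positivity) (by positivity), ← ENNReal.ofReal_mul hM'.le]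
          congr 1
          field_simp
          norm_num

/-- Sequences of digits with prescribed moduli inherit medial means from a nontrivial chain. -/
theorem medial_tail_of_chain [StandardBorelSpace W] [IsProbabilityMeasure P]
    (hr : ∀ n, Measurable (r n)) (hr0 : ∀ w, r 0 w = w)
    (hc : ∀ n, MeasurableSet (c n)) (hrr : ∀ i j, i ≤ j → ∀ w, r j (r i w) = r j w)
    (hcr : ∀ n w, r n w ∈ c n ↔ w ∈ c n)
    (hhalf : ∀ n U, MeasurableSet U → P (c n ∩ r (n + 1) ⁻¹' U) ≤ 2⁻¹ * P (r (n + 1) ⁻¹' U))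
    (hinf : ∀ᵐ w ∂P, ∃ᶠ n in atTop, w ∈ c n)
    {F : W → W → Prop} (hF : Equivalence F) (hFB : MeasurableSet {p : W × W | F p.1 p.2})
    (hFc : ∀ w, {w' | F w w'}.Countable) (hmed : Medial P F) (hFr : ∀ k w, F w (r k w))
    (M : ℕ → ℕ) [∀ k, NeZero (M k)] : Medial (bern M) (Tail (A := fun k => Fin (M k))) := by
  choose n' hn' κ hκM hinv hunif enc hencm herr using fun (k n : ℕ) =>
    exists_step_pat hr hc hrr hcr hhalf hinf n (M k) (Nat.pos_of_neZero _)
      (show (0 : ℝ) < (1 / 2) ^ k by positivity)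
  let N : ℕ → ℕ := fun k => Nat.rec 0 n' k
  have hmono : Monotone N := monotone_nat_of_le_succ fun k => hn' k (N k)
  have hD : IsDigits P (fun k => r (N k)) M (fun k => κ k (N k)) :=
    ⟨fun k => hr _, hr0, fun j k h w => hrr _ _ (hmono h) w, fun k => hinv k _,
      fun k => hunif k (N k)⟩
  have : ∀ k, IsMarkovKernel (κ k (N k)) := fun k => hκM _ _
  refine hD.medial_tail hF hFB hFc hmed (fun k w => hFr _ w) (fun k => enc k (N k))
    (fun k => hencm _ _) ?_
  refine ne_top_of_le_ne_top ?_ (ENNReal.tsum_le_tsum fun k => herr k (N k))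
  rw [← ENNReal.ofReal_tsum_of_nonneg (fun n => by positivity)
    (summable_geometric_of_lt_one (by norm_num) (by norm_num))]
  exact ENNReal.ofReal_ne_top

end Patterns

/-- From each pair exchanged by an involution one can select, measurably, a point around which the
measure is not larger. -/
theorem exists_light_half {X : Type*} [MeasurableSpace X] [StandardBorelSpace X] {θ : X → X}
    (hθ : Measurable θ) (hθθ : ∀ x, θ (θ x) = x) {Y : Set X} (hY : MeasurableSet Y)
    (ω : Measure X) [IsFiniteMeasure ω] :
    ∃ D : Set X, MeasurableSet D ∧ (∀ x ∈ D, x ∈ Y ∧ θ x ∈ Y ∧ θ x ∉ D) ∧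
      (∀ x ∈ Y, θ x ∈ Y → θ x ≠ x → x ∈ D ∨ θ x ∈ D) ∧
      ∀ V ⊆ D, MeasurableSet V → ω V ≤ ω (θ ⁻¹' V) := by
  obtain ⟨f, hf⟩ := exists_measurableEmbedding_real X
  obtain ⟨Q, hQ, hQ1, hQ2⟩ := hahn_decomposition ω (ω.map θ)
  have hfθ : Measurable fun x => f (θ x) := hf.measurable.comp hθ
  have hQθ : MeasurableSet {x | θ x ∈ Q} := hθ hQ
  set D1 : Set X := {x | x ∈ Y ∧ θ x ∈ Y} ∩ (Qᶜ ∩ {x | θ x ∈ Q}) with hD1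
  set D2 : Set X := {x | x ∈ Y ∧ θ x ∈ Y} ∩ ((Q ∩ {x | θ x ∈ Q}) ∩ {x | f x < f (θ x)}) with hD2
  set D3 : Set X := {x | x ∈ Y ∧ θ x ∈ Y} ∩ ((Qᶜ ∩ {x | θ x ∈ Q}ᶜ) ∩ {x | f x < f (θ x)}) with hD3
  have hYm : MeasurableSet {x | x ∈ Y ∧ θ x ∈ Y} := hY.inter (hθ hY)
  have hlt : MeasurableSet {x | f x < f (θ x)} := measurableSet_lt hf.measurable hfθ
  have m1 : MeasurableSet D1 := hYm.inter (hQ.compl.inter hQθ)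
  have m2 : MeasurableSet D2 := hYm.inter ((hQ.inter hQθ).inter hlt)
  have m3 : MeasurableSet D3 := hYm.inter ((hQ.compl.inter hQθ.compl).inter hlt)
  refine ⟨D1 ∪ (D2 ∪ D3), m1.union (m2.union m3), ?_, ?_, ?_⟩
  · intro x hx
    have hxY : x ∈ Y ∧ θ x ∈ Y := by
      rcases hx with h | h | h <;> exact h.1
    refine ⟨hxY.1, hxY.2, fun hx' => ?_⟩
    have hnlt : ∀ x, f x < f (θ x) → ¬ f (θ x) < f (θ (θ x)) := fun x h => by
      rw [hθθ]; exact not_lt.2 h.le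
    rcases hx with ⟨-, h1, h2⟩ | ⟨-, ⟨h1, h2⟩, h3⟩ | ⟨-, ⟨h1, h2⟩, h3⟩ <;>
    rcases hx' with ⟨-, h1', h2'⟩ | ⟨-, ⟨h1', h2'⟩, h3'⟩ | ⟨-, ⟨h1', h2'⟩, h3'⟩ <;>
    simp only [mem_ofPred_eq, mem_compl_iff, hθθ] at * <;>
    tauto
  · intro x hx hθx hne
    have hfne : f x ≠ f (θ x) := fun h => hne (hf.injective h).symm
    have key : ∀ x, x ∈ Y → θ x ∈ Y → f x < f (θ x) →
        x ∈ D1 ∪ (D2 ∪ D3) ∨ θ x ∈ D1 ∪ (D2 ∪ D3) := by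
      intro x hx hθx hlt
      by_cases h1 : x ∈ Q <;> by_cases h2 : θ x ∈ Q
      · exact Or.inl (Or.inr (Or.inl ⟨⟨hx, hθx⟩, ⟨h1, h2⟩, hlt⟩))
      · exact Or.inr (Or.inl ⟨⟨hθx, by rwa [hθθ]⟩, h2, by rw [mem_ofPred_eq, hθθ]; exact h1⟩)
      · exact Or.inl (Or.inl ⟨⟨hx, hθx⟩, h1, h2⟩)
      · exact Or.inl (Or.inr (Or.inr ⟨⟨hx, hθx⟩, ⟨h1, h2⟩, hlt⟩))
    rcases lt_or_gt_of_ne hfne with h | h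
    · exact key x hx hθx h
    · have := key (θ x) hθx (by rwa [hθθ]) (by rwa [hθθ])
      rw [hθθ] at this
      exact this.symm
  · intro V hV hVm
    have hQc : ∀ V, MeasurableSet V → V ⊆ Qᶜ → ω V ≤ ω (θ ⁻¹' V) := fun V hVm h => by
      have := hQ2 V hVm h
      rwa [Measure.map_apply hθ hVm] at this
    have hQQ : ∀ V, MeasurableSet V → V ⊆ {x | θ x ∈ Q} → ω V ≤ ω (θ ⁻¹' V) := fun V hVm h => by
      have := hQ1 (θ ⁻¹' V) (hθ hVm) fun x hx => by
        have := h hx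
        rwa [mem_ofPred_eq, hθθ] at this
      rw [Measure.map_apply hθ (hθ hVm)] at this
      have e : θ ⁻¹' (θ ⁻¹' V) = V := by ext x; simp only [mem_preimage, hθθ]
      rwa [e] at this
    have s1 := hQc (V ∩ Qᶜ) (hVm.inter hQ.compl) inter_subset_right
    have s2 := hQQ (V ∩ Q) (hVm.inter hQ) fun x hx => by
      rcases hV hx.1 with ⟨-, h1, h2⟩ | ⟨-, ⟨h1, h2⟩, h3⟩ | ⟨-, ⟨h1, h2⟩, h3⟩
      · exact absurd hx.2 h1
      · exact h2
      · exact absurd hx.2 h1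
    calc ω V = ω (V ∩ Q) + ω (V ∩ Qᶜ) := by
          rw [← measure_inter_add_sdiff V hQ, sdiff_eq]
      _ ≤ ω (θ ⁻¹' (V ∩ Q)) + ω (θ ⁻¹' (V ∩ Qᶜ)) := add_le_add s2 s1
      _ = ω (θ ⁻¹' V) := by
          rw [← measure_inter_add_sdiff (θ ⁻¹' V) (hθ hQ), sdiff_eq]; rfl

/-- A chain of retractions inside the classes of a countable Borel equivalence relation. -/
structure IsLeaderChain {X : Type*} [MeasurableSpace X] (μ : Measure X) (θ : ℕ → X → X)
    (r : ℕ → X → X) (D : ℕ → Set X) (T : Set X) : Prop where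
  meas : ∀ n, Measurable (r n)
  measD : ∀ n, MeasurableSet (D n)
  measT : MeasurableSet T
  zero : ∀ x, r 0 x = x
  comp : ∀ i j, i ≤ j → ∀ x, r j (r i x) = r j x
  succ : ∀ n x, (r n x ∈ D n ∧ r (n + 1) x = θ n (r n x)) ∨ (r n x ∉ D n ∧ r (n + 1) x = r n x)
  half : ∀ n U, MeasurableSet U →
    μ (r n ⁻¹' D n ∩ r (n + 1) ⁻¹' U) ≤ 2⁻¹ * μ (r (n + 1) ⁻¹' U)
  inj : ∀ n, ∀ x ∈ T, θ n x ∈ T → θ n x = x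
  infinite : ∀ x, (∃ n, r n x ∈ T) ∨ ∃ᶠ n in atTop, r n x ∈ D n

theorem exists_leaderChain {X : Type*} [MeasurableSpace X] [StandardBorelSpace X]
    {θ : ℕ → X → X} (hθ : ∀ n, Measurable (θ n)) (hθθ : ∀ n x, θ n (θ n x) = x)
    (μ : Measure X) [IsFiniteMeasure μ] : ∃ r D T, IsLeaderChain μ θ r D T := by
  classical
  choose D hD hD1 hD2 hD3 using fun (n : ℕ) (Y : Set X) (hY : MeasurableSet Y) (ω : Measure X)
    (hω : IsFiniteMeasure ω) => exists_light_half (hθ n) (hθθ n) hY ω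
  let St := {s : (X → X) × Set X // Measurable s.1 ∧ MeasurableSet s.2}
  have hfin : ∀ s : St, IsFiniteMeasure (μ.map s.1.1) := fun s => inferInstance
  let DD : ℕ → St → Set X := fun n s => D n s.1.2 s.2.2 (μ.map s.1.1) (hfin s)
  have hDD : ∀ n s, MeasurableSet (DD n s) := fun n s => hD _ _ _ _ _
  let next : ℕ → St → St := fun n s =>
    ⟨(fun x => if s.1.1 x ∈ DD n s then θ n (s.1.1 x) else s.1.1 x, s.1.2 \ DD n s),
      Measurable.ite (s.2.1 (hDD n s)) ((hθ n).comp s.2.1) s.2.1, s.2.2.diff (hDD n s)⟩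
  let S : ℕ → St := fun n => Nat.rec ⟨(id, univ), measurable_id, MeasurableSet.univ⟩ next n
  set r : ℕ → X → X := fun n => (S n).1.1 with hr
  set Y : ℕ → Set X := fun n => (S n).1.2 with hY
  set d : ℕ → Set X := fun n => DD n (S n) with hd
  have hrs : ∀ n x, r (n + 1) x = if r n x ∈ d n then θ n (r n x) else r n x := fun n x => rfl
  have hYs : ∀ n, Y (n + 1) = Y n \ d n := fun n => rfl
  have hd1 : ∀ n, ∀ x ∈ d n, x ∈ Y n ∧ θ n x ∈ Y n ∧ θ n x ∉ d n := fun n => hD1 _ _ _ _ _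
  have hrY : ∀ n x, r n x ∈ Y n := fun n => by
    induction n with
    | zero => exact fun x => mem_univ _
    | succ n ih =>
      intro x
      rw [hrs, hYs]
      split_ifs with h
      · exact ⟨(hd1 n _ h).2.1, (hd1 n _ h).2.2⟩
      · exact ⟨ih x, h⟩
  have hrid : ∀ n, ∀ x ∈ Y n, r n x = x := fun n => by
    induction n with
    | zero => exact fun x _ => rfl
    | succ n ih =>
      intro x hx
      rw [hYs] at hx
      rw [hrs, ih x hx.1, if_neg hx.2]
  have hYa : Antitone Y := antitone_nat_of_succ_le fun n => by rw [hYs]; exact sdiff_subset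
  have hrm : ∀ n, Measurable (r n) := fun n => (S n).2.1
  have hcomp : ∀ i j, i ≤ j → ∀ x, r j (r i x) = r j x := fun i j hij x => by
    induction j, hij using Nat.le_induction with
    | base => exact hrid _ _ (hrY _ _)
    | succ j hij ih => rw [hrs, hrs, ih]
  refine ⟨r, d, ⋂ n, Y n, hrm, fun n => hDD n _, MeasurableSet.iInter fun n => (S n).2.2,
    fun x => rfl, hcomp, fun n x => ?_, fun n U hU => ?_, fun n x hx hx' => ?_, fun x => ?_⟩
  · by_cases h : r n x ∈ d n
    · exact Or.inl ⟨h, by rw [hrs, if_pos h]⟩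
    · exact Or.inr ⟨h, by rw [hrs, if_neg h]⟩
  · have hVm : MeasurableSet (d n ∩ θ n ⁻¹' U) := (hDD n _).inter (hθ n hU)
    have h3 := hD3 n (Y n) (S n).2.2 (μ.map (r n)) (hfin (S n)) (d n ∩ θ n ⁻¹' U)
      inter_subset_left hVm
    rw [Measure.map_apply (hrm n) hVm, Measure.map_apply (hrm n) (hθ n hVm)] at h3
    have e1 : r n ⁻¹' d n ∩ r (n + 1) ⁻¹' U = r n ⁻¹' (d n ∩ θ n ⁻¹' U) := by
      ext x
      simp only [mem_inter_iff, mem_preimage, hrs]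
      constructor
      · rintro ⟨h, h'⟩; rw [if_pos h] at h'; exact ⟨h, h'⟩
      · rintro ⟨h, h'⟩; rw [if_pos h]; exact ⟨h, h'⟩
    rw [e1]
    have hdisj : Disjoint (r n ⁻¹' (d n ∩ θ n ⁻¹' U)) (r n ⁻¹' (θ n ⁻¹' (d n ∩ θ n ⁻¹' U))) := by
      rw [disjoint_left]
      rintro x hx hx'
      exact (hd1 n _ hx.1).2.2 hx'.1
    have hsub : r n ⁻¹' (d n ∩ θ n ⁻¹' U) ∪ r n ⁻¹' (θ n ⁻¹' (d n ∩ θ n ⁻¹' U)) ⊆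
        r (n + 1) ⁻¹' U := by
      rintro x (hx | hx)
      · rw [mem_preimage, hrs, if_pos hx.1]; exact hx.2
      · have h1 : θ n (r n x) ∈ d n := hx.1
        have h2 := (hd1 n _ h1).2.2
        rw [hθθ] at h2
        rw [mem_preimage, hrs, if_neg h2]
        have h3 : θ n (θ n (r n x)) ∈ U := hx.2
        rwa [hθθ] at h3
    have h4 := measure_mono (μ := μ) hsub
    rw [measure_union hdisj (hrm n (hθ n hVm))] at h4
    calc μ (r n ⁻¹' (d n ∩ θ n ⁻¹' U))
        = 2⁻¹ * (μ (r n ⁻¹' (d n ∩ θ n ⁻¹' U)) + μ (r n ⁻¹' (d n ∩ θ n ⁻¹' U))) := by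
          rw [← two_mul, ← mul_assoc, ENNReal.inv_mul_cancel (by simp) (by simp), one_mul]
      _ ≤ 2⁻¹ * μ (r (n + 1) ⁻¹' U) := by
          gcongr
          exact (add_le_add le_rfl h3).trans h4
  · by_contra hne
    have hx1 := mem_iInter.1 hx
    have hx2 := mem_iInter.1 hx'
    rcases hD2 n (Y n) (S n).2.2 (μ.map (r n)) (hfin (S n)) x (hx1 n) (hx2 n) hne with h | h
    · have := hx1 (n + 1); rw [hYs] at this; exact this.2 h
    · have := hx2 (n + 1); rw [hYs] at this; exact this.2 h
  · by_cases h : ∃ᶠ n in atTop, r n x ∈ d n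
    · exact Or.inr h
    · rw [not_frequently] at h
      obtain ⟨n₀, hn₀⟩ := eventually_atTop.1 h
      have hconst : ∀ n, n₀ ≤ n → r n x = r n₀ x := fun n hn => by
        induction n, hn using Nat.le_induction with
        | base => rfl
        | succ n hn ih => rw [hrs, if_neg (hn₀ n hn), ih]
      refine Or.inl ⟨n₀, mem_iInter.2 fun n => ?_⟩
      have := hrY (max n n₀) x
      rw [hconst _ (le_max_right _ _)] at this
      exact hYa (le_max_left _ _) this

namespace IsLeaderChain

variable {X : Type*} [MeasurableSpace X] {μ : Measure X} {θ : ℕ → X → X}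
  {r : ℕ → X → X} {D : ℕ → Set X} {T : Set X}

theorem finite_fibre (h : IsLeaderChain μ θ r D T) (hθθ : ∀ n x, θ n (θ n x) = x) (n : ℕ) (y : X) :
    {x | r n x = y}.Finite := by
  induction n generalizing y with
  | zero => simp only [h.zero]; exact finite_singleton y
  | succ n ih =>
    refine ((ih y).union (ih (θ n y))).subset fun x hx => ?_
    have hx' : r (n + 1) x = y := hx
    rcases h.succ n x with ⟨-, h1⟩ | ⟨-, h1⟩
    · right
      change r n x = _
      rw [← hx', h1, hθθ]
    · left
      change r n x = _
      rw [← hx', h1]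

theorem rel (h : IsLeaderChain μ θ r D T) {E : X → X → Prop} (hE : Equivalence E)
    (hθE : ∀ x y, E x y ↔ ∃ n, θ n x = y) (n : ℕ) (x : X) : E x (r n x) := by
  induction n with
  | zero => rw [h.zero]; exact hE.refl x
  | succ n ih =>
    rcases h.succ n x with ⟨-, h1⟩ | ⟨-, h1⟩ <;> rw [h1]
    · exact hE.trans ih ((hθE _ _).2 ⟨n, rfl⟩)
    · exact ih

end IsLeaderChain

/-- `E` has, almost everywhere, a measurable invariant choice of a point in each class. -/
def Tame {X : Type*} [MeasurableSpace X] (μ : Measure X) (E : X → X → Prop) : Prop :=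
  ∃ (s : X → X) (X0 : Set X), Measurable s ∧ (∀ᵐ x ∂μ, x ∈ X0) ∧ (∀ x ∈ X0, E x (s x)) ∧
    ∀ x ∈ X0, ∀ x' ∈ X0, E x x' → s x = s x'

theorem tame_of_index {X : Type*} [MeasurableSpace X] {μ : Measure X} {E : X → X → Prop}
    {θ : ℕ → X → X} (hθ : ∀ n, Measurable (θ n)) (hθE : ∀ n x, E x (θ n x)) {Q : X → ℕ → Prop}
    (hQ : ∀ i, NullMeasurableSet {x | Q x i} μ) (hex : ∀ᵐ x ∂μ, ∃ i, Q x i)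
    (hcompat : ∀ x x' i i', E x x' → Q x i → Q x' i' → θ i x = θ i' x') : Tame μ E := by
  classical
  choose B hBm hB using fun i => (hQ i).exists_measurable_superset_ae_eq
  have hB' : ∀ i, MeasurableSet (B i) := fun i => (hB i).1
  have hex' : ∀ x, ∃ i, x ∈ B i ∨ x ∉ ⋃ j, B j := fun x => by
    by_cases h : x ∈ ⋃ j, B j
    · obtain ⟨i, hi⟩ := mem_iUnion.1 h
      exact ⟨i, Or.inl hi⟩
    · exact ⟨0, Or.inr h⟩
  have hιm : Measurable fun x => Nat.find (hex' x) := measurable_find hex' fun i =>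
    (hB' i).union (MeasurableSet.iUnion hB').compl
  have hsm : Measurable fun x => θ (Nat.find (hex' x)) x := by
    have h2 : Measurable fun p : ℕ × X => θ p.1 p.2 := measurable_from_prod_countable_right hθ
    exact h2.comp (hιm.prodMk measurable_id)
  refine ⟨fun x => θ (Nat.find (hex' x)) x, {x | (∃ i, Q x i) ∧ ∀ i, x ∈ B i → Q x i}, hsm, ?_,
    fun x _ => hθE _ x, ?_⟩
  · have h2 : ∀ᵐ x ∂μ, ∀ i, x ∈ B i → Q x i := by
      rw [ae_all_iff]; intro i
      filter_upwards [(hB i).2.mem_iff] with x hx h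
      exact hx.1 h
    filter_upwards [hex, h2] with x h h' using ⟨h, h'⟩
  · have key : ∀ x ∈ {x | (∃ i, Q x i) ∧ ∀ i, x ∈ B i → Q x i}, Q x (Nat.find (hex' x)) := by
      rintro x ⟨⟨i, hi⟩, h⟩
      refine h _ ((Nat.find_spec (hex' x)).resolve_right fun hn => hn ?_)
      exact mem_iUnion.2 ⟨i, hBm i hi⟩
    exact fun x hx x' hx' hE => hcompat x x' _ _ hE (key x hx) (key x' hx')

theorem IsMean.finite_atoms {α : Type*} {m : Set α → ℝ} (h : IsMean m) {ε : ℝ} (hε : 0 < ε) :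
    {y | ε ≤ m {y}}.Finite := by
  by_contra hinf
  obtain ⟨n, hn⟩ := exists_nat_gt (1 / ε)
  obtain ⟨t, ht, htn⟩ := (Set.not_finite.1 hinf : {y | ε ≤ m {y}}.Infinite).exists_subset_card_eq n
  have h1 : ∀ s : Finset α, m s = ∑ y ∈ s, m {y} := fun s => by
    classical
    induction s using Finset.induction_on with
    | empty => simp [h.empty]
    | insert a s ha ih =>
      rw [Finset.sum_insert ha, Finset.coe_insert, insert_eq, h.add _ _ (by simpa using ha), ih]
  have h2 : (n : ℝ) * ε ≤ m t := by
    rw [h1, ← htn, ← nsmul_eq_mul]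
    exact Finset.card_nsmul_le_sum _ _ _ fun y hy => ht hy
  have h3 := (h.mem_Icc (t : Set α)).2
  rw [div_lt_iff₀ hε] at hn
  linarith

section Dichotomy

variable {X : Type*} [MeasurableSpace X] [StandardBorelSpace X] {E : X → X → Prop}
  {θ : ℕ → X → X} {ν : X → Set X → ℝ}

theorem nu_outside_class (hν : ∀ x, IsMean (ν x)) (hνE : ∀ x, ν x {y | E x y} = 1) {x y : X}
    (h : 0 < ν x {y}) : E x y := by
  by_contra hn
  have h1 := (hν x).add {y | E x y} {y} (by simpa using hn)
  have h2 := ((hν x).mem_Icc ({y | E x y} ∪ {y})).2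
  rw [hνE] at h1
  linarith

theorem exists_extremal_atom (hν : ∀ x, IsMean (ν x)) (f : X → ℝ) {x y : X} (h : 0 < ν x {y}) :
    ∃ y, 0 < ν x {y} ∧ ∀ y', ν x {y'} < ν x {y} ∨ (ν x {y'} = ν x {y} ∧ f y ≤ f y') := by
  obtain ⟨z, hz, hzmax⟩ := ((hν x).finite_atoms h).exists_maximalFor (fun z => ν x {z}) _
    ⟨y, show ν x {y} ≤ ν x {y} from le_rfl⟩
  have hz' : ν x {y} ≤ ν x {z} := hz
  have hmax : ∀ y', ν x {y'} ≤ ν x {z} := fun y' => by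
    by_contra hlt
    rw [not_le] at hlt
    exact absurd (hzmax (show ν x {y} ≤ ν x {y'} from hz'.trans hlt.le) hlt.le) (not_le.2 hlt)
  have hpos : 0 < ν x {z} := h.trans_le hz'
  obtain ⟨u, hu, humin⟩ := (((hν x).finite_atoms hpos).subset
    (show {y' | ν x {y'} = ν x {z}} ⊆ _ from fun y' hy' => (show ν x {z} ≤ ν x {y'} from
      (show ν x {y'} = ν x {z} from hy').ge))).exists_minimalFor f _ ⟨z, rfl⟩
  have hu' : ν x {u} = ν x {z} := hu
  refine ⟨u, hu' ▸ hpos, fun y' => ?_⟩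
  rw [hu']
  rcases (hmax y').lt_or_eq with h1 | h1
  · exact Or.inl h1
  · refine Or.inr ⟨h1, ?_⟩
    by_contra hlt
    rw [not_le] at hlt
    exact absurd (humin h1 hlt.le) (not_le.2 hlt)

/-- The mean on times obtained by pushing a mean on the class forward to exhaustion times. -/
theorem IsLeaderChain.medial (hE : Equivalence E) (hB : MeasurableSet {p : X × X | E p.1 p.2})
    (hθ : ∀ n, Measurable (θ n)) (hθθ : ∀ n x, θ n (θ n x) = x)
    (hθE : ∀ x y, E x y ↔ ∃ n, θ n x = y) (hν : ∀ x, IsMean (ν x))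
    (hνE : ∀ x, ν x {y | E x y} = 1) (hνinv : ∀ x y, E x y → ν x = ν y)
    {P μ : Measure X} (hνm : ∀ A : Set (X × X), MeasurableSet A →
      AEMeasurable (fun x => ν x {y | (x, y) ∈ A}) P)
    {r : ℕ → X → X} {D : ℕ → Set X} {T : Set X} (h : IsLeaderChain μ θ r D T)
    (hat : ∀ᵐ x ∂P, ∀ y, ν x {y} = 0) : Medial P fun x x' => ∃ n, r n x = r n x' := by
  classical
  have hrel := h.rel hE hθE
  have hup : ∀ i j x x', i ≤ j → r i x = r i x' → r j x = r j x' := fun i j x x' hij e => by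
    rw [← h.comp i j hij x, e, h.comp i j hij]
  have hFeq : Equivalence fun x x' => ∃ n, r n x = r n x' :=
    ⟨fun w => ⟨0, rfl⟩, fun ⟨n, h⟩ => ⟨n, h.symm⟩, fun {w w' w''} ⟨n, e⟩ ⟨m, e'⟩ =>
      ⟨max n m, (hup n _ _ _ (le_max_left _ _) e).trans (hup m _ _ _ (le_max_right _ _) e')⟩⟩
  have hFE : ∀ x x', (∃ n, r n x = r n x') → E x x' := fun x x' ⟨n, e⟩ =>
    hE.trans (hrel n x) (e ▸ hE.symm (hrel n x'))
  set B : ℕ → X → X → Prop := fun n x y => ∃ i, i ≤ n ∧ r n (θ i y) = r n x with hBdef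
  have hBm : ∀ n, MeasurableSet {p : X × X | B n p.1 p.2} := fun n => by
    simp only [hBdef, ofPred_exists]
    refine MeasurableSet.iUnion fun i => (MeasurableSet.const _).inter ?_
    exact measurableSet_eq_fun ((h.meas n).comp ((hθ i).comp measurable_snd))
      ((h.meas n).comp measurable_fst)
  have hBmono : ∀ n m x y, n ≤ m → B n x y → B m x y := fun n m x y hnm ⟨i, hi, e⟩ =>
    ⟨i, hi.trans hnm, hup n m _ _ hnm e⟩
  have hBfin : ∀ n x, {y | B n x y}.Finite := fun n x => by
    have : {y | B n x y} ⊆ ⋃ i ∈ Set.Iic n, (θ i) ⁻¹' {u | r n u = r n x} := by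
      rintro y ⟨i, hi, e⟩
      exact mem_biUnion hi e
    refine ((finite_Iic n).biUnion fun i _ => ?_).subset this
    exact (h.finite_fibre hθθ n _).preimage
      (Function.LeftInverse.injective (hθθ i)).injOn
  have hex : ∀ p : X × X, ∃ n, B n p.1 p.2 ∨ ¬ E p.1 p.2 := fun p => by
    by_cases hp : E p.1 p.2
    · obtain ⟨i, hi⟩ := (hθE _ _).1 (hE.symm hp)
      exact ⟨i, Or.inl ⟨i, le_rfl, by rw [hi]⟩⟩
    · exact ⟨0, Or.inr hp⟩
  set ℓ : X × X → ℕ := fun p => Nat.find (hex p) with hℓ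
  have hℓm : Measurable ℓ := measurable_find hex fun n => (hBm n).union hB.compl
  have hℓB : ∀ x y, E x y → B (ℓ (x, y)) x y := fun x y hxy =>
    (Nat.find_spec (hex (x, y))).resolve_right (not_not.2 hxy)
  have hℓfin : ∀ x n, {y | E x y ∧ ℓ (x, y) ≤ n}.Finite := fun x n =>
    (hBfin n x).subset fun y hy => hBmono _ _ _ _ hy.2 (hℓB x y hy.1)
  have hclass : ∀ x A B, (∀ y, E x y → (y ∈ A ↔ y ∈ B)) → ν x A = ν x B := fun x A B hAB => by
    refine (hν x).eq_of_symmDiff_null (C := {y | E x y}ᶜ) ?_ ?_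
    · have := (hν x).add {y | E x y} {y | E x y}ᶜ disjoint_compl_right
      rw [union_compl_self, (hν x).univ, hνE] at this
      linarith
    · intro y hy
      exact hAB y (not_not.1 hy)
  obtain ⟨m0, hm0, hm0'⟩ := exists_nonprincipal_mean
  refine medial_of_ae hFeq {x | ∀ y, ν x {y} = 0} hat
    (fun x S => if ∀ y, ν x {y} = 0 then ν x {y | ℓ (x, y) ∈ S} else m0 S) (fun x => ?_)
    (fun x n => ?_) (fun x hx x' hx' hxx' => ?_) fun S hS => ?_
  · by_cases hx : ∀ y, ν x {y} = 0
    · simp only [if_pos hx]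
      refine ⟨fun A => (hν x).nonneg _, (hν x).univ, fun A B hAB => ?_⟩
      rw [← (hν x).add]
      · rfl
      · exact disjoint_left.2 fun y hy hy' => disjoint_left.1 hAB hy hy'
    · simp only [if_neg hx]
      exact hm0
  · by_cases hx : ∀ y, ν x {y} = 0
    · simp only [if_pos hx]
      rw [hclass x _ {y | E x y ∧ ℓ (x, y) = n} fun y hy => by simp [hy]]
      refine (hν x).finite_null hx ((hℓfin x n).subset fun y hy => ⟨hy.1, hy.2.le⟩)
    · simp only [if_neg hx]
      exact hm0' n
  · funext S
    simp only [if_pos (show ∀ y, ν x {y} = 0 from hx), if_pos (show ∀ y, ν x' {y} = 0 from hx')]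
    have hEx := hFE x x' hxx'
    rw [← hνinv x x' hEx]
    obtain ⟨n, hn⟩ := hxx'
    have hBeq : ∀ k, n ≤ k → ∀ y, B k x y ↔ B k x' y := fun k hk y => by
      simp only [hBdef, hup n k x x' hk hn]
    refine (hν x).eq_of_symmDiff_null (C := {y | B n x y} ∪ {y | E x y}ᶜ) ?_ ?_
    · rw [hclass x _ {y | E x y ∧ B n x y} fun y hy => by simp [hy]]
      exact (hν x).finite_null hx ((hBfin n x).subset fun y hy => hy.2)
    · intro y hy
      simp only [mem_union, not_or, mem_ofPred_eq, mem_compl_iff, not_not] at hy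
      have hEx'y : E x' y := hE.trans (hE.symm hEx) hy.2
      have : ℓ (x, y) = ℓ (x', y) := by
        refine Nat.find_congr' fun {k} => ?_
        simp only [hy.2, hEx'y, not_true, or_false]
        rcases le_total n k with hk | hk
        · exact hBeq k hk y
        · exact ⟨fun hb => absurd (hBmono k n x y hk hb) hy.1,
            fun hb => absurd ((hBeq n le_rfl y).2 (hBmono k n x' y hk hb)) hy.1⟩
      rw [mem_ofPred_eq, mem_ofPred_eq, this]
  · have hA : MeasurableSet {p : X × X | (p.1, ℓ p) ∈ S} :=
      (measurable_fst.prodMk hℓm) hS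
    refine (hνm _ hA).congr ?_
    filter_upwards [hat] with x hx
    rw [if_pos hx]

/-- Either almost every class carries a measurably chosen point, or digit sequences carry medial
means. -/
theorem tame_or_medial_tail (hE : Equivalence E) (hB : MeasurableSet {p : X × X | E p.1 p.2})
    (hc : ∀ x, {y | E x y}.Countable) (μ : Measure X) [IsFiniteMeasure μ] (h : MuAmenable μ E) :
    Tame μ E ∨ ∀ (M : ℕ → ℕ) [∀ k, NeZero (M k)],
      Medial (bern M) (Tail (A := fun k => Fin (M k))) := by
  classical
  obtain ⟨θ, hθ, hθθ, hθE⟩ := exists_involutions hE hB hc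
  obtain ⟨ν, h1, h2, h3, hνE, hνinv, hνm⟩ := h
  have hν : ∀ x, IsMean (ν x) := fun x => ⟨h1 x, h2 x, h3 x⟩
  have hθE' : ∀ n x, E x (θ n x) := fun n x => (hθE _ _).2 ⟨n, rfl⟩
  have ham : ∀ i, AEMeasurable (fun x => ν x {θ i x}) μ := fun i => by
    have := hνm {p | p.2 = θ i p.1}
      (measurableSet_eq_fun measurable_snd ((hθ i).comp measurable_fst))
    exact this
  set At : Set X := {x | ∃ i, 0 < ν x {θ i x}} with hAt
  have hAtn : NullMeasurableSet At μ := by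
    rw [hAt, ofPred_exists]
    exact NullMeasurableSet.iUnion fun i => nullMeasurableSet_lt aemeasurable_const (ham i)
  have hAt0 : ∀ x, x ∉ At → ∀ y, ν x {y} = 0 := fun x hx y => by
    by_contra hne
    have hpos : 0 < ν x {y} := lt_of_le_of_ne (h1 x _) (Ne.symm hne)
    obtain ⟨i, hi⟩ := (hθE _ _).1 (nu_outside_class hν hνE hpos)
    exact hx ⟨i, hi.symm ▸ hpos⟩
  have hAtinv : ∀ x x', E x x' → x ∈ At → x' ∈ At := fun x x' hxx' ⟨i, hi⟩ => by
    by_contra hn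
    have := hAt0 x' hn (θ i x)
    rw [← hνinv x x' hxx'] at this
    exact hi.ne' this
  set N : Set X := toMeasurable μ At with hN
  have hNm : MeasurableSet N := measurableSet_toMeasurable μ At
  have hNAt : ∀ᵐ x ∂μ, x ∈ N ↔ x ∈ At := hAtn.toMeasurable_ae_eq.mem_iff
  set μ0 := μ.restrict Nᶜ with hμ0
  obtain ⟨r, D, T, hch⟩ := exists_leaderChain hθ hθθ μ0
  have hrel := hch.rel hE hθE
  set C : Set X := {x | ∀ i, θ i x ∉ T} with hC
  have hCm : MeasurableSet C := by
    rw [hC, ofPred_forall]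
    exact MeasurableSet.iInter fun i => (hθ i hch.measT).compl
  have hCT : ∀ x, x ∈ C ↔ ∀ y, E x y → y ∉ T := fun x =>
    ⟨fun hx y hy => by obtain ⟨i, rfl⟩ := (hθE _ _).1 hy; exact hx i, fun hx i => hx _ (hθE' i x)⟩
  have hCinv : ∀ x x', E x x' → (x ∈ C ↔ x' ∈ C) := fun x x' hxx' => by
    rw [hCT, hCT]
    exact ⟨fun h y hy => h y (hE.trans hxx' hy), fun h y hy => h y (hE.trans (hE.symm hxx') hy)⟩
  by_cases hC0 : μ0 C = 0
  · left
    obtain ⟨f, hf⟩ := exists_measurableEmbedding_real X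
    refine tame_of_index (θ := θ) (Q := fun x i => (x ∈ At ∧ (0 < ν x {θ i x} ∧ ∀ j,
      ν x {θ j x} < ν x {θ i x} ∨ (ν x {θ j x} = ν x {θ i x} ∧ f (θ i x) ≤ f (θ j x)))) ∨
      (x ∉ At ∧ θ i x ∈ T)) hθ hθE' (fun i => ?_) ?_ ?_
    · refine NullMeasurableSet.union (hAtn.inter (NullMeasurableSet.inter
        (nullMeasurableSet_lt aemeasurable_const (ham i)) ?_))
        (hAtn.compl.inter (hθ i hch.measT).nullMeasurableSet)
      have : {x | ∀ j, ν x {θ j x} < ν x {θ i x} ∨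
          (ν x {θ j x} = ν x {θ i x} ∧ f (θ i x) ≤ f (θ j x))} = ⋂ j,
          ({x | ν x {θ j x} < ν x {θ i x}} ∪ ({x | ν x {θ j x} = ν x {θ i x}} ∩
            {x | f (θ i x) ≤ f (θ j x)})) := by
        ext x; simp only [mem_ofPred_eq, mem_iInter, mem_union, mem_inter_iff]
      change NullMeasurableSet {x | ∀ j, _} μ
      rw [this]
      refine NullMeasurableSet.iInter fun j => (nullMeasurableSet_lt (ham j) (ham i)).union
        ((nullMeasurableSet_eq_fun (ham j) (ham i)).inter ?_)
      exact (measurableSet_le (hf.measurable.comp (hθ i))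
        (hf.measurable.comp (hθ j))).nullMeasurableSet
    · have hC' : ∀ᵐ x ∂μ, x ∈ Nᶜ → x ∉ C := by
        rw [← ae_restrict_iff' hNm.compl]
        exact measure_eq_zero_iff_ae_notMem.1 hC0
      filter_upwards [hC', hNAt] with x hx hx'
      by_cases hxA : x ∈ At
      · obtain ⟨i, hi⟩ := id hxA
        obtain ⟨y, hy, hymax⟩ := exists_extremal_atom hν f hi
        obtain ⟨j, rfl⟩ := (hθE _ _).1 (nu_outside_class hν hνE hy)
        exact ⟨j, Or.inl ⟨hxA, hy, fun k => hymax _⟩⟩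
      · have hxC := hx fun h => hxA (hx'.1 h)
        simp only [hC, mem_ofPred_eq, not_forall, not_not] at hxC
        obtain ⟨i, hi⟩ := hxC
        exact ⟨i, Or.inr ⟨hxA, hi⟩⟩
    · intro x x' i i' hxx' hQ hQ'
      have hrel2 : ∀ i i', E (θ i x) (θ i' x') := fun i i' =>
        hE.trans (hE.symm (hθE' i x)) (hE.trans hxx' (hθE' i' x'))
      rcases hQ with ⟨hA, hp, hm⟩ | ⟨hA, hT⟩ <;> rcases hQ' with ⟨hA', hp', hm'⟩ | ⟨hA', hT'⟩
      · obtain ⟨k, hk⟩ := (hθE x (θ i' x')).1 (hE.trans hxx' (hθE' _ _))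
        obtain ⟨k', hk'⟩ := (hθE x' (θ i x)).1 (hE.trans (hE.symm hxx') (hθE' _ _))
        have a1 := hm k
        have a2 := hm' k'
        rw [hk] at a1
        rw [hk', ← hνinv x x' hxx'] at a2
        refine hf.injective (le_antisymm ?_ ?_)
        · rcases a1 with a1 | a1
          · rcases a2 with a2 | a2
            · exact absurd a1 (not_lt.2 a2.le)
            · exact absurd a1 (not_lt.2 a2.1.le)
          · exact a1.2
        · rcases a2 with a2 | a2
          · rcases a1 with a1 | a1
            · exact absurd a1 (not_lt.2 a2.le)
            · exact absurd a2 (not_lt.2 a1.1.le)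
          · exact a2.2
      · exact absurd (hAtinv _ _ hxx' hA) hA'
      · exact absurd (hAtinv _ _ (hE.symm hxx') hA') hA
      · obtain ⟨k, hk⟩ := (hθE _ _).1 (hrel2 i i')
        rw [← hk]
        exact (hch.inj k _ hT (hk ▸ hT')).symm
  · right
    intro M _
    have hP : IsProbabilityMeasure (μ0[|C]) := cond_isProbabilityMeasure hC0
    have hPac : μ0[|C] ≪ μ := (cond_absolutelyContinuous).trans Measure.absolutelyContinuous_restrict
    have hPC : ∀ᵐ x ∂μ0[|C], x ∈ C := ae_cond_mem hCm
    have hPN : ∀ᵐ x ∂μ0[|C], x ∈ Nᶜ := cond_absolutelyContinuous.ae_le (ae_restrict_mem hNm.compl)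
    have hup : ∀ i j x x', i ≤ j → r i x = r i x' → r j x = r j x' := fun i j x x' hij e => by
      rw [← hch.comp i j hij x, e, hch.comp i j hij]
    have hmed := hch.medial hE hB hθ hθθ hθE hν hνE hνinv (P := μ0[|C])
      (fun A hA => (hνm A hA).mono_ac hPac) (by
        filter_upwards [hPN] with x hx
        exact hAt0 x fun hxA => hx (subset_toMeasurable μ At hxA))
    refine medial_tail_of_chain (P := μ0[|C]) (r := r) (c := fun n => r n ⁻¹' D n)
      hch.meas hch.zero (fun n => hch.meas n (hch.measD n)) hch.comp (fun n w => ?_)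
      (fun n U hU => ?_) ?_ ?_ ?_ (fun w => ?_) hmed (fun k w => ⟨k, (hch.comp k k le_rfl w).symm⟩) M
    · rw [mem_preimage, hch.comp n n le_rfl]; rfl
    · rw [cond_apply hCm, cond_apply hCm]
      have e1 : C ∩ r (n + 1) ⁻¹' U = r (n + 1) ⁻¹' (U ∩ C) := by
        ext x
        simp only [mem_inter_iff, mem_preimage, ← hCinv x _ (hrel (n + 1) x)]
        exact and_comm
      have e2 : C ∩ (r n ⁻¹' D n ∩ r (n + 1) ⁻¹' U) = r n ⁻¹' D n ∩ r (n + 1) ⁻¹' (U ∩ C) := by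
        rw [← e1]; ext x; simp only [mem_inter_iff]; tauto
      rw [e1, e2, mul_left_comm]
      gcongr
      exact hch.half n _ (hU.inter hCm)
    · filter_upwards [hPC] with x hx
      refine (hch.infinite x).resolve_left ?_
      rintro ⟨n, hn⟩
      exact (hCT x).1 hx _ (hrel n x) hn
    · exact ⟨fun w => ⟨0, rfl⟩, fun ⟨n, h⟩ => ⟨n, h.symm⟩, fun {w w' w''} ⟨n, e⟩ ⟨m, e'⟩ =>
        ⟨max n m, (hup n _ _ _ (le_max_left _ _) e).trans (hup m _ _ _ (le_max_right _ _) e')⟩⟩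
    · rw [ofPred_exists]
      exact MeasurableSet.iUnion fun n => measurableSet_eq_fun ((hch.meas n).comp measurable_fst)
        ((hch.meas n).comp measurable_snd)
    · rw [ofPred_exists]
      refine countable_iUnion fun n => ?_
      refine ((hch.finite_fibre hθθ n (r n w)).countable).mono fun w' hw' => ?_
      exact (show r n w = r n w' from hw').symm

end Dichotomy

/-- Continuous functionals on `L¹` of a finite measure are given by bounded measurable functions. -/
theorem exists_bounded_density {Z : Type*} [MeasurableSpace Z] (M : Measure Z) [IsFiniteMeasure M]
    (ℓ : Lp ℝ 1 M →L[ℝ] ℝ) :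
    ∃ f : Z → ℝ, Measurable f ∧ (∀ z, |f z| ≤ ‖ℓ‖) ∧
      ∀ (g : Z → ℝ) (hg : Integrable g M), ℓ (hg.toL1 g) = ∫ z, f z * g z ∂M := by
  classical
  let B : ℝ →L[ℝ] ℝ →L[ℝ] ℝ := ContinuousLinearMap.mul ℝ ℝ
  let one : Lp ℝ 2 M := (memLp_const (1 : ℝ)).toLp
  let ι : Lp ℝ 2 M →L[ℝ] Lp ℝ 1 M := B.holderL M 2 2 1 one
  let f0 : Lp ℝ 2 M := (InnerProductSpace.toDual ℝ (Lp ℝ 2 M)).symm (ℓ.comp ι)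
  have hf0 : ∀ g : Lp ℝ 2 M, ℓ (ι g) = inner ℝ f0 g := fun g => by
    rw [InnerProductSpace.toDual_symm_apply]; rfl
  have hf0int : Integrable f0 M := (Lp.memLp f0).integrable (by norm_num)
  have hset : ∀ (s : Set Z) (hs : MeasurableSet s),
      ℓ (indicatorConstLp 1 hs (measure_ne_top M s) (1 : ℝ)) = ∫ z in s, f0 z ∂M := fun s hs => by
    have h1 : ι (indicatorConstLp 2 hs (measure_ne_top M s) (1 : ℝ)) =
        indicatorConstLp 1 hs (measure_ne_top M s) (1 : ℝ) := by
      refine Lp.ext ?_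
      have a1 := B.coeFn_holder (r := 1) one (indicatorConstLp 2 hs (measure_ne_top M s) (1 : ℝ))
      filter_upwards [a1, (memLp_const (μ := M) (p := 2) (1 : ℝ)).coeFn_toLp,
        indicatorConstLp_coeFn (p := 2) (hs := hs) (hμs := measure_ne_top M s) (c := (1 : ℝ)),
        indicatorConstLp_coeFn (p := 1) (hs := hs) (hμs := measure_ne_top M s) (c := (1 : ℝ))]
        with z b1 b2 b3 b4
      have b1' : (ι (indicatorConstLp 2 hs (measure_ne_top M s) (1 : ℝ))) z =
        one z * (indicatorConstLp 2 hs (measure_ne_top M s) (1 : ℝ) : Lp ℝ 2 M) z := b1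
      have b2' : one z = 1 := b2
      rw [b1', b4, b3, b2', one_mul]
    rw [← h1, hf0, real_inner_comm, L2.inner_indicatorConstLp_one]
  have hnorm : ∀ (s : Set Z), MeasurableSet s → |∫ z in s, f0 z ∂M| ≤ ‖ℓ‖ * M.real s :=
    fun s hs => by
      rw [← hset s hs, ← Real.norm_eq_abs]
      refine (ℓ.le_opNorm _).trans (mul_le_mul_of_nonneg_left ?_ (norm_nonneg _))
      rw [norm_indicatorConstLp one_ne_zero ENNReal.one_ne_top]
      simp
  have hle : f0 ≤ᵐ[M] fun _ => ‖ℓ‖ := by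
    refine ae_le_of_forall_setIntegral_le hf0int (integrable_const _) fun s hs _ => ?_
    rw [setIntegral_const, smul_eq_mul, mul_comm]
    exact (abs_le.1 (hnorm s hs)).2
  have hge : (fun _ => -‖ℓ‖) ≤ᵐ[M] f0 := by
    refine ae_le_of_forall_setIntegral_le (integrable_const _) hf0int fun s hs _ => ?_
    rw [setIntegral_const, smul_eq_mul, mul_neg, mul_comm]
    exact (abs_le.1 (hnorm s hs)).1
  let f1 : Z → ℝ := (Lp.aestronglyMeasurable f0).mk f0
  have hf1m : Measurable f1 := (Lp.aestronglyMeasurable f0).measurable_mk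
  have hf1 : f0 =ᵐ[M] f1 := (Lp.aestronglyMeasurable f0).ae_eq_mk
  let f : Z → ℝ := fun z => max (-‖ℓ‖) (min (f1 z) ‖ℓ‖)
  have hff : f0 =ᵐ[M] f := by
    filter_upwards [hf1, hle, hge] with z h1 h2 h3
    have h2' : f0 z ≤ ‖ℓ‖ := h2
    have h3' : -‖ℓ‖ ≤ f0 z := h3
    rw [h1] at h2' h3' ⊢
    simp only [f, min_eq_left h2', max_eq_right h3']
  have hfm : Measurable f := measurable_const.max (hf1m.min measurable_const)
  have hfb : ∀ z, |f z| ≤ ‖ℓ‖ := fun z => abs_le.2 ⟨le_max_left _ _,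
    max_le ((neg_nonpos.2 (norm_nonneg _)).trans (norm_nonneg _)) (min_le_right _ _)⟩
  have hfi : ∀ g : Z → ℝ, Integrable g M → Integrable (fun z => f z * g z) M := fun g hg =>
    hg.bdd_mul hfm.aestronglyMeasurable (Eventually.of_forall hfb)
  refine ⟨f, hfm, hfb, fun g hg => ?_⟩
  have key : ∀ ⦃g : Z → ℝ⦄, Integrable g M →
      ∀ hg : Integrable g M, ℓ (hg.toL1 g) = ∫ z, f z * g z ∂M := by
    refine Integrable.induction (P := fun g => ∀ hg : Integrable g M,
      ℓ (hg.toL1 g) = ∫ z, f z * g z ∂M) ?_ ?_ ?_ ?_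
    · intro c s hs _ hg
      have e : hg.toL1 _ = c • indicatorConstLp 1 hs (measure_ne_top M s) (1 : ℝ) := by
        refine Lp.ext ?_
        filter_upwards [hg.coeFn_toL1, Lp.coeFn_smul c (indicatorConstLp 1 hs
          (measure_ne_top M s) (1 : ℝ)), indicatorConstLp_coeFn (p := 1) (hs := hs)
          (hμs := measure_ne_top M s) (c := (1 : ℝ))] with z h1 h2 h3
        rw [h1, h2, Pi.smul_apply, h3]
        by_cases hz : z ∈ s <;> simp [hz]
      rw [e, map_smul, hset s hs, ← integral_indicator hs, smul_eq_mul, ← integral_const_mul]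
      refine integral_congr_ae ?_
      filter_upwards [hff] with z hz
      by_cases h : z ∈ s <;> simp [h, hz, mul_comm]
    · intro g g' _ hg hg' h1 h2 hgg
      have e : hgg.toL1 _ = hg.toL1 g + hg'.toL1 g' := Integrable.toL1_add g g' hg hg'
      rw [e, map_add, h1 hg, h2 hg', ← integral_add (hfi g hg) (hfi g' hg')]
      simp only [Pi.add_apply, mul_add]
    · have e : {g : Lp ℝ 1 M | ∀ hg : Integrable g M, ℓ (hg.toL1 g) = ∫ z, f z * g z ∂M} =
          {g : Lp ℝ 1 M | ℓ g = ∫ z, f z * g z ∂M} := by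
        ext g
        simp only [mem_ofPred_eq, Integrable.toL1_coeFn]
        exact ⟨fun h => h (L1.integrable_coeFn g), fun h _ => h⟩
      rw [e]
      refine isClosed_eq ℓ.continuous ?_
      let ftop : Lp ℝ ∞ M := (memLp_top_of_bound hfm.aestronglyMeasurable ‖ℓ‖
        (Eventually.of_forall hfb)).toLp
      have hc : Continuous fun g : Lp ℝ 1 M => L1.integral (B.holderL M ∞ 1 1 ftop g) :=
        L1.continuous_integral.comp (B.holderL M ∞ 1 1 ftop).continuous
      refine hc.congr fun g => ?_
      rw [L1.integral_eq_integral]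
      refine integral_congr_ae ?_
      filter_upwards [B.coeFn_holder (r := 1) ftop g, (memLp_top_of_bound
        hfm.aestronglyMeasurable ‖ℓ‖ (Eventually.of_forall hfb)).coeFn_toLp] with z h1 h2
      have h1' : (B.holderL M ∞ 1 1 ftop g) z = ftop z * g z := h1
      rw [h1']
      exact congrArg (· * g z) h2
    · intro g g' hgg hg h hg'
      rw [← (Integrable.toL1_eq_toL1_iff g g' hg hg').2 hgg, h hg]
      refine integral_congr_ae ?_
      filter_upwards [hgg] with z hz
      rw [hz]
  exact key hg hg

section QuasiInvariant

variable {X : Type*} [MeasurableSpace X] [StandardBorelSpace X] {E : X → X → Prop}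
  {θ : ℕ → X → X}

/-- A finite quasi-invariant measure dominating `μ`, for which the relation is still amenable. -/
theorem exists_quasiInvariant (hE : Equivalence E) (hθ : ∀ n, Measurable (θ n))
    (hθθ : ∀ n x, θ n (θ n x) = x) (hθE : ∀ x y, E x y ↔ ∃ n, θ n x = y)
    (μ : Measure X) [SFinite μ] (h : MuAmenable μ E) :
    ∃ μ' : Measure X, IsFiniteMeasure μ' ∧ μ ≪ μ' ∧ (∀ n, μ'.map (θ n) ≪ μ') ∧
      MuAmenable μ' E := by
  set σ : Measure X := Measure.sum fun i => μ.map (θ i) with hσ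
  have hnull : ∀ A, MeasurableSet A → (σ A = 0 ↔ ∀ i, μ (θ i ⁻¹' A) = 0) := fun A hA => by
    rw [hσ, Measure.sum_apply _ hA, ENNReal.tsum_eq_zero]
    simp only [Measure.map_apply (hθ _) hA]
  have hmod : σ.toFinite ≪ σ := toFinite_absolutelyContinuous σ
  have hdom : σ ≪ σ.toFinite := absolutelyContinuous_toFinite σ
  have hall : ∀ A, MeasurableSet A → σ A = 0 → ∀ᵐ x ∂μ, ∀ y, E x y → y ∉ A := fun A hA h0 => by
    have : ∀ i, ∀ᵐ x ∂μ, θ i x ∉ A := fun i => measure_eq_zero_iff_ae_notMem.1 ((hnull A hA).1 h0 i)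
    filter_upwards [ae_all_iff.2 this] with x hx y hy
    obtain ⟨i, rfl⟩ := (hθE x y).1 hy
    exact hx i
  refine ⟨σ.toFinite, inferInstance, (Measure.AbsolutelyContinuous.mk fun A hA h0 => ?_).trans hdom,
    fun n => ?_, ?_⟩
  · refine measure_eq_zero_iff_ae_notMem.2 ?_
    filter_upwards [hall A hA h0] with x hx
    exact hx x (hE.refl x)
  · refine Measure.AbsolutelyContinuous.mk fun A hA h0 => ?_
    rw [Measure.map_apply (hθ n) hA]
    refine hmod ((hnull _ (hθ n hA)).2 fun i => measure_eq_zero_iff_ae_notMem.2 ?_)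
    filter_upwards [hall A hA (hdom h0)] with x hx
    exact hx _ (hE.trans ((hθE _ _).2 ⟨i, rfl⟩) ((hθE _ _).2 ⟨n, rfl⟩))
  · obtain ⟨ν, h1, h2, h3, h4, h5, h6⟩ := h
    refine ⟨ν, h1, h2, h3, h4, h5, fun A hA => AEMeasurable.mono_ac ?_ hmod⟩
    refine aemeasurable_sum_measure_iff.2 fun i => ?_
    let e : X ≃ᵐ X := ⟨⟨θ i, θ i, hθθ i, hθθ i⟩, hθ i, hθ i⟩
    have he : MeasurableEmbedding (θ i) := e.measurableEmbedding
    rw [he.aemeasurable_map_iff]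
    have := h6 {p | (θ i p.1, p.2) ∈ A}
      ((((hθ i).comp measurable_fst).prodMk measurable_snd) hA)
    refine this.congr (Eventually.of_forall fun x => ?_)
    change ν x {y | (θ i x, y) ∈ A} = ν (θ i x) {y | (θ i x, y) ∈ A}
    rw [h5 x (θ i x) ((hθE _ _).2 ⟨i, rfl⟩)]

end QuasiInvariant

section ClassKernel

variable {X : Type*} [MeasurableSpace X] [StandardBorelSpace X] {E : X → X → Prop}
  {θ : ℕ → X → X}

/-- A Markov kernel charging every point of the class. -/
theorem exists_class_kernel (hθ : ∀ n, Measurable (θ n)) (hθE : ∀ x y, E x y ↔ ∃ n, θ n x = y) :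
    ∃ κ : Kernel X X, IsMarkovKernel κ ∧ ∀ x y, E x y → κ x {y} ≠ 0 := by
  let γ : Measure ℕ := poissonMeasure 1
  have hγ : ∀ n, γ {n} ≠ 0 := fun n => by
    have : 0 < γ.real {n} := poissonMeasure_real_singleton_pos n one_pos
    intro h0
    rw [measureReal_def, h0] at this
    simp at this
  have hm : Measurable fun p : X × ℕ => θ p.2 p.1 :=
    measurable_from_prod_countable_left fun n => hθ n
  refine ⟨(Kernel.id ×ₖ Kernel.const X γ).map fun p : X × ℕ => θ p.2 p.1,
    Kernel.IsMarkovKernel.map _ hm, fun x y hxy => ?_⟩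
  obtain ⟨n, rfl⟩ := (hθE x y).1 hxy
  rw [Kernel.map_apply' _ hm _ (measurableSet_singleton _), Kernel.prod_apply, Kernel.id_apply,
    Kernel.const_apply]
  refine fun h0 => hγ n ?_
  have : (Measure.dirac x).prod γ ({x} ×ˢ {n}) = 0 := by
    refine measure_mono_null ?_ h0
    rintro ⟨a, b⟩ ⟨rfl, rfl⟩
    rfl
  rw [Measure.prod_prod] at this
  simpa using this

/-- The graph of `t`, normalised with respect to the kernel. -/
noncomputable def graphDensity (κ : Kernel X X) (t : X → X) (p : X × X) : ℝ :=
  ({p : X × X | p.2 = t p.1}.indicator fun p => ((κ p.1).real {p.2})⁻¹) p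

variable {κ : Kernel X X} [IsMarkovKernel κ] {t : X → X}

theorem measurable_graphDensity (ht : Measurable t) : Measurable (graphDensity κ t) := by
  refine Measurable.indicator ?_ (measurableSet_eq_fun measurable_snd (ht.comp measurable_fst))
  have hS : MeasurableSet {q : (X × X) × X | q.2 = q.1.2} :=
    measurableSet_eq_fun measurable_snd (measurable_snd.comp measurable_fst)
  have := Kernel.measurable_kernel_prodMk_left (κ := Kernel.prodMkRight X κ) hS
  exact (this.ennreal_toReal).inv

theorem mul_graphDensity (f : X → ℝ) (x : X) :
    (fun y => f y * graphDensity κ t (x, y)) =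
      ({t x} : Set X).indicator fun _ => f (t x) * ((κ x).real {t x})⁻¹ := by
  ext y
  by_cases hy : y = t x
  · subst hy
    rw [indicator_of_mem (mem_singleton _), graphDensity, indicator_of_mem]
    rfl
  · rw [indicator_of_notMem (by simpa using hy), graphDensity, indicator_of_notMem (by simpa using hy),
      mul_zero]

theorem integrable_mul_graphDensity (f : X → ℝ) (x : X) :
    Integrable (fun y => f y * graphDensity κ t (x, y)) (κ x) := by
  rw [mul_graphDensity]
  exact (integrable_const _).indicator (measurableSet_singleton _)

theorem integral_mul_graphDensity (f : X → ℝ) {x : X} (ht : κ x {t x} ≠ 0) :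
    ∫ y, f y * graphDensity κ t (x, y) ∂(κ x) = f (t x) := by
  rw [mul_graphDensity, integral_indicator (measurableSet_singleton _), setIntegral_const,
    smul_eq_mul, mul_comm, mul_assoc, inv_mul_cancel₀, mul_one]
  exact (ENNReal.toReal_pos ht (measure_ne_top _ _)).ne'

variable (μ : Measure X) [IsFiniteMeasure μ]

theorem integrable_graphDensity (htm : Measurable t) (ht : ∀ x, κ x {t x} ≠ 0) :
    Integrable (graphDensity κ t) (μ ⊗ₘ κ) := by
  rw [Measure.integrable_compProd_iff (measurable_graphDensity htm).aestronglyMeasurable]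
  have e : ∀ x y, ‖graphDensity κ t (x, y)‖ = 1 * graphDensity κ t (x, y) := fun x y => by
    rw [one_mul, Real.norm_of_nonneg]
    exact indicator_nonneg (fun p _ => inv_nonneg.2 measureReal_nonneg) _
  refine ⟨Eventually.of_forall fun x => ?_, ?_⟩
  · simpa using integrable_mul_graphDensity (κ := κ) (t := t) (fun _ => 1) x
  · simp_rw [e]
    simp_rw [fun x => integral_mul_graphDensity (fun _ => 1) (ht x)]
    exact integrable_const _

theorem integral_compProd_graphDensity (htm : Measurable t) (ht : ∀ x, κ x {t x} ≠ 0)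
    {f : X × X → ℝ} (hf : Measurable f) {C : ℝ} (hC : ∀ p, |f p| ≤ C) :
    ∫ p, f p * graphDensity κ t p ∂(μ ⊗ₘ κ) = ∫ x, f (x, t x) ∂μ := by
  rw [Measure.integral_compProd]
  · refine integral_congr_ae (Eventually.of_forall fun x => ?_)
    exact integral_mul_graphDensity (fun y => f (x, y)) (ht x)
  · exact (integrable_graphDensity μ htm ht).bdd_mul hf.aestronglyMeasurable
      (Eventually.of_forall hC)

end ClassKernel

section Selection

variable {X : Type*} [MeasurableSpace X] [StandardBorelSpace X] {E : X → X → Prop}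
  {θ : ℕ → X → X}

/-- An amenable assignment, as an invariant field of positive functionals. -/
structure IsFunField (μ : Measure X) (E : X → X → Prop) (Λ : X → (X → ℝ) → ℝ) : Prop where
  pos : ∀ x, IsPosFun (Λ x)
  inv : ∀ x y, E x y → Λ x = Λ y
  supp : ∀ x, Λ x ({y | E x y}.indicator 1) = 1
  meas : ∀ A : Set (X × X), MeasurableSet A →
    AEMeasurable (fun x => Λ x ({y | (x, y) ∈ A}.indicator 1)) μ

theorem exists_funField {μ : Measure X} (h : MuAmenable μ E) : ∃ Λ, IsFunField μ E Λ := by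
  obtain ⟨ν, h1, h2, h3, h4, h5, h6⟩ := h
  rcases isEmpty_or_nonempty X with hX | hX
  · exact ⟨fun _ _ => 0, ⟨fun x => hX.elim x, fun x => hX.elim x, fun x => hX.elim x,
      fun A _ => aemeasurable_const⟩⟩
  have hex : ∀ m : Set X → ℝ, ∃ Λ : (X → ℝ) → ℝ, IsMean m → IsPosFun Λ ∧
      ∀ A, Λ (A.indicator 1) = m A := fun m => by
    by_cases hm : IsMean m
    · obtain ⟨Λ, hΛ, hΛ'⟩ := exists_functional (⊤ : MeasurableSpace X) m (fun A _ => hm.nonneg A)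
        hm.univ (fun A B _ _ => hm.add A B)
      exact ⟨Λ, fun _ => ⟨hΛ, fun A => hΛ' A trivial⟩⟩
    · exact ⟨fun _ => 0, fun h => absurd h hm⟩
  choose L hL using hex
  have hν : ∀ x, IsMean (ν x) := fun x => ⟨h1 x, h2 x, h3 x⟩
  refine ⟨fun x => L (ν x), fun x => (hL _ (hν x)).1, fun x y hxy => by rw [h5 x y hxy],
    fun x => by rw [(hL _ (hν x)).2, h4], fun A hA => ?_⟩
  simp_rw [fun x => (hL _ (hν x)).2]
  exact h6 A hA

namespace IsFunField

variable {μ : Measure X} {Λ : X → (X → ℝ) → ℝ}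

theorem aemeasurable_apply (h : IsFunField μ E Λ) {f : X × X → ℝ} (hf : Measurable f) {C : ℝ}
    (hC : ∀ p, |f p| ≤ C) : AEMeasurable (fun x => Λ x fun y => f (x, y)) μ := by
  have hunit : ∀ u : X × X → ℝ, Measurable u → (∀ p, u p ∈ Icc (0 : ℝ) 1) →
      AEMeasurable (fun x => Λ x fun y => u (x, y)) μ := fun u hu hu1 => by
    refine aemeasurable_of_tendsto_metrizable_ae atTop (f := fun (N : ℕ) x => ((N : ℝ) + 1)⁻¹ *
      ∑ i ∈ Finset.range (N + 1), Λ x ({y | (i : ℝ) / (N + 1) < u (x, y)}.indicator 1))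
      (fun N => ?_) (Eventually.of_forall fun x => (h.pos x).tendsto_layer fun y => hu1 (x, y))
    exact (Finset.aemeasurable_fun_sum _ fun (i : ℕ) _ =>
      h.meas {p | (i : ℝ) / (N + 1) < u p} (measurableSet_lt measurable_const hu)).const_mul _
  rcases isEmpty_or_nonempty X with hX | ⟨⟨x0⟩⟩
  · exact ⟨fun _ => 0, measurable_const, Eventually.of_forall fun x => hX.elim x⟩
  have hC0 : 0 ≤ C := (abs_nonneg _).trans (hC (x0, x0))
  set D := C + 1 with hD
  have hDpos : 0 < D := by linarith
  have key := hunit (fun p => (f p + D) / (2 * D)) ((hf.add_const _).div_const _) fun p => by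
    have := abs_le.1 (hC p)
    constructor
    · exact div_nonneg (by linarith) (by linarith)
    · rw [div_le_one (by linarith)]; linarith
  have e : (fun x => Λ x fun y => f (x, y)) = fun x =>
      2 * D * (Λ x fun y => (f (x, y) + D) / (2 * D)) - D := by
    ext x
    have hb : Bdd fun y => f (x, y) := ⟨C, fun y => hC _⟩
    have h1 : (fun y => (f (x, y) + D) / (2 * D)) = fun y => (2 * D)⁻¹ * (f (x, y) + D) := by
      ext y; rw [div_eq_inv_mul]
    rw [h1, (h.pos x).smul _ _ (hb.add (Bdd.const D)), (h.pos x).add _ _ hb (Bdd.const D),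
      (h.pos x).const]
    field_simp
    ring
  rw [e]
  exact (key.const_mul _).sub_const _

theorem exists_le (h : IsFunField μ E Λ) (x : X) {f : X → ℝ} (hf : Bdd f) {ε : ℝ} (hε : 0 < ε) :
    ∃ y, E x y ∧ f y ≤ Λ x f + ε := by
  by_contra hn
  push Not at hn
  obtain ⟨C, hC⟩ := hf
  have hf : Bdd f := ⟨C, hC⟩
  set a := Λ x f + ε with ha
  let u : X → ℝ := {y | E x y}.indicator 1
  have hu : Bdd u := Bdd.indicator _
  have h1 : Λ x (fun y => a + (C + |a|) * (u y + (-1))) ≤ Λ x f := by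
    refine (h.pos x).mono ((Bdd.const a).add ((hu.add (Bdd.const (-1))).const_mul _)) hf
      fun y => ?_
    by_cases hy : E x y
    · have : u y = 1 := indicator_of_mem (s := {y | E x y}) hy _
      rw [this]
      have := hn y hy
      linarith
    · have : u y = 0 := indicator_of_notMem (s := {y | E x y}) hy _
      rw [this]
      have h2 := (abs_le.1 (hC y)).1
      have h3 := le_abs_self a
      linarith
  rw [(h.pos x).add _ _ (Bdd.const a) ((hu.add (Bdd.const (-1))).const_mul _), (h.pos x).const,
    (h.pos x).smul _ _ (hu.add (Bdd.const (-1))), (h.pos x).add _ _ hu (Bdd.const (-1)),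
    (h.pos x).const, h.supp x] at h1
  linarith

/-- A measurable choice of points in the classes whose average does not exceed the average of the
means by much. -/
theorem exists_selection (h : IsFunField μ E Λ) [IsFiniteMeasure μ] (hθ : ∀ n, Measurable (θ n))
    (hθE : ∀ x y, E x y ↔ ∃ n, θ n x = y) {F : X × X → ℝ} (hF : Measurable F) {b : X → ℝ}
    (hb : Integrable b μ) (hFb : ∀ x y, |F (x, y)| ≤ b x)
    (hN : AEMeasurable (fun x => Λ x fun y => F (x, y)) μ) {ε : ℝ} (hε : 0 < ε) :
    ∃ s : X → X, Measurable s ∧ (∀ x, E x (s x)) ∧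
      ∫ x, F (x, s x) ∂μ ≤ ∫ x, Λ x (fun y => F (x, y)) ∂μ + ε := by
  classical
  set N : X → ℝ := fun x => Λ x fun y => F (x, y) with hNdef
  have hbd : ∀ x, Bdd fun y => F (x, y) := fun x => ⟨b x, hFb x⟩
  have hNb : ∀ x, |N x| ≤ b x := fun x => by
    have := (h.pos x).abs_sub_le (hbd x) (Bdd.const 0) (ε := b x) fun y => by simpa using hFb x y
    rwa [(h.pos x).const, sub_zero] at this
  have hNint : Integrable N μ := hb.mono' hN.aestronglyMeasurable (Eventually.of_forall hNb)
  set η : ℝ := ε / (μ.real univ + 1) with hη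
  have hpos : 0 < μ.real univ + 1 := by positivity
  have hηpos : 0 < η := div_pos hε hpos
  let N' := hN.mk N
  have hN'm : Measurable N' := hN.measurable_mk
  let Q : X → ℕ → Prop := fun x i => F (x, θ i x) ≤ N' x + η
  have hQ : ∀ i, MeasurableSet {x | Q x i} := fun i =>
    measurableSet_le (hF.comp (measurable_id.prodMk (hθ i))) (hN'm.add_const _)
  let idx : X → ℕ := fun x => if hx : ∃ i, Q x i then Nat.find hx else 0
  have hidx : Measurable idx := by
    have hex : MeasurableSet {x | ∃ i, Q x i} := by
      rw [ofPred_exists]; exact MeasurableSet.iUnion hQ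
    refine measurable_to_countable' fun n => ?_
    have : idx ⁻¹' {n} = ({x | Q x n} ∩ ⋂ j ∈ Finset.range n, {x | Q x j}ᶜ) ∪
        ({x | ∃ i, Q x i}ᶜ ∩ {_x | n = 0}) := by
      ext x
      simp only [mem_preimage, mem_singleton_iff, idx, mem_union, mem_inter_iff, mem_iInter,
        mem_compl_iff, mem_ofPred_eq, Finset.mem_range]
      by_cases hx : ∃ i, Q x i
      · rw [dif_pos hx, Nat.find_eq_iff]
        constructor
        · rintro ⟨h1, h2⟩; exact Or.inl ⟨h1, h2⟩
        · rintro (h1 | h1)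
          · exact h1
          · exact absurd hx h1.1
      · rw [dif_neg hx]
        constructor
        · intro h1; exact Or.inr ⟨hx, h1.symm⟩
        · rintro (h1 | h1)
          · exact absurd ⟨n, h1.1⟩ hx
          · exact h1.2.symm
    rw [this]
    exact ((hQ n).inter (Finset.measurableSet_biInter _ fun j _ => (hQ j).compl)).union
      (hex.compl.inter (MeasurableSet.const _))
  have hsm : Measurable fun x => θ (idx x) x :=
    (measurable_from_prod_countable_left (f := fun p : X × ℕ => θ p.2 p.1) fun n => hθ n).comp
      (measurable_id.prodMk hidx)
  refine ⟨fun x => θ (idx x) x, hsm, fun x => (hθE _ _).2 ⟨_, rfl⟩, ?_⟩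
  have hFint : Integrable (fun x => F (x, θ (idx x) x)) μ := hb.mono'
    (hF.comp (measurable_id.prodMk hsm)).aestronglyMeasurable
    (Eventually.of_forall fun x => hFb _ _)
  calc ∫ x, F (x, θ (idx x) x) ∂μ ≤ ∫ x, (N x + η) ∂μ := by
        refine integral_mono_ae hFint (hNint.add (integrable_const _)) ?_
        filter_upwards [hN.ae_eq_mk] with x hx
        have hx' : N x = N' x := hx
        obtain ⟨y, hy, hle⟩ := h.exists_le x (hbd x) hηpos
        obtain ⟨i, rfl⟩ := (hθE x y).1 hy
        have hex : ∃ i, Q x i := ⟨i, by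
          change F (x, θ i x) ≤ N' x + η
          rw [← hx']; exact hle⟩
        have : Q x (idx x) := by
          simp only [idx, dif_pos hex]
          exact Nat.find_spec hex
        change F (x, θ (idx x) x) ≤ N x + η
        rw [hx']
        exact this
    _ = ∫ x, N x ∂μ + μ.real univ * η := by
        rw [integral_add hNint (integrable_const _), integral_const, smul_eq_mul]
    _ ≤ ∫ x, N x ∂μ + ε := by
        have : μ.real univ * η ≤ ε := by
          rw [hη, mul_div_assoc', div_le_iff₀ hpos]
          nlinarith [measureReal_nonneg (μ := μ) (s := univ)]
        linarith

end IsFunField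

end Selection

section Reiter

variable {X : Type*} [MeasurableSpace X] [StandardBorelSpace X] {E : X → X → Prop}
  {θ : ℕ → X → X}

theorem integral_rnDeriv_mul_comp {μ : Measure X} [IsFiniteMeasure μ] {τ : X → X}
    (hτ : Measurable τ) (hac : μ.map τ ≪ μ) {u : X → ℝ} (hu : AEMeasurable u μ) :
    ∫ x, ((μ.map τ).rnDeriv μ x).toReal * u x ∂μ = ∫ x, u (τ x) ∂μ := by
  have hfin : IsFiniteMeasure (μ.map τ) := Measure.isFiniteMeasure_map μ τ
  have := integral_rnDeriv_smul (f := u) hac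
  simp only [smul_eq_mul] at this
  rw [this, integral_map hτ.aemeasurable (hu.mono_ac hac).aestronglyMeasurable]

/-- No finite family of bounded functions separates the selections from invariance. -/
theorem exists_selection_le (hθ : ∀ n, Measurable (θ n)) (hθθ : ∀ n x, θ n (θ n x) = x)
    (hθE : ∀ x y, E x y ↔ ∃ n, θ n x = y) {μ : Measure X} [IsFiniteMeasure μ]
    (hqi : ∀ n, μ.map (θ n) ≪ μ) (h : MuAmenable μ E) {J : ℕ} (f : Fin J → X × X → ℝ)
    (hf : ∀ j, Measurable (f j)) {C : ℝ} (hC : ∀ j p, |f j p| ≤ C) {ε : ℝ} (hε : 0 < ε) :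
    ∃ s : X → X, Measurable s ∧ (∀ x, E x (s x)) ∧
      ∑ j, (∫ x, f j (x, s x) ∂μ - ∫ x, f j (x, s (θ j x)) ∂μ) ≤ ε := by
  obtain ⟨Λ, hΛ⟩ := exists_funField h
  let D : Fin J → X → ℝ := fun j x => ((μ.map (θ j)).rnDeriv μ x).toReal
  have hfin : ∀ j : Fin J, IsFiniteMeasure (μ.map (θ j)) := fun j =>
    Measure.isFiniteMeasure_map μ (θ j)
  have hDm : ∀ j, Measurable (D j) := fun j => (Measure.measurable_rnDeriv _ _).ennreal_toReal
  have hD0 : ∀ j x, 0 ≤ D j x := fun j x => ENNReal.toReal_nonneg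
  have hDi : ∀ j, Integrable (D j) μ := fun j => Measure.integrable_toReal_rnDeriv
  let f' : Fin J → X × X → ℝ := fun j p => f j (θ j p.1, p.2)
  have hf' : ∀ j, Measurable (f' j) := fun j =>
    (hf j).comp (((hθ j).comp measurable_fst).prodMk measurable_snd)
  have hC' : ∀ j p, |f' j p| ≤ C := fun j p => hC j _
  let F : X × X → ℝ := fun p => ∑ j, (f j p - D j p.1 * f' j p)
  have hF : Measurable F := Finset.measurable_fun_sum _ fun j _ =>
    (hf j).sub (((hDm j).comp measurable_fst).mul (hf' j))
  let b : X → ℝ := fun x => ∑ j, (C + D j x * C)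
  have hb : Integrable b μ := integrable_finsetSum _ fun j _ =>
    (integrable_const _).add ((hDi j).mul_const _)
  have hterm : ∀ j x y, |f j (x, y) - D j x * f' j (x, y)| ≤ C + D j x * C := fun j x y => by
    refine (abs_sub _ _).trans (add_le_add (hC j _) ?_)
    rw [abs_mul, abs_of_nonneg (hD0 j x)]
    exact mul_le_mul_of_nonneg_left (hC' j _) (hD0 j x)
  have hFb : ∀ x y, |F (x, y)| ≤ b x := fun x y =>
    (Finset.abs_sum_le_sum_abs _ _).trans (Finset.sum_le_sum fun j _ => hterm j x y)
  let n : Fin J → X → ℝ := fun j x => Λ x fun y => f j (x, y)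
  let n' : Fin J → X → ℝ := fun j x => Λ x fun y => f' j (x, y)
  have hn : ∀ j, AEMeasurable (n j) μ := fun j => hΛ.aemeasurable_apply (hf j) (hC j)
  have hn' : ∀ j, AEMeasurable (n' j) μ := fun j => hΛ.aemeasurable_apply (hf' j) (hC' j)
  have habs : ∀ x (g : X → ℝ), (∀ y, |g y| ≤ C) → |Λ x g| ≤ C := fun x g hg => by
    have := (hΛ.pos x).abs_sub_le (f := g) ⟨C, hg⟩ (Bdd.const 0) (ε := C) fun y => by
      simpa using hg y
    rwa [(hΛ.pos x).const, sub_zero] at this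
  have hnn : ∀ j x, n j (θ j x) = n' j x := fun j x => by
    change Λ (θ j x) (fun y => f j (θ j x, y)) = Λ x fun y => f j (θ j x, y)
    rw [hΛ.inv x (θ j x) ((hθE _ _).2 ⟨j, rfl⟩)]
  have hnn' : ∀ j x, n' j (θ j x) = n j x := fun j x => by rw [← hnn, hθθ]
  have hNF : (fun x => Λ x fun y => F (x, y)) = fun x => ∑ j, (n j x - D j x * n' j x) := by
    ext x
    have h1 : ∀ j, Bdd fun y => f j (x, y) := fun j => ⟨C, fun y => hC j _⟩
    have h2 : ∀ j, Bdd fun y => f' j (x, y) := fun j => ⟨C, fun y => hC' j _⟩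
    have := (hΛ.pos x).sum Finset.univ (f := fun j y => f j (x, y) - D j x * f' j (x, y))
      fun j => (h1 j).sub ((h2 j).const_mul _)
    refine this.trans (Finset.sum_congr rfl fun j _ => ?_)
    rw [(hΛ.pos x).sub (h1 j) ((h2 j).const_mul _), (hΛ.pos x).smul _ _ (h2 j)]
  have hNm : AEMeasurable (fun x => Λ x fun y => F (x, y)) μ := by
    rw [hNF]
    exact Finset.aemeasurable_fun_sum _ fun j _ =>
      (hn j).sub ((hDm j).aemeasurable.mul (hn' j))
  have hni : ∀ j, Integrable (n j) μ := fun j =>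
    (integrable_const C).mono' (hn j).aestronglyMeasurable
      (Eventually.of_forall fun x => habs x _ fun y => hC j _)
  have hDn : ∀ j, Integrable (fun x => D j x * n' j x) μ := fun j =>
    (hDi j).mul_bdd (hn' j).aestronglyMeasurable
      (Eventually.of_forall fun x => habs x _ fun y => hC' j _)
  have hNint : ∫ x, Λ x (fun y => F (x, y)) ∂μ = 0 := by
    rw [hNF, integral_finsetSum (f := fun j x => n j x - D j x * n' j x) _
      fun j _ => (hni j).sub (hDn j)]
    refine Finset.sum_eq_zero fun j _ => ?_
    rw [integral_sub (hni j) (hDn j), integral_rnDeriv_mul_comp (hθ j) (hqi j) (hn' j)]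
    simp only [hnn', sub_self]
  obtain ⟨s, hs, hsE, hle⟩ := hΛ.exists_selection hθ hθE hF hb hFb hNm hε
  rw [hNint, zero_add] at hle
  refine ⟨s, hs, hsE, le_of_eq_of_le ?_ hle⟩
  have hu : ∀ j, Measurable fun x => f' j (x, s x) := fun j =>
    (hf' j).comp (measurable_id.prodMk hs)
  have hv : ∀ j, Measurable fun x => f j (x, s x) := fun j => (hf j).comp (measurable_id.prodMk hs)
  have hvi : ∀ j, Integrable (fun x => f j (x, s x)) μ := fun j =>
    (integrable_const C).mono' (hv j).aestronglyMeasurable (Eventually.of_forall fun x => hC j _)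
  have hui : ∀ j, Integrable (fun x => D j x * f' j (x, s x)) μ := fun j =>
    (hDi j).mul_bdd (hu j).aestronglyMeasurable (Eventually.of_forall fun x => hC' j _)
  change _ = ∫ x, ∑ j, (f j (x, s x) - D j x * f' j (x, s x)) ∂μ
  rw [integral_finsetSum (f := fun j x => f j (x, s x) - D j x * f' j (x, s x)) _
    fun j _ => (hvi j).sub (hui j)]
  refine Finset.sum_congr rfl fun j _ => ?_
  rw [integral_sub (hvi j) (hui j), integral_rnDeriv_mul_comp (hθ j) (hqi j) (hu j).aemeasurable]
  simp only [f', hθθ]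

/-- Convex combinations of selections which are nearly invariant under finitely many maps. -/
theorem exists_almost_invariant_combination (hE : Equivalence E) (hθ : ∀ n, Measurable (θ n))
    (hθθ : ∀ n x, θ n (θ n x) = x)
    (hθE : ∀ x y, E x y ↔ ∃ n, θ n x = y) {μ : Measure X} [IsFiniteMeasure μ]
    (hqi : ∀ n, μ.map (θ n) ≪ μ) (h : MuAmenable μ E) (κ : Kernel X X) [IsMarkovKernel κ]
    (hκ : ∀ x y, E x y → κ x {y} ≠ 0) (J : ℕ) {ε : ℝ} (hε : 0 < ε) :
    ∃ (ι : Type) (_ : Fintype ι) (a : ι → ℝ) (s : ι → X → X), (∀ i, 0 ≤ a i) ∧ ∑ i, a i = 1 ∧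
      (∀ i, Measurable (s i)) ∧ (∀ i x, E x (s i x)) ∧ ∀ j < J,
        ∫⁻ p, ‖∑ i, a i * (graphDensity κ (s i) p - graphDensity κ (fun x => s i (θ j x)) p)‖ₑ
          ∂(μ ⊗ₘ κ) ≤ ENNReal.ofReal ε := by
  classical
  set M := μ ⊗ₘ κ with hM
  let S := {s : X → X // Measurable s ∧ ∀ x, E x (s x)}
  have hθ' : ∀ j x, E x (θ j x) := fun j x => (hθE _ _).2 ⟨j, rfl⟩
  have hκ1 : ∀ (s : S) x, κ x {s.1 x} ≠ 0 := fun s x => hκ _ _ (s.2.2 x)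
  have hκ2 : ∀ (s : S) j x, κ x {s.1 (θ j x)} ≠ 0 := fun s j x =>
    hκ _ _ (hE.trans (hθ' j x) (s.2.2 _))
  have hi1 : ∀ s : S, Integrable (graphDensity κ s.1) M := fun s =>
    integrable_graphDensity μ s.2.1 (hκ1 s)
  have hi2 : ∀ (s : S) j, Integrable (graphDensity κ fun x => s.1 (θ j x)) M := fun s j =>
    integrable_graphDensity μ (s.2.1.comp (hθ j)) (hκ2 s j)
  let H : S → Fin J → Lp ℝ 1 M := fun s j => (hi1 s).toL1 _ - (hi2 s j).toL1 _
  have hmem : (0 : Fin J → Lp ℝ 1 M) ∈ closure (convexHull ℝ (range H)) := by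
    by_contra hn
    obtain ⟨ℓ, u, hu0, hu⟩ := geometric_hahn_banach_point_closed
      (convex_convexHull ℝ (range H)).closure isClosed_closure hn
    rw [map_zero] at hu0
    let ℓj : Fin J → (Lp ℝ 1 M →L[ℝ] ℝ) := fun j =>
      ℓ.comp (ContinuousLinearMap.single ℝ (fun _ : Fin J => Lp ℝ 1 M) j)
    choose f hf hfb hfℓ using fun j => exists_bounded_density M (ℓj j)
    obtain ⟨s, hs, hsE, hle⟩ := exists_selection_le hθ hθθ hθE hqi h f hf (C := ∑ j, ‖ℓj j‖)
      (fun j p => (hfb j p).trans (Finset.single_le_sum (f := fun j => ‖ℓj j‖)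
        (fun j _ => norm_nonneg _) (Finset.mem_univ j))) hu0
    have hlt := hu (H ⟨s, hs, hsE⟩) (subset_closure (subset_convexHull ℝ _ ⟨_, rfl⟩))
    refine absurd hle (not_le.2 (hlt.trans_eq ?_))
    have e : ℓ (H ⟨s, hs, hsE⟩) = ∑ j, ℓj j (H ⟨s, hs, hsE⟩ j) := by
      conv_lhs => rw [← Finset.univ_sum_single (H ⟨s, hs, hsE⟩)]
      rw [map_sum]
      rfl
    rw [e]
    refine Finset.sum_congr rfl fun j _ => ?_
    simp only [H]
    rw [map_sub, hfℓ, hfℓ, integral_compProd_graphDensity μ hs (hκ1 ⟨s, hs, hsE⟩) (hf j) (hfb j),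
      integral_compProd_graphDensity (t := fun x => s (θ j x)) μ (hs.comp (hθ j))
        (hκ2 ⟨s, hs, hsE⟩ j) (hf j) (hfb j)]
  obtain ⟨g, hg, hgε⟩ := Metric.mem_closure_iff.1 hmem ε hε
  rw [dist_zero_left] at hgε
  obtain ⟨ι, _, a, z, ha, ha1, hz, hzg⟩ := mem_convexHull_iff_exists_fintype.1 hg
  choose s hs using hz
  obtain ⟨N, ⟨eN⟩⟩ := Finite.exists_equiv_fin ι
  refine ⟨Fin N, inferInstance, fun i => a (eN.symm i), fun i => (s (eN.symm i)).1,
    fun i => ha _, ?_, fun i => (s _).2.1, fun i => (s _).2.2, fun j hj => ?_⟩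
  · rw [← ha1]
    exact Equiv.sum_comp eN.symm a
  have hsum : ∀ p, ∑ i, a (eN.symm i) * (graphDensity κ (s (eN.symm i)).1 p -
      graphDensity κ (fun x => (s (eN.symm i)).1 (θ j x)) p) =
      ∑ i, a i * (graphDensity κ (s i).1 p - graphDensity κ (fun x => (s i).1 (θ j x)) p) :=
    fun p => Equiv.sum_comp eN.symm fun i =>
      a i * (graphDensity κ (s i).1 p - graphDensity κ (fun x => (s i).1 (θ j x)) p)
  simp_rw [hsum]
  let G : X × X → ℝ := fun p =>
    ∑ i, a i * (graphDensity κ (s i).1 p - graphDensity κ (fun x => (s i).1 (θ j x)) p)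
  have hae : g ⟨j, hj⟩ =ᵐ[M] G := by
    have e1 : g ⟨j, hj⟩ = ∑ i, a i • ((hi1 (s i)).toL1 _ - (hi2 (s i) j).toL1 _) := by
      rw [← hzg, Finset.sum_apply]
      refine Finset.sum_congr rfl fun i _ => ?_
      rw [← hs i]
      rfl
    rw [e1]
    refine (Lp.coeFn_finsetSum _ _).trans ?_
    have h1 : ∀ i, (a i • ((hi1 (s i)).toL1 _ - (hi2 (s i) j).toL1 _) : Lp ℝ 1 M) =ᵐ[M] fun p =>
        a i * (graphDensity κ (s i).1 p - graphDensity κ (fun x => (s i).1 (θ j x)) p) :=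
      fun i => by
        filter_upwards [Lp.coeFn_smul (a i) ((hi1 (s i)).toL1 _ - (hi2 (s i) j).toL1 _),
          Lp.coeFn_sub ((hi1 (s i)).toL1 _) ((hi2 (s i) j).toL1 _), (hi1 (s i)).coeFn_toL1,
          (hi2 (s i) j).coeFn_toL1] with p b1 b2 b3 b4
        rw [b1, Pi.smul_apply, b2, Pi.sub_apply, b3, b4, smul_eq_mul]
    filter_upwards [ae_all_iff.2 h1] with p hp
    simp only [Finset.sum_apply, hp, G]
  have e2 : ∫⁻ p, ‖G p‖ₑ ∂M = ‖g ⟨j, hj⟩‖ₑ := by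
    rw [Lp.enorm_def, eLpNorm_one_eq_lintegral_enorm]
    refine lintegral_congr_ae ?_
    filter_upwards [hae] with p hp
    rw [hp]
  change ∫⁻ p, ‖G p‖ₑ ∂M ≤ _
  rw [e2, ← ofReal_norm]
  exact ENNReal.ofReal_le_ofReal ((norm_le_pi_norm g ⟨j, hj⟩).trans hgε.le)

end Reiter

section ReiterKernel

variable {X : Type*} [MeasurableSpace X] [StandardBorelSpace X] {E : X → X → Prop}
  {θ : ℕ → X → X}

/-- Finitely many points chosen measurably, with fixed weights, form a kernel. -/
theorem exists_combination_kernel {ι : Type*} [Fintype ι] {a : ι → ℝ} {s : ι → X → X}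
    (ha : ∀ i, 0 ≤ a i) (hs : ∀ i, Measurable (s i)) :
    ∃ L : Kernel X X, ∀ x A, MeasurableSet A →
      L x A = ENNReal.ofReal (∑ i, a i * A.indicator (fun _ => (1 : ℝ)) (s i x)) := by
  have hval : ∀ x A, MeasurableSet A →
      (∑ i, ENNReal.ofReal (a i) • Measure.dirac (s i x)) A =
        ENNReal.ofReal (∑ i, a i * A.indicator (fun _ => (1 : ℝ)) (s i x)) := fun x A hA => by
    have h0 : ∀ i, 0 ≤ A.indicator (fun _ => (1 : ℝ)) (s i x) := fun i =>
      indicator_nonneg (fun _ _ => zero_le_one) _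
    rw [ENNReal.ofReal_sum_of_nonneg fun i _ => mul_nonneg (ha i) (h0 i), Measure.finsetSum_apply]
    refine Finset.sum_congr rfl fun i _ => ?_
    rw [ENNReal.ofReal_mul (ha i), Measure.smul_apply, Measure.dirac_apply' _ hA, smul_eq_mul]
    by_cases h : s i x ∈ A
    · simp [h]
    · simp [h]
  refine ⟨⟨fun x => ∑ i, ENNReal.ofReal (a i) • Measure.dirac (s i x), ?_⟩, hval⟩
  refine Measure.measurable_of_measurable_coe _ fun A hA => ?_
  simp only [hval _ A hA]
  refine ENNReal.measurable_ofReal.comp (Finset.measurable_sum _ fun i _ => ?_)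
  exact ((measurable_const.indicator hA).comp (hs i)).const_mul (a i)

theorem exists_almost_invariant_kernel (hE : Equivalence E) (hB : MeasurableSet {p : X × X | E p.1 p.2})
    (hθ : ∀ n, Measurable (θ n)) (hθθ : ∀ n x, θ n (θ n x) = x)
    (hθE : ∀ x y, E x y ↔ ∃ n, θ n x = y) {μ : Measure X} [IsFiniteMeasure μ]
    (hqi : ∀ n, μ.map (θ n) ≪ μ) (h : MuAmenable μ E) (J : ℕ) {ε : ℝ} (hε : 0 < ε) :
    ∃ (L : Kernel X X) (q : ℕ → X → ℝ≥0∞), IsMarkovKernel L ∧ (∀ x, L x {y | E x y}ᶜ = 0) ∧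
      (∀ j, Measurable (q j)) ∧ (∀ j < J, ∫⁻ x, q j x ∂μ ≤ ENNReal.ofReal ε) ∧
      ∀ j x A, MeasurableSet A → L x A ≤ L (θ j x) A + q j x := by
  obtain ⟨κ, _, hκ⟩ := exists_class_kernel hθ hθE
  obtain ⟨ι, _, a, s, ha, ha1, hs, hsE, hInt⟩ :=
    exists_almost_invariant_combination hE hθ hθθ hθE hqi h κ hκ J hε
  obtain ⟨L, hL⟩ := exists_combination_kernel ha hs
  let G : ℕ → X × X → ℝ := fun j p =>
    ∑ i, a i * (graphDensity κ (s i) p - graphDensity κ (fun x => s i (θ j x)) p)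
  have hG : ∀ j, Measurable (G j) := fun j => Finset.measurable_sum _ fun i _ =>
    ((measurable_graphDensity (hs i)).sub
      (measurable_graphDensity ((hs i).comp (hθ j)))).const_mul _
  have hθ' : ∀ j x, E x (θ j x) := fun j x => (hθE _ _).2 ⟨j, rfl⟩
  have hclass : ∀ x, MeasurableSet {y | E x y} := fun x => measurable_prodMk_left hB
  refine ⟨L, fun j x => ∫⁻ y, ‖G j (x, y)‖ₑ ∂κ x, ⟨fun x => ⟨?_⟩⟩, fun x => ?_, fun j => ?_,
    fun j hj => ?_, fun j x A hA => ?_⟩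
  · rw [hL x _ MeasurableSet.univ]
    simp [ha1]
  · rw [hL x _ (hclass x).compl]
    have : ∀ i, ({y | E x y}ᶜ).indicator (fun _ => (1 : ℝ)) (s i x) = 0 := fun i =>
      indicator_of_notMem (not_not.2 (hsE i x)) _
    simp [this]
  · exact ((hG j).enorm).lintegral_kernel_prod_right'
  · refine le_of_eq_of_le ?_ (hInt j hj)
    rw [Measure.lintegral_compProd (hG j).enorm]
  · let f : X → ℝ := A.indicator fun _ => 1
    have hfG : (fun y => f y * G j (x, y)) = fun y => ∑ i, a i * (f y * graphDensity κ (s i) (x, y) -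
        f y * graphDensity κ (fun x => s i (θ j x)) (x, y)) := by
      ext y
      simp only [G, Finset.mul_sum]
      exact Finset.sum_congr rfl fun i _ => by ring
    have e : ∫ y, f y * G j (x, y) ∂κ x = ∑ i, a i * f (s i x) - ∑ i, a i * f (s i (θ j x)) := by
      rw [hfG, integral_finsetSum (f := fun i y => a i * (f y * graphDensity κ (s i) (x, y) -
        f y * graphDensity κ (fun x => s i (θ j x)) (x, y))) _ fun i _ =>
          ((integrable_mul_graphDensity f x).sub (integrable_mul_graphDensity f x)).const_mul _,
        ← Finset.sum_sub_distrib]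
      refine Finset.sum_congr rfl fun i _ => ?_
      rw [integral_const_mul, integral_sub (integrable_mul_graphDensity f x)
        (integrable_mul_graphDensity f x), integral_mul_graphDensity f (hκ _ _ (hsE i x)),
        integral_mul_graphDensity f (hκ _ _ (hE.trans (hθ' j x) (hsE i _))), mul_sub]
    have hq : ENNReal.ofReal (∑ i, a i * f (s i x) - ∑ i, a i * f (s i (θ j x))) ≤
        ∫⁻ y, ‖G j (x, y)‖ₑ ∂κ x := by
      rw [← e]
      refine (Real.ofReal_le_enorm _).trans ((enorm_integral_le_lintegral_enorm _).trans
        (lintegral_mono fun y => ?_))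
      rw [enorm_mul]
      refine mul_le_of_le_one_left' ?_
      by_cases hy : y ∈ A
      · simp [f, hy]
      · simp [f, hy]
    rw [hL x A hA, hL _ A hA]
    change ENNReal.ofReal (∑ i, a i * f (s i x)) ≤ ENNReal.ofReal (∑ i, a i * f (s i (θ j x))) + _
    refine le_trans ?_ (add_le_add_right hq _)
    refine le_trans (ENNReal.ofReal_le_ofReal ?_) ENNReal.ofReal_add_le
    linarith

/-- Kernels witnessing Reiter's condition, with summable errors. -/
def Reiter (μ : Measure X) (E : X → X → Prop) (L : ℕ → Kernel X X) : Prop :=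
  (∀ k, IsMarkovKernel (L k)) ∧ (∀ k x, L k x {y | E x y}ᶜ = 0) ∧
    ∃ X0 : Set X, (∀ᵐ x ∂μ, x ∈ X0) ∧ ∀ x ∈ X0, ∀ x', E x x' → ∃ c : ℕ → ℝ≥0∞,
      ∑' k, c k ≠ ∞ ∧ ∀ k A, MeasurableSet A → L k x A ≤ L k x' A + c k

theorem exists_reiter (hE : Equivalence E) (hB : MeasurableSet {p : X × X | E p.1 p.2})
    (hc : ∀ x, {y | E x y}.Countable) (μ : Measure X) [SFinite μ] (h : MuAmenable μ E) :
    ∃ L : ℕ → Kernel X X, Reiter μ E L := by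
  obtain ⟨θ, hθ, hθθ, hθE⟩ := exists_involutions hE hB hc
  obtain ⟨μ', _, hac, hqi, h'⟩ := exists_quasiInvariant hE hθ hθθ hθE μ h
  choose L q hL hLE hq hqi hLq using fun k : ℕ =>
    exists_almost_invariant_kernel hE hB hθ hθθ hθE hqi h' k (ε := (1 / 2 : ℝ) ^ k) (by positivity)
  have hsum : ∀ j, ∀ᵐ x ∂μ', ∑' k, q (k + (j + 1)) j x < ∞ := fun j => by
    refine ae_lt_top' (AEMeasurable.tsum fun k => (hq _ j).aemeasurable) ?_
    rw [lintegral_tsum fun k => (hq _ j).aemeasurable]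
    refine ne_top_of_le_ne_top ?_ (ENNReal.tsum_le_tsum fun k => hqi (k + (j + 1)) j (by omega))
    rw [← ENNReal.ofReal_tsum_of_nonneg (fun k => by positivity)
      ((summable_nat_add_iff (j + 1)).2 summable_geometric_two)]
    exact ENNReal.ofReal_ne_top
  refine ⟨L, hL, hLE, {x | ∀ j, ∑' k, q (k + (j + 1)) j x < ∞}, hac (ae_all_iff.2 hsum),
    fun x hx x' hxx' => ?_⟩
  obtain ⟨j, rfl⟩ := (hθE x x').1 hxx'
  refine ⟨fun k => if j < k then q k j x else 1, ?_, fun k A hA => ?_⟩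
  · rw [← Summable.sum_add_tsum_nat_add' (k := j + 1) ENNReal.summable]
    refine ENNReal.add_ne_top.2 ⟨ENNReal.sum_ne_top.2 fun k hk => ?_, ?_⟩
    · rw [if_neg (by simp at hk; omega)]
      exact ENNReal.one_ne_top
    · have : ∀ k, (if j < k + (j + 1) then q (k + (j + 1)) j x else 1) = q (k + (j + 1)) j x :=
        fun k => if_pos (by omega)
      simp only [this]
      exact (hx j).ne
  · dsimp only
    split_ifs with hjk
    · exact hLq k j x A hA
    · exact le_add_of_nonneg_of_le zero_le (prob_le_one)

end ReiterKernel

theorem prod_le_prod_add {X Y : Type*} [MeasurableSpace X] [MeasurableSpace Y]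
    {α α' : Measure X} {β β' : Measure Y} [IsProbabilityMeasure α] [IsProbabilityMeasure α']
    [IsProbabilityMeasure β] [IsProbabilityMeasure β'] {c d : ℝ≥0∞}
    (hα : ∀ A, MeasurableSet A → α A ≤ α' A + c) (hβ : ∀ A, MeasurableSet A → β A ≤ β' A + d)
    {A : Set (X × Y)} (hA : MeasurableSet A) : α.prod β A ≤ α'.prod β' A + (c + d) := by
  have h1 : α.prod β A ≤ α.prod β' A + d := by
    rw [Measure.prod_apply hA, Measure.prod_apply hA]
    refine (lintegral_mono fun x => hβ _ (measurable_prodMk_left hA)).trans ?_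
    rw [lintegral_add_right _ measurable_const]
    simp
  have h2 : α.prod β' A ≤ α'.prod β' A + c := by
    rw [Measure.prod_apply_symm hA, Measure.prod_apply_symm hA]
    refine (lintegral_mono fun x => hα _ (measurable_prodMk_right hA)).trans ?_
    rw [lintegral_add_right _ measurable_const]
    simp
  calc α.prod β A ≤ α.prod β' A + d := h1
    _ ≤ (α'.prod β' A + c) + d := by gcongr
    _ = _ := add_assoc _ _ _

theorem Reiter.prod {X Y : Type*} [MeasurableSpace X] [StandardBorelSpace X] [MeasurableSpace Y]
    [StandardBorelSpace Y] {μ : Measure X} {ν : Measure Y} [SFinite μ] [SFinite ν]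
    {E : X → X → Prop} {F : Y → Y → Prop} {L : ℕ → Kernel X X} {M : ℕ → Kernel Y Y}
    (hL : Reiter μ E L) (hM : Reiter ν F M) :
    Reiter (μ.prod ν) (fun p q : X × Y => E p.1 q.1 ∧ F p.2 q.2) fun k => L k ∥ₖ M k := by
  obtain ⟨_, hLE, X0, hX0, hL⟩ := hL
  obtain ⟨_, hMF, Y0, hY0, hM⟩ := hM
  refine ⟨fun k => inferInstance, fun k p => ?_, {p | p.1 ∈ X0 ∧ p.2 ∈ Y0},
    (Measure.quasiMeasurePreserving_fst.ae hX0).and (Measure.quasiMeasurePreserving_snd.ae hY0),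
    fun p hp q hpq => ?_⟩
  · rw [Kernel.parallelComp_apply]
    refine measure_mono_null (t := ({y | E p.1 y}ᶜ ×ˢ univ) ∪ (univ ×ˢ {y | F p.2 y}ᶜ)) ?_ ?_
    · intro q hq
      by_cases h : E p.1 q.1
      · exact Or.inr ⟨mem_univ _, fun hF => hq ⟨h, hF⟩⟩
      · exact Or.inl ⟨h, mem_univ _⟩
    · refine measure_union_null ?_ ?_
      · rw [Measure.prod_prod, hLE, zero_mul]
      · rw [Measure.prod_prod, hMF, mul_zero]
  · obtain ⟨c, hc, hc'⟩ := hL p.1 hp.1 q.1 hpq.1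
    obtain ⟨d, hd, hd'⟩ := hM p.2 hp.2 q.2 hpq.2
    refine ⟨fun k => c k + d k, ?_, fun k A hA => ?_⟩
    · rw [ENNReal.tsum_add]
      exact ENNReal.add_ne_top.2 ⟨hc, hd⟩
    · rw [Kernel.parallelComp_apply, Kernel.parallelComp_apply]
      exact prod_le_prod_add (hc' k) (hd' k) hA

section Chain

variable {X : Type*} [MeasurableSpace X] [StandardBorelSpace X] {R : X → X → Prop}

open Classical in
/-- On sequences within one class, make the first `n` terms equal to the `n`-th. -/
noncomputable def collapse (R : X → X → Prop) (n : ℕ) (s : ℕ → X) : ℕ → X :=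
  if ∀ j, R (s 0) (s j) then fun k => s (max k n) else s

theorem collapse_of_class {s : ℕ → X} (hs : ∀ j, R (s 0) (s j)) (n : ℕ) :
    collapse R n s = fun k => s (max k n) := if_pos hs

theorem collapse_of_not {s : ℕ → X} (hs : ¬ ∀ j, R (s 0) (s j)) (n : ℕ) :
    collapse R n s = s := if_neg hs

theorem measurable_collapse (hB : MeasurableSet {p : X × X | R p.1 p.2}) (n : ℕ) :
    Measurable (collapse R n) := by
  classical
  have hG : MeasurableSet {s : ℕ → X | ∀ j, R (s 0) (s j)} := by
    rw [ofPred_forall]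
    refine MeasurableSet.iInter fun j => ?_
    have hm : Measurable fun s : ℕ → X => (s 0, s j) :=
      (measurable_pi_apply 0).prodMk (measurable_pi_apply j)
    exact hB.preimage hm
  exact Measurable.ite hG (measurable_pi_lambda _ fun k => measurable_pi_apply _) measurable_id

theorem collapse_zero (s : ℕ → X) : collapse R 0 s = s := by
  by_cases hs : ∀ j, R (s 0) (s j)
  · rw [collapse_of_class hs]
    simp
  · exact collapse_of_not hs 0

theorem collapse_collapse (hR : Equivalence R) {i j : ℕ} (hij : i ≤ j) (s : ℕ → X) :
    collapse R j (collapse R i s) = collapse R j s := by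
  by_cases hs : ∀ j, R (s 0) (s j)
  · have h' : ∀ k, R (s (max 0 i)) (s (max k i)) := fun k => hR.trans (hR.symm (hs _)) (hs _)
    rw [collapse_of_class hs, collapse_of_class hs, collapse_of_class h']
    ext k
    rw [max_assoc, max_eq_left hij]
  · rw [collapse_of_not hs i]

theorem countable_collapse (hR : Equivalence R) (hc : ∀ x, {y | R x y}.Countable) (n : ℕ)
    (s : ℕ → X) : {s' | collapse R n s' = s}.Countable := by
  have h1 : {s' : ℕ → X | (∀ k, n ≤ k → s' k = s k) ∧ ∀ k, R (s n) (s' k)}.Countable := by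
    refine MapsTo.countable_of_injOn (f := fun (s' : ℕ → X) (k : Fin n) => s' k)
      (t := pi univ fun _ => {y | R (s n) y}) (fun s' hs' k _ => hs'.2 k) ?_
      (countable_univ_pi fun _ => hc _)
    intro a ha b hb hab
    ext k
    by_cases hk : k < n
    · exact congrFun hab ⟨k, hk⟩
    · rw [ha.1 k (not_lt.1 hk), hb.1 k (not_lt.1 hk)]
  refine (h1.union (countable_singleton s)).mono fun s' hs' => ?_
  by_cases h : ∀ j, R (s' 0) (s' j)
  · have e : ∀ k, s' (max k n) = s k := fun k => by
      rw [← (hs' : collapse R n s' = s), collapse_of_class h]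
    refine Or.inl ⟨fun k hk => by rw [← e k, max_eq_left hk], fun k => ?_⟩
    rw [← e n]
    exact hR.trans (hR.symm (h _)) (h k)
  · exact Or.inr ((collapse_of_not h n).symm.trans hs')

theorem Reiter.medial (hR : Equivalence R) (hB : MeasurableSet {p : X × X | R p.1 p.2})
    (hc : ∀ x, {y | R x y}.Countable)
    (hT : ∀ (M : ℕ → ℕ) [∀ k, NeZero (M k)], Medial (bern M) (Tail (A := fun k => Fin (M k))))
    (κ : Measure X) [IsProbabilityMeasure κ] {L : ℕ → Kernel X X} (hL : Reiter κ R L) :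
    Medial κ R := by
  obtain ⟨_, hLR, X0, hX0, hL⟩ := hL
  let F : (ℕ → X) → (ℕ → X) → Prop := fun s s' => ∃ n, collapse R n s = collapse R n s'
  have hF : Equivalence F := ⟨fun s => ⟨0, rfl⟩, fun ⟨n, h⟩ => ⟨n, h.symm⟩, fun ⟨n, h⟩ ⟨m, h'⟩ =>
    ⟨max n m, by
      rw [← collapse_collapse hR (le_max_left n m), h, collapse_collapse hR (le_max_left n m),
        ← collapse_collapse hR (le_max_right n m), h', collapse_collapse hR (le_max_right n m)]⟩⟩
  have hmed := medial_chain hT (κ ⊗ₘ piKernel L).snd (measurable_collapse hB)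
    (collapse_zero (R := R)) (fun i j hij w => collapse_collapse hR hij w) (countable_collapse hR hc)
  have hclass : ∀ x, ∀ᵐ s ∂(Measure.infinitePi fun k => L k x), ∀ j, R x (s j) := fun x => by
    refine ae_all_iff.2 fun j => ?_
    have h0 : ∀ᵐ y ∂(L j x), R x y := ae_iff.2 (hLR j x)
    rw [← Measure.infinitePi_map_eval (fun k => L k x) j] at h0
    exact ae_of_ae_map (measurable_pi_apply j).aemeasurable h0
  have hΓ : MeasurableSet {p : X × (ℕ → X) | R p.1 (p.2 0)} :=
    hB.preimage (measurable_fst.prodMk ((measurable_pi_apply 0).comp measurable_snd))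
  refine Medial.transfer (F := F) hF ?_ ?_ hmed κ (piKernel L) Measure.AbsolutelyContinuous.rfl hΓ ?_
    ?_ hR X0 hX0 fun x hx x' hx' hxx' U hU hUF => ?_
  · simp only [F, ofPred_exists]
    exact MeasurableSet.iUnion fun n => measurableSet_eq_fun
      ((measurable_collapse hB n).comp measurable_fst)
      ((measurable_collapse hB n).comp measurable_snd)
  · intro s
    simp only [F, ofPred_exists]
    refine countable_iUnion fun n => ?_
    simp only [eq_comm (a := collapse R n s)]
    exact countable_collapse hR hc n _
  · refine (Measure.ae_compProd_iff hΓ).2 (Eventually.of_forall fun x => ?_)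
    filter_upwards [hclass x] with s hs
    exact hs 0
  · exact fun s => (hc (s 0)).mono fun x hx => hR.symm hx
  · obtain ⟨c, hc1, hc2⟩ := hL x hx x' hxx'
    refine infinitePi_eq_of_tail (fun k => L k x) (fun k => L k x') c hc1 hc2 (hclass x)
      (hclass x') hU fun s hs s' hs' hev => hUF _ _ ?_
    obtain ⟨n, hn⟩ := eventually_atTop.1 hev
    refine ⟨n, ?_⟩
    rw [collapse_of_class fun j => hR.trans (hR.symm (hs 0)) (hs j),
      collapse_of_class fun j => hR.trans (hR.symm (hs' 0)) (hs' j)]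
    ext k
    exact hn _ (le_max_right _ _)

end Chain

theorem isMean_dirac {α : Type*} (a : α) :
    IsMean fun A : Set α => A.indicator (fun _ => (1 : ℝ)) a := by
  refine ⟨fun A => indicator_nonneg (fun _ _ => zero_le_one) _, by simp, fun A B hAB => ?_⟩
  exact congrFun (indicator_union_of_disjoint hAB _) a

/-- It suffices to find an invariant assignment of means up to a null set. -/
theorem muAmenable_of_ae {X : Type*} [MeasurableSpace X] {μ : Measure X} {R : X → X → Prop}
    (hR : Equivalence R) (X0 : Set X) (hX0 : ∀ᵐ x ∂μ, x ∈ X0) (ν : X → Set X → ℝ)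
    (h1 : ∀ x, IsMean (ν x)) (h2 : ∀ x, ν x {y | R x y} = 1)
    (h3 : ∀ x ∈ X0, ∀ x' ∈ X0, R x x' → ν x = ν x')
    (h4 : ∀ A : Set (X × X), MeasurableSet A →
      AEMeasurable (fun x => ν x {y | (x, y) ∈ A}) μ) : MuAmenable μ R := by
  let rep : X → X := fun x => (Quotient.mk ⟨R, hR⟩ x).out
  have hrep : ∀ x, R x (rep x) := fun x =>
    hR.symm (Quotient.exact (s := ⟨R, hR⟩) (Quotient.out_eq (Quotient.mk ⟨R, hR⟩ x)))
  have hrep' : ∀ x x', R x x' → rep x = rep x' := fun x x' h =>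
    congrArg (Quotient.out (s := ⟨R, hR⟩)) (Quotient.sound (s := ⟨R, hR⟩) h)
  obtain ⟨m, e1, e2, e3⟩ := exists_invariant_modification hR X0 (fun x => some (ν x)) none
    fun x hx x' hx' h => congrArg some (h3 x hx x' hx' h)
  let ν' : X → Set X → ℝ := fun x =>
    (m x).getD fun A => A.indicator (fun _ => (1 : ℝ)) (rep x)
  have hν' : ∀ x, IsMean (ν' x) ∧ ν' x {y | R x y} = 1 := fun x => by
    rcases e3 x with h | ⟨y, hxy, h⟩
    · simp only [ν', h, Option.getD_none]
      exact ⟨isMean_dirac _, indicator_of_mem (s := {y | R x y}) (hrep x) _⟩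
    · simp only [ν', h, Option.getD_some]
      have : {z | R x z} = {z | R y z} := by
        ext z
        exact ⟨fun hz => hR.trans (hR.symm hxy) hz, fun hz => hR.trans hxy hz⟩
      exact ⟨h1 y, this ▸ h2 y⟩
  refine ⟨ν', fun x => (hν' x).1.nonneg, fun x => (hν' x).1.univ, fun x => (hν' x).1.add,
    fun x => (hν' x).2, fun x x' h => ?_, fun A hA => (h4 A hA).congr ?_⟩
  · simp only [ν', e2 x x' h, hrep' x x' h]
  · filter_upwards [hX0] with x hx
    simp only [ν', e1 x hx, Option.getD_some]

theorem muAmenable_of_tame {X : Type*} [MeasurableSpace X] {μ : Measure X} {R : X → X → Prop}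
    (hR : Equivalence R) (h : Tame μ R) : MuAmenable μ R := by
  classical
  obtain ⟨s, X0, hs, hX0, hsR, hinv⟩ := h
  let t : X → X := fun x => if x ∈ X0 then s x else x
  have ht : ∀ x, R x (t x) := fun x => by
    by_cases hx : x ∈ X0
    · simp only [t, if_pos hx]
      exact hsR x hx
    · simp only [t, if_neg hx]
      exact hR.refl x
  refine muAmenable_of_ae hR X0 hX0 (fun x A => A.indicator (fun _ => (1 : ℝ)) (t x))
    (fun x => isMean_dirac _) (fun x => indicator_of_mem (s := {y | R x y}) (ht x) _)
    (fun x hx x' hx' h => ?_) fun A hA => ?_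
  · simp only [t, if_pos hx, if_pos hx', hinv x hx x' hx' h]
  · have hm : Measurable fun x => A.indicator (fun _ => (1 : ℝ)) (x, s x) :=
      (measurable_const.indicator hA).comp (measurable_id.prodMk hs)
    refine hm.aemeasurable.congr ?_
    filter_upwards [hX0] with x hx
    simp only [t, if_pos hx]
    rfl

theorem Tame.prod {X Y : Type*} [MeasurableSpace X] [MeasurableSpace Y] {μ : Measure X}
    {ν : Measure Y} [SFinite μ] [SFinite ν] {E : X → X → Prop} {F : Y → Y → Prop}
    (hE : Tame μ E) (hF : Tame ν F) :
    Tame (μ.prod ν) fun p q : X × Y => E p.1 q.1 ∧ F p.2 q.2 := by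
  obtain ⟨s, X0, hs, hX0, hsE, hsi⟩ := hE
  obtain ⟨t, Y0, ht, hY0, htF, hti⟩ := hF
  exact ⟨fun p => (s p.1, t p.2), {p | p.1 ∈ X0 ∧ p.2 ∈ Y0},
    (hs.comp measurable_fst).prodMk (ht.comp measurable_snd),
    (Measure.quasiMeasurePreserving_fst.ae hX0).and (Measure.quasiMeasurePreserving_snd.ae hY0),
    fun p hp => ⟨hsE _ hp.1, htF _ hp.2⟩, fun p hp q hq h =>
      Prod.ext (hsi _ hp.1 _ hq.1 h.1) (hti _ hp.2 _ hq.2 h.2)⟩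

/-- Nonprincipal means do not see finitely many terms. -/
theorem IsPosFun.le_of_eventually_le {Λ : (ℕ → ℝ) → ℝ} (hΛ : IsPosFun Λ)
    (h0 : ∀ A : Set ℕ, A.Finite → Λ (A.indicator 1) = 0) {f g : ℕ → ℝ}
    (hf : ∀ n, f n ∈ Icc (0 : ℝ) 1) (hg : ∀ n, g n ∈ Icc (0 : ℝ) 1)
    (h : ∀ ε > 0, ∀ᶠ n in atTop, f n ≤ g n + ε) : Λ f ≤ Λ g := by
  refine le_of_forall_pos_le_add fun ε hε => ?_
  obtain ⟨N, hN⟩ := eventually_atTop.1 (h ε hε)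
  have hb := Bdd.indicator (Iio N)
  have := hΛ.mono (Bdd.of_mem hf) (((Bdd.of_mem hg).add (Bdd.const ε)).add hb) fun n => by
    by_cases hn : n < N
    · have : (Iio N).indicator (1 : ℕ → ℝ) n = 1 := indicator_of_mem (s := Iio N) hn _
      linarith [(hf n).2, (hg n).1]
    · have : (Iio N).indicator (1 : ℕ → ℝ) n = 0 := indicator_of_notMem (s := Iio N) hn _
      linarith [hN n (not_lt.1 hn)]
  rw [hΛ.add _ _ ((Bdd.of_mem hg).add (Bdd.const ε)) hb, hΛ.add _ _ (Bdd.of_mem hg) (Bdd.const ε),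
    hΛ.const, h0 _ (finite_Iio N), add_zero] at this
  exact this

section

variable {X : Type*} [MeasurableSpace X] [StandardBorelSpace X] {R : X → X → Prop}

/-- Reiter kernels can be averaged along an invariant field of nonprincipal means. -/
theorem Reiter.muAmenable (hR : Equivalence R) (hB : MeasurableSet {p : X × X | R p.1 p.2})
    (hc : ∀ x, {y | R x y}.Countable) {μ : Measure X} {L : ℕ → Kernel X X} (hL : Reiter μ R L)
    (hm : Medial μ R) : MuAmenable μ R := by
  classical
  obtain ⟨_, hLR, X0, hX0, hL⟩ := hL
  obtain ⟨m, m1, m2, m3, m4⟩ := hm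
  have hex : ∀ w : Set ℕ → ℝ, ∃ Λ : (ℕ → ℝ) → ℝ, IsMean w →
      IsPosFun Λ ∧ ∀ A, Λ (A.indicator 1) = w A := fun w => by
    by_cases hw : IsMean w
    · obtain ⟨Λ, h, h'⟩ := exists_functional ⊤ w (fun A _ => hw.nonneg A) hw.univ
        fun A B _ _ => hw.add A B
      exact ⟨Λ, fun _ => ⟨h, fun A => h' A trivial⟩⟩
    · exact ⟨0, fun h => absurd h hw⟩
  choose Λ hΛ using hex
  have hΛ1 : ∀ x, IsPosFun (Λ (m x)) := fun x => (hΛ _ (m1 x)).1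
  have hΛ2 : ∀ x A, Λ (m x) (A.indicator 1) = m x A := fun x => (hΛ _ (m1 x)).2
  let f : X → Set X → ℕ → ℝ := fun x A n => (L n x).real (A ∩ {y | R x y})
  have hf : ∀ x A n, f x A n ∈ Icc (0 : ℝ) 1 := fun x A n =>
    ⟨measureReal_nonneg, measureReal_le_one⟩
  have hmeas : ∀ x A, MeasurableSet (A ∩ {y | R x y}) := fun x A =>
    ((hc x).mono inter_subset_right).measurableSet
  have hclass : ∀ x n, (L n x).real {y | R x y} = 1 := fun x n => by
    have hm : MeasurableSet {y | R x y} := (hc x).measurableSet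
    rw [measureReal_def, (prob_compl_eq_zero_iff hm).1 (hLR n x), ENNReal.toReal_one]
  have hle : ∀ x ∈ X0, ∀ x', R x x' → ∀ A, Λ (m x) (f x A) ≤ Λ (m x) (f x' A) :=
    fun x hx x' hxx' A => by
    refine (hΛ1 x).le_of_eventually_le (fun B hB => ?_) (hf x A) (hf x' A) fun ε hε => ?_
    · rw [hΛ2, (m1 x).finite_null (m2 x) hB]
    obtain ⟨c, hc1, hc2⟩ := hL x hx x' hxx'
    filter_upwards [(ENNReal.tendsto_atTop_zero_of_tsum_ne_top hc1).eventually_le_const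
      (ENNReal.ofReal_pos.2 hε)] with n hn
    have hcl : {y | R x y} = {y | R x' y} := by
      ext z
      exact ⟨fun hz => hR.trans (hR.symm hxx') hz, fun hz => hR.trans hxx' hz⟩
    simp only [f, ← hcl, measureReal_def]
    rw [← ENNReal.toReal_ofReal hε.le, ← ENNReal.toReal_add (measure_ne_top _ _) ENNReal.ofReal_ne_top]
    exact ENNReal.toReal_mono (ENNReal.add_ne_top.2 ⟨measure_ne_top _ _, ENNReal.ofReal_ne_top⟩)
      ((hc2 n _ (hmeas x A)).trans (add_le_add_right hn _))
  refine muAmenable_of_ae hR X0 hX0 (fun x A => Λ (m x) (f x A)) (fun x => ⟨fun A => ?_, ?_,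
    fun A B hAB => ?_⟩) (fun x => ?_) (fun x hx x' hx' h => ?_) fun A hA => ?_
  · exact (hΛ1 x).nonneg _ (Bdd.of_mem (hf x A)) fun n => (hf x A n).1
  · have : f x univ = fun _ => 1 := by
      ext n
      simp only [f, univ_inter, hclass]
    rw [this, (hΛ1 x).one]
  · rw [← (hΛ1 x).add _ _ (Bdd.of_mem (hf x A)) (Bdd.of_mem (hf x B))]
    congr 1
    ext n
    simp only [f, union_inter_distrib_right]
    exact measureReal_union (hAB.mono inter_subset_left inter_subset_left) (hmeas x B)
  · have : f x {y | R x y} = fun _ => 1 := by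
      ext n
      simp only [f, inter_self, hclass]
    rw [this, (hΛ1 x).one]
  · ext A
    refine le_antisymm ?_ ?_
    · rw [← m3 x x' h]
      exact hle x hx x' h A
    · rw [m3 x x' h]
      exact hle x' hx' x (hR.symm h) A
  · have hfm : Measurable fun p : X × ℕ => f p.1 {y | (p.1, y) ∈ A} p.2 :=
      measurable_from_prod_countable_left fun n =>
        (Kernel.measurable_kernel_prodMk_left (κ := L n) (hA.inter hB)).ennreal_toReal
    refine aemeasurable_of_tendsto_metrizable_ae atTop (f := fun (N : ℕ) x =>
      ((N : ℝ) + 1)⁻¹ * ∑ i ∈ Finset.range (N + 1),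
        m x {n | (x, n) ∈ {p : X × ℕ | (i : ℝ) / (N + 1) < f p.1 {y | (p.1, y) ∈ A} p.2}})
      (fun N => ?_) (Eventually.of_forall fun x => ?_)
    · exact (Finset.aemeasurable_fun_sum _ fun i _ =>
        m4 _ (measurableSet_lt measurable_const hfm)).const_mul _
    · have := (hΛ1 x).tendsto_layer (hf x {y | (x, y) ∈ A})
      simp only [hΛ2] at this
      exact this

end

theorem muAmenable_mono_ac {X : Type*} [MeasurableSpace X] {μ μ' : Measure X} {R : X → X → Prop}
    (h : MuAmenable μ R) (hac : μ' ≪ μ) : MuAmenable μ' R := by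
  obtain ⟨ν, h1, h2, h3, h4, h5, h6⟩ := h
  exact ⟨ν, h1, h2, h3, h4, h5, fun A hA => (h6 A hA).mono_ac hac⟩

theorem muAmenable_prod_of_isProbabilityMeasure {X Y : Type*} [MeasurableSpace X]
    [StandardBorelSpace X] [MeasurableSpace Y] [StandardBorelSpace Y] (μ : Measure X)
    [IsProbabilityMeasure μ] (ν : Measure Y) [IsProbabilityMeasure ν]
    {E : X → X → Prop} (hE : Equivalence E) (hEB : MeasurableSet {p : X × X | E p.1 p.2})
    (hEc : ∀ x, {y | E x y}.Countable)
    {F : Y → Y → Prop} (hF : Equivalence F) (hFB : MeasurableSet {p : Y × Y | F p.1 p.2})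
    (hFc : ∀ x, {y | F x y}.Countable) (hμ : MuAmenable μ E) (hν : MuAmenable ν F) :
    MuAmenable (μ.prod ν) fun p q : X × Y => E p.1 q.1 ∧ F p.2 q.2 := by
  have hR : Equivalence fun p q : X × Y => E p.1 q.1 ∧ F p.2 q.2 :=
    ⟨fun p => ⟨hE.refl _, hF.refl _⟩, fun h => ⟨hE.symm h.1, hF.symm h.2⟩,
      fun h h' => ⟨hE.trans h.1 h'.1, hF.trans h.2 h'.2⟩⟩
  have hRB : MeasurableSet {p : (X × Y) × (X × Y) | E p.1.1 p.2.1 ∧ F p.1.2 p.2.2} :=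
    (hEB.preimage
      ((measurable_fst.comp measurable_fst).prodMk (measurable_fst.comp measurable_snd))).inter
    (hFB.preimage
      ((measurable_snd.comp measurable_fst).prodMk (measurable_snd.comp measurable_snd)))
  have hRc : ∀ p : X × Y, {q : X × Y | E p.1 q.1 ∧ F p.2 q.2}.Countable := fun p =>
    (hEc p.1).prod (hFc p.2)
  obtain ⟨L, hL⟩ := exists_reiter hE hEB hEc μ hμ
  obtain ⟨M, hM⟩ := exists_reiter hF hFB hFc ν hν
  have key := fun hT => (hL.prod hM).muAmenable hR hRB hRc ((hL.prod hM).medial hR hRB hRc hT _)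
  rcases tame_or_medial_tail hE hEB hEc μ hμ with h1 | hT
  · rcases tame_or_medial_tail hF hFB hFc ν hν with h2 | hT
    · exact muAmenable_of_tame hR (h1.prod h2)
    · exact key hT
  · exact key hT

end AmenProd

/-- The product of a μ₁-amenable countable Borel equivalence relation and a
μ₂-amenable countable Borel equivalence relation is amenable with respect to the product
measure μ₁ ⊗ μ₂. -/
theorem mu_amenable_prod
    {X₁ : Type*} [MeasurableSpace X₁] [StandardBorelSpace X₁]
    {X₂ : Type*} [MeasurableSpace X₂] [StandardBorelSpace X₂]
    (μ₁ : Measure X₁) [SigmaFinite μ₁] (μ₂ : Measure X₂) [SigmaFinite μ₂]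
    (E₁ : X₁ → X₁ → Prop) (hE₁Equiv : Equivalence E₁)
    (hE₁Borel : MeasurableSet {p : X₁ × X₁ | E₁ p.1 p.2})
    (hE₁Ctble : ∀ x, {y | E₁ x y}.Countable)
    (E₂ : X₂ → X₂ → Prop) (hE₂Equiv : Equivalence E₂)
    (hE₂Borel : MeasurableSet {p : X₂ × X₂ | E₂ p.1 p.2})
    (hE₂Ctble : ∀ x, {y | E₂ x y}.Countable)
    (h₁ : MuAmenable μ₁ E₁) (h₂ : MuAmenable μ₂ E₂) :
    MuAmenable (μ₁.prod μ₂) (fun p q : X₁ × X₂ => E₁ p.1 q.1 ∧ E₂ p.2 q.2) := by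
  have hR : Equivalence fun p q : X₁ × X₂ => E₁ p.1 q.1 ∧ E₂ p.2 q.2 :=
    ⟨fun p => ⟨hE₁Equiv.refl _, hE₂Equiv.refl _⟩, fun h => ⟨hE₁Equiv.symm h.1, hE₂Equiv.symm h.2⟩,
      fun h h' => ⟨hE₁Equiv.trans h.1 h'.1, hE₂Equiv.trans h.2 h'.2⟩⟩
  by_cases h0 : μ₁ = 0 ∨ μ₂ = 0
  · have hz : μ₁.prod μ₂ = 0 := by
      rcases h0 with rfl | rfl <;> simp
    refine AmenProd.muAmenable_of_tame hR ⟨id, ∅, measurable_id, ?_, by simp, by simp⟩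
    rw [hz]
    simp
  have hn₁ : NeZero μ₁ := ⟨fun h => h0 (Or.inl h)⟩
  have hn₂ : NeZero μ₂ := ⟨fun h => h0 (Or.inr h)⟩
  exact AmenProd.muAmenable_mono_ac (AmenProd.muAmenable_prod_of_isProbabilityMeasure μ₁.toFinite
    μ₂.toFinite hE₁Equiv hE₁Borel hE₁Ctble hE₂Equiv hE₂Borel hE₂Ctble
    (AmenProd.muAmenable_mono_ac h₁ (toFinite_absolutelyContinuous μ₁))
    (AmenProd.muAmenable_mono_ac h₂ (toFinite_absolutelyContinuous μ₂)))
    ((absolutelyContinuous_toFinite μ₁).prod (absolutelyContinuous_toFinite μ₂))
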